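/- arXiv:1709.04435 — 3 statements merged into one kernel-verified Lean document; each statement's English description precedes it below -/
import Mathlib

section
/- Let K be a commutative Noetherian ring with identity, let A be an associative K-algebra (not necessarily commutative or unital), and let B be a K-subalgebra of A such that the quotient K-module A/B is finitely generated. Then A is finitely presented as a K-algebra if and only if B is finitely presented as a K-algebra. -/
/-- The free non-unital associative `K`-algebra on `X`: the semigroup algebra of the free
semigroup `X⁺` over `K`. -/
abbrev FreeNUAlg (K X : Type*) [CommRing K] : Type _ := MonoidAlgebra K (FreeSemigroup X)

/-- The two-sided ideal (as a `K`-submodule closed under left and right multiplication)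
generated by a set in a non-unital `K`-algebra. -/
def idealSpan (K : Type*) {A : Type*} [CommRing K] [NonUnitalRing A] [Module K A]
    (s : Set A) : Submodule K A :=
  sInf {J : Submodule K A | s ⊆ J ∧ ∀ a b : A, b ∈ J → a * b ∈ J ∧ b * a ∈ J}

/-- A non-unital `K`-algebra is finitely generated if some finite subset generates it as a
`K`-algebra. -/
def NUAlgFG (K A : Type*) [CommRing K] [NonUnitalRing A] [Module K A]
    [IsScalarTower K A A] [SMulCommClass K A A] : Prop :=
  ∃ s : Finset A, NonUnitalAlgebra.adjoin K (s : Set A) = ⊤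

/-- A non-unital `K`-algebra is finitely presented if it is isomorphic to the quotient of a
free algebra `K⟨X⟩` on a finite set `X` by a finitely generated two-sided ideal, i.e. there
is a surjection from some `K⟨X⟩`, `X` finite, whose kernel is a finitely generated
two-sided ideal. -/
def NUAlgFP (K A : Type*) [CommRing K] [NonUnitalRing A] [Module K A]
    [IsScalarTower K A A] [SMulCommClass K A A] : Prop :=
  ∃ (n : ℕ) (f : FreeNUAlg K (Fin n) →ₙₐ[K] A),
    Function.Surjective f ∧
      ∃ s : Finset (FreeNUAlg K (Fin n)),
        ∀ x, f x = 0 ↔ x ∈ idealSpan K (s : Set (FreeNUAlg K (Fin n)))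

set_option linter.unusedSectionVars false

section Basics

variable {K : Type*} [CommRing K] {Z : Type*}
  {A : Type*} [NonUnitalRing A] [Module K A] [IsScalarTower K A A] [SMulCommClass K A A]
  {A' : Type*} [NonUnitalRing A'] [Module K A'] [IsScalarTower K A' A'] [SMulCommClass K A' A']

/-- word in the free algebra -/
noncomputable def wd (K : Type*) [CommRing K] {Z : Type*} (w : FreeSemigroup Z) : FreeNUAlg K Z :=
  MonoidAlgebra.single w 1

/-- generator of the free algebra -/
noncomputable def fo (K : Type*) [CommRing K] {Z : Type*} (z : Z) : FreeNUAlg K Z :=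
  wd K (FreeSemigroup.of z)

/-- lift to the free algebra -/
noncomputable def fl (K : Type*) [CommRing K] {Z : Type*}
    {A : Type*} [NonUnitalRing A] [Module K A] [IsScalarTower K A A] [SMulCommClass K A A]
    (t : Z → A) : FreeNUAlg K Z →ₙₐ[K] A :=
  MonoidAlgebra.liftMagma K (FreeSemigroup.lift t)

theorem wd_mul (v w : FreeSemigroup Z) : wd K (v * w) = wd K v * wd K w := by
  simp [wd]

theorem fl_fo (t : Z → A) (z : Z) : fl K t (fo K z) = t z := by
  simp [fl, fo, wd]

theorem span_wd : Submodule.span K (Set.range (wd K : FreeSemigroup Z → _)) = ⊤ := by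
  rw [eq_top_iff]
  intro x _
  induction x using MonoidAlgebra.induction_linear with
  | zero => exact zero_mem _
  | add f g hf hg => exact add_mem (hf trivial) (hg trivial)
  | single m r =>
    have : (MonoidAlgebra.single m r : FreeNUAlg K Z) = r • wd K m := by
      simp [wd]
    rw [this]
    exact Submodule.smul_mem _ _ (Submodule.subset_span ⟨m, rfl⟩)

theorem mem_of_wd (M : Submodule K (FreeNUAlg K Z)) (h : ∀ w, wd K w ∈ M) (x) : x ∈ M := by
  have : (⊤ : Submodule K (FreeNUAlg K Z)) ≤ M := by
    rw [← span_wd, Submodule.span_le]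
    rintro _ ⟨w, rfl⟩
    exact h w
  exact this trivial

theorem free_induction (M : Submodule K (FreeNUAlg K Z)) (h1 : ∀ z, fo K z ∈ M)
    (h2 : ∀ z, ∀ m ∈ M, fo K z * m ∈ M) (x) : x ∈ M := by
  refine mem_of_wd M (fun w => ?_) x
  induction w with
  | ih1 z => exact h1 z
  | ih2 z w _ h => rw [wd_mul]; exact h2 z _ h

theorem free_ext (f g : FreeNUAlg K Z →ₙₐ[K] A) (h : ∀ z, f (fo K z) = g (fo K z)) (x) :
    f x = g x := by
  refine free_induction (LinearMap.eqLocus (f : _ →ₗ[K] A) (g : _ →ₗ[K] A)) ?_ ?_ x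
  · exact h
  · intro z m hm
    have hm : f m = g m := hm
    change f _ = g _
    rw [map_mul, map_mul, h, hm]

theorem idealSpan_mul (s : Set A) {a b : A} (hb : b ∈ idealSpan K s) :
    a * b ∈ idealSpan K s ∧ b * a ∈ idealSpan K s := by
  simp only [idealSpan, Submodule.mem_sInf] at hb ⊢
  exact ⟨fun J hJ => (hJ.2 a b (hb J hJ)).1, fun J hJ => (hJ.2 a b (hb J hJ)).2⟩

theorem subset_idealSpan {s : Set A} {a : A} (h : a ∈ s) : a ∈ idealSpan K s := by
  simp only [idealSpan, Submodule.mem_sInf]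
  exact fun J hJ => hJ.1 h

theorem idealSpan_le {s : Set A} {J : Submodule K A} (h : s ⊆ J)
    (h2 : ∀ a b : A, b ∈ J → a * b ∈ J ∧ b * a ∈ J) : idealSpan K s ≤ J :=
  sInf_le ⟨h, h2⟩

theorem idealSpan_map (f : A →ₙₐ[K] A') {s : Set A} {t : Set A'}
    (h : ∀ a ∈ s, f a ∈ idealSpan K t) {x : A} (hx : x ∈ idealSpan K s) :
    f x ∈ idealSpan K t := by
  have : idealSpan K s ≤ (idealSpan K t).comap (f : A →ₗ[K] A') := by
    refine idealSpan_le (fun a ha => h a ha) (fun a b hb => ?_)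
    have hb : f b ∈ idealSpan K t := hb
    constructor
    · change f _ ∈ idealSpan K t
      rw [map_mul]; exact (idealSpan_mul t hb).1
    · change f _ ∈ idealSpan K t
      rw [map_mul]; exact (idealSpan_mul t hb).2
  exact this hx

/-- the kernel of `g` is a finitely generated ideal -/
def FPh {K : Type*} [CommRing K] {A' : Type*} [NonUnitalRing A'] [Module K A']
    {A : Type*} [NonUnitalRing A] [Module K A] (g : A' →ₙₐ[K] A) : Prop :=
  ∃ s : Set A', s.Finite ∧ ∀ x, g x = 0 ↔ x ∈ idealSpan K s

/-- composition of surjections with f.g. kernels -/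
theorem FPh.comp {A'' : Type*} [NonUnitalRing A''] [Module K A'']
    [IsScalarTower K A'' A''] [SMulCommClass K A'' A'']
    {g : A' →ₙₐ[K] A} {h : A'' →ₙₐ[K] A'} (hg : FPh g) (hh : FPh h)
    (hs : Function.Surjective h) : FPh (g.comp h) := by
  obtain ⟨s, sf, hs1⟩ := hg
  obtain ⟨t, tf, ht⟩ := hh
  choose r hr using hs
  refine ⟨t ∪ r '' s, tf.union (sf.image _), fun x => ⟨fun hx => ?_, fun hx => ?_⟩⟩
  · have h1 : h x ∈ idealSpan K s := (hs1 _).1 hx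
    have h2 : idealSpan K s ≤ (idealSpan K (t ∪ r '' s)).map (h : A'' →ₗ[K] A') := by
      refine idealSpan_le (fun a ha => ⟨r a, subset_idealSpan (Or.inr ⟨a, ha, rfl⟩), hr a⟩) ?_
      rintro a _ ⟨b, hb, rfl⟩
      refine ⟨⟨r a * b, (idealSpan_mul _ hb).1, ?_⟩, ⟨b * r a, (idealSpan_mul _ hb).2, ?_⟩⟩
      · change h _ = _ * h _
        rw [map_mul, hr]
      · change h _ = h _ * _
        rw [map_mul, hr]
    obtain ⟨y, hy, hyx⟩ := h2 h1
    have hyx : h y = h x := hyx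
    have h3 : x - y ∈ idealSpan K t := by
      rw [← ht, map_sub, hyx, sub_self]
    have h4 : x - y ∈ idealSpan K (t ∪ r '' s) := by
      have := idealSpan_map (NonUnitalAlgHom.id K A'') (t := t ∪ r '' s)
        (fun a ha => subset_idealSpan (Or.inl ha)) h3
      simpa using this
    simpa using add_mem h4 hy
  · change g (h x) = 0
    rw [hs1]
    refine idealSpan_map h ?_ hx
    rintro a (ha | ⟨b, hb, rfl⟩)
    · rw [(ht a).2 (subset_idealSpan ha)]; exact zero_mem _
    · rw [hr]; exact subset_idealSpan hb

theorem fp_of_finite [Finite Z] (g : FreeNUAlg K Z →ₙₐ[K] A) (hg : FPh g)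
    (hs : Function.Surjective g) : NUAlgFP K A := by
  obtain ⟨n, ⟨e⟩⟩ := Finite.exists_equiv_fin Z
  let h : FreeNUAlg K (Fin n) →ₙₐ[K] FreeNUAlg K Z := fl K (fun i => fo K (e.symm i))
  let h' : FreeNUAlg K Z →ₙₐ[K] FreeNUAlg K (Fin n) := fl K (fun i => fo K (e i))
  have h1 : ∀ x, h (h' x) = x := fun x => by
    refine free_ext (h.comp h') (NonUnitalAlgHom.id K _) (fun z => ?_) x
    simp [h, h', fl_fo]
  have h2 : ∀ x, h' (h x) = x := fun x => by
    refine free_ext (h'.comp h) (NonUnitalAlgHom.id K _) (fun z => ?_) x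
    simp [h, h', fl_fo]
  have hh : FPh h := by
    refine ⟨∅, Set.finite_empty, fun x => ⟨fun hx => ?_, fun hx => ?_⟩⟩
    · rw [← h2 x, hx, map_zero]; exact zero_mem _
    · have : idealSpan K (∅ : Set (FreeNUAlg K (Fin n))) ≤ ⊥ := by
        refine idealSpan_le (Set.empty_subset _) ?_
        rintro a b hb
        simp only [Submodule.mem_bot] at hb
        simp [hb]
      have := this hx
      simp only [Submodule.mem_bot] at this
      rw [this, map_zero]
  have hsur : Function.Surjective h := fun x => ⟨_, h1 x⟩
  obtain ⟨s, sf, hs'⟩ := hg.comp hh hsur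
  refine ⟨n, g.comp h, ?_, sf.toFinset, ?_⟩
  · exact hs.comp hsur
  · simpa using hs'

theorem FPh_of_fp (h : NUAlgFP K A) : ∃ n, ∃ g : FreeNUAlg K (Fin n) →ₙₐ[K] A,
    FPh g ∧ Function.Surjective g := by
  obtain ⟨n, f, hf, s, hs⟩ := h
  exact ⟨n, f, ⟨s, s.finite_toSet, hs⟩, hf⟩

theorem fp_quot {g : A' →ₙₐ[K] A} (hg : FPh g) (hs : Function.Surjective g)
    (h : NUAlgFP K A') : NUAlgFP K A := by
  obtain ⟨n, f, hf, hsf⟩ := FPh_of_fp h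
  exact fp_of_finite (g.comp f) (hg.comp hf hsf) (hs.comp hsf)

/-- complements -/
theorem exists_compl {M : Type*} [AddCommGroup M] [Module K M] [IsNoetherian K M]
    {E : Type*} [AddCommGroup E] [Module K E] (ε : E →ₗ[K] M) :
    ∃ (k : ℕ) (y : Fin k → E), ∀ a, ∃ c : Fin k → K, a - ∑ i, c i • y i ∈ LinearMap.ker ε := by
  have : (LinearMap.range ε).FG := IsNoetherian.noetherian _
  obtain ⟨k, v, hv⟩ := Submodule.fg_iff_exists_fin_generating_family.1 this
  have hv' : ∀ i, v i ∈ LinearMap.range ε := fun i => by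
    rw [← hv]; exact Submodule.subset_span ⟨i, rfl⟩
  choose y hy using hv'
  refine ⟨k, y, fun a => ?_⟩
  have : ε a ∈ Submodule.span K (Set.range v) := by rw [hv]; exact ⟨a, rfl⟩
  obtain ⟨c, hc⟩ := (Submodule.mem_span_range_iff_exists_fun K).1 this
  refine ⟨c, ?_⟩
  simp [hy, hc]

end Basics

section Up

variable {K : Type*} [CommRing K] {Z : Type*}
  {A : Type*} [NonUnitalRing A] [Module K A] [IsScalarTower K A A] [SMulCommClass K A A]

/-- Extending a presentation by finitely many generators spanning a complement. -/
theorem fp_up [IsNoetherianRing K] [Finite Z] (g : FreeNUAlg K Z →ₙₐ[K] A) (hg : FPh g)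
    (k : ℕ) (y : Fin k → A)
    (hy : ∀ a, ∃ (w : FreeNUAlg K Z) (c : Fin k → K), g w + ∑ i, c i • y i = a) :
    FPh (fl K (Sum.elim (fun z => g (fo K z)) y)) ∧
      Function.Surjective (fl K (Sum.elim (fun z => g (fo K z)) y)) := by
  obtain ⟨s, sf, hs⟩ := hg
  set G := fl K (Sum.elim (fun z => g (fo K z)) y) with hG
  let ι : FreeNUAlg K Z →ₙₐ[K] FreeNUAlg K (Z ⊕ Fin k) := fl K (fun z => fo K (Sum.inl z))
  let lin : (Fin k → K) →ₗ[K] FreeNUAlg K (Z ⊕ Fin k) :=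
    Fintype.linearCombination K (fun i => fo K (Sum.inr i))
  have hιo : ∀ z, ι (fo K z) = fo K (Sum.inl z) := fun z => fl_fo _ _
  have hGι : ∀ w, G (ι w) = g w := fun w => by
    refine free_ext (G.comp ι) g (fun z => ?_) w
    simp [ι, hG, fl_fo]
  have hGl : ∀ c, G (lin c) = ∑ i, c i • y i := fun c => by
    simp [lin, hG, Fintype.linearCombination_apply, map_sum, fl_fo]
  choose wa ca hr using hy
  let r : A → FreeNUAlg K (Z ⊕ Fin k) := fun a => ι (wa a) + lin (ca a)
  have hGr : ∀ a, G (r a) = a := fun a => by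
    simp only [r, map_add, hGι, hGl, hr]
  let Rm : Submodule K (Fin k → K) :=
    (LinearMap.range (g : FreeNUAlg K Z →ₗ[K] A)).comap (Fintype.linearCombination K y)
  obtain ⟨e, he⟩ : Rm.FG := IsNoetherian.noetherian _
  have hw : ∀ c : Fin k → K, ∃ w, c ∈ Rm → g w = ∑ i, c i • y i := by
    intro c
    by_cases hc : c ∈ Rm
    · obtain ⟨w, hw⟩ := hc
      exact ⟨w, fun _ => hw⟩
    · exact ⟨0, fun h => absurd h hc⟩
  choose wc hwc using hw
  have heR : ∀ c ∈ e, c ∈ Rm := fun c hc => by rw [← he]; exact Submodule.subset_span hc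
  let S : Set (FreeNUAlg K (Z ⊕ Fin k)) := (ι '' s) ∪
    (Set.range (fun p : (Z ⊕ Fin k) × (Z ⊕ Fin k) =>
      fo K p.1 * fo K p.2 - r (G (fo K p.1 * fo K p.2)))) ∪
    ((fun c => lin c - ι (wc c)) '' (e : Set (Fin k → K)))
  have Sf : S.Finite :=
    ((sf.image _).union (Set.finite_range _)).union (e.finite_toSet.image _)
  have hSG : ∀ x ∈ S, G x = 0 := by
    rintro x ((⟨w, hw, rfl⟩ | ⟨p, rfl⟩) | ⟨c, hc, rfl⟩)
    · rw [hGι]; exact (hs w).2 (subset_idealSpan hw)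
    · simp only [map_sub, hGr, sub_self]
    · simp only [map_sub, hGι, hGl]
      rw [hwc c (heR c hc), sub_self]
  let M : Submodule K (FreeNUAlg K (Z ⊕ Fin k)) :=
    LinearMap.range (ι : FreeNUAlg K Z →ₗ[K] FreeNUAlg K (Z ⊕ Fin k)) ⊔ LinearMap.range lin ⊔ idealSpan K S
  have Mι : ∀ w, ι w ∈ M := fun w =>
    Submodule.mem_sup_left (Submodule.mem_sup_left ⟨w, rfl⟩)
  have Ml : ∀ c, lin c ∈ M := fun c =>
    Submodule.mem_sup_left (Submodule.mem_sup_right ⟨c, rfl⟩)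
  have Mi : ∀ x ∈ idealSpan K S, x ∈ M := fun x hx => Submodule.mem_sup_right hx
  have hlin : ∀ c, lin c = ∑ i, c i • fo K (Sum.inr i) := fun c => by
    simp [lin, Fintype.linearCombination_apply]
  have My : ∀ i, fo K (Sum.inr i) ∈ M := fun i => by
    have := Ml (Pi.single i 1)
    rw [hlin, Finset.sum_eq_single i] at this
    · simpa using this
    · intro j _ hj; simp [hj]
    · simp
  have hMmem : ∀ x ∈ M, ∃ w c n, n ∈ idealSpan K S ∧ x = ι w + lin c + n := by
    intro x hx
    obtain ⟨u, hu, n, hn, rfl⟩ := Submodule.mem_sup.1 hx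
    obtain ⟨_, ⟨w, rfl⟩, _, ⟨c, rfl⟩, rfl⟩ := Submodule.mem_sup.1 hu
    exact ⟨w, c, n, hn, rfl⟩
  have hrel : ∀ p q, ∃ w c n, n ∈ idealSpan K S ∧ fo K p * fo K q = ι w + lin c + n := by
    intro p q
    refine ⟨wa (G (fo K p * fo K q)), ca (G (fo K p * fo K q)),
      fo K p * fo K q - r (G (fo K p * fo K q)),
      subset_idealSpan (Or.inl (Or.inr ⟨(p, q), rfl⟩)), ?_⟩
    change _ = r (G (fo K p * fo K q)) + _
    abel
  have Mpq : ∀ p q, fo K p * fo K q ∈ M := by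
    intro p q
    obtain ⟨w, c, n, hn, h⟩ := hrel p q
    rw [h]
    exact add_mem (add_mem (Mι _) (Ml _)) (Mi _ hn)
  have Myι : ∀ w i, fo K (Sum.inr i) * ι w ∈ M := by
    have key : ∀ w : FreeSemigroup Z, ∀ i, fo K (Sum.inr i) * ι (wd K w) ∈ M := by
      intro w
      induction w with
      | ih1 z => intro i; exact (hιo z).symm ▸ Mpq _ _
      | ih2 z v _ ih =>
        intro i
        obtain ⟨w, c, n, hn, h⟩ := hrel (Sum.inr i) (Sum.inl z)
        have h1 : ι (wd K (FreeSemigroup.of z)) = fo K (Sum.inl z) := hιo z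
        rw [wd_mul, map_mul, h1, ← mul_assoc, h, add_mul, add_mul, ← map_mul]
        refine add_mem (add_mem (Mι _) ?_) (Mi _ (idealSpan_mul S hn).2)
        rw [hlin, Finset.sum_mul]
        refine sum_mem fun j _ => ?_
        rw [smul_mul_assoc]
        exact Submodule.smul_mem _ _ (ih j)
    intro w i
    exact mem_of_wd (M.comap ((LinearMap.mulLeft K (fo K (Sum.inr i))).comp (ι : FreeNUAlg K Z →ₗ[K] FreeNUAlg K (Z ⊕ Fin k))))
      (fun v => key v i) w
  have Mtop : ∀ x, x ∈ M := by
    refine free_induction M ?_ ?_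
    · rintro (z | i)
      · rw [← hιo]; exact Mι _
      · exact My i
    · intro p m hm
      obtain ⟨w, c, n, hn, rfl⟩ := hMmem m hm
      rw [mul_add, mul_add]
      refine add_mem (add_mem ?_ ?_) (Mi _ (idealSpan_mul S hn).1)
      · rcases p with z | i
        · rw [← hιo, ← map_mul]; exact Mι _
        · exact Myι w i
      · rw [hlin, Finset.mul_sum]
        refine sum_mem fun j _ => ?_
        rw [mul_smul_comm]
        exact Submodule.smul_mem _ _ (Mpq _ _)
  refine ⟨⟨S, Sf, fun x => ⟨fun hx => ?_, fun hx => ?_⟩⟩, fun a => ⟨r a, hGr a⟩⟩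
  · have hN : ∀ n ∈ idealSpan K S, G n = 0 := fun n hn => by
      have := idealSpan_map G (t := ∅) (s := S)
        (fun a ha => by rw [hSG a ha]; exact zero_mem _) hn
      have h0 : idealSpan K (∅ : Set A) ≤ ⊥ := by
        refine idealSpan_le (Set.empty_subset _) ?_
        rintro a b hb
        simp only [Submodule.mem_bot] at hb
        simp [hb]
      simpa using h0 this
    obtain ⟨w, c, n, hn, rfl⟩ := hMmem x (Mtop x)
    rw [map_add, map_add, hN n hn, add_zero, hGι, hGl] at hx
    have hc : c ∈ Rm := ⟨-w, by
      change g (-w) = Fintype.linearCombination K y c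
      rw [map_neg, Fintype.linearCombination_apply]
      exact (eq_neg_of_add_eq_zero_right hx).symm⟩
    have hcw : ∃ v, lin c - ι v ∈ idealSpan K S ∧ g v = ∑ i, c i • y i := by
      rw [← he] at hc
      clear hx
      induction hc using Submodule.span_induction with
      | mem c hc => exact ⟨wc c, subset_idealSpan (Or.inr ⟨c, hc, rfl⟩), hwc c (heR c hc)⟩
      | zero => exact ⟨0, by simp, by simp⟩
      | add a b _ _ ha hb =>
        obtain ⟨v, h1, h2⟩ := ha
        obtain ⟨v', h1', h2'⟩ := hb
        refine ⟨v + v', ?_, ?_⟩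
        · have := add_mem h1 h1'
          rw [map_add, map_add]
          convert this using 1
          abel
        · simp [h2, h2', add_smul, Finset.sum_add_distrib]
      | smul t a _ ha =>
        obtain ⟨v, h1, h2⟩ := ha
        refine ⟨t • v, ?_, ?_⟩
        · have := Submodule.smul_mem _ t h1
          rwa [smul_sub, ← map_smul, ← map_smul] at this
        · simp [h2, Finset.smul_sum, smul_smul]
    obtain ⟨v, h1, h2⟩ := hcw
    have h3 : g (w + v) = 0 := by rw [map_add, h2, hx]
    have h4 : ι (w + v) ∈ idealSpan K S :=
      idealSpan_map ι (fun a ha => subset_idealSpan (Or.inl (Or.inl ⟨a, ha, rfl⟩))) ((hs _).1 h3)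
    have : ι w + lin c + n = ι (w + v) + (lin c - ι v) + n := by
      rw [map_add]; abel
    rw [this]
    exact add_mem (add_mem h4 h1) hn
  · have := idealSpan_map G (t := ∅) (s := S)
        (fun a ha => by rw [hSG a ha]; exact zero_mem _) hx
    have h0 : idealSpan K (∅ : Set A) ≤ ⊥ := by
      refine idealSpan_le (Set.empty_subset _) ?_
      rintro a b hb
      simp only [Submodule.mem_bot] at hb
      simp [hb]
    simpa using h0 this

/-- The kernel ideal stays finitely generated in a subalgebra of finite corank. -/
theorem ker_fg_sub {A' : Type*} [NonUnitalRing A'] [Module K A']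
    [IsScalarTower K A' A'] [SMulCommClass K A' A']
    (f : A' →ₙₐ[K] A) (hf : FPh f) (B : NonUnitalSubalgebra K A)
    (k : ℕ) (y : Fin k → A')
    (hy : ∀ a, ∃ c : Fin k → K, f (a - ∑ i, c i • y i) ∈ B)
    (q : B.comap f →ₙₐ[K] B) (hq : ∀ x, (q x : A) = f x) : FPh q := by
  obtain ⟨s, sf, hs⟩ := hf
  let J := B.comap f
  have hJ : ∀ x, x ∈ J ↔ f x ∈ B := fun x => NonUnitalSubalgebra.mem_comap _ _ _
  let s1 : Set A' := s ∪ Set.image2 (fun i r => y i * r) Set.univ s ∪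
    Set.image2 (fun i r => r * y i) Set.univ s ∪
    Set.image2 (fun (p : Fin k × Fin k) r => y p.1 * r * y p.2) Set.univ s
  have s1f : s1.Finite :=
    ((sf.union (Set.Finite.image2 _ Set.finite_univ sf)).union
      (Set.Finite.image2 _ Set.finite_univ sf)).union (Set.Finite.image2 _ Set.finite_univ sf)
  have hs0 : ∀ r ∈ s, f r = 0 := fun r hr => (hs r).2 (subset_idealSpan hr)
  have hs1 : ∀ r ∈ s1, f r = 0 := by
    rintro r (((h | ⟨i, _, r, h, rfl⟩) | ⟨i, _, r, h, rfl⟩) | ⟨i, _, r, h, rfl⟩)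
    · exact hs0 r h
    all_goals simp [hs0 r h]
  let s' : Set J := (Subtype.val) ⁻¹' s1
  have sprf : s'.Finite := s1f.preimage Subtype.val_injective.injOn
  let L : Submodule K A' := (idealSpan K s').map (NonUnitalSubalgebraClass.subtype J : J →ₗ[K] A')
  have Lmem : ∀ x, x ∈ L ↔ ∃ h : x ∈ J, (⟨x, h⟩ : J) ∈ idealSpan K s' := by
    intro x
    constructor
    · rintro ⟨z, hz, rfl⟩
      exact ⟨z.2, hz⟩
    · rintro ⟨h, h'⟩
      exact ⟨_, h', rfl⟩
  have Ls1 : ∀ r ∈ s1, r ∈ L := fun r hr => (Lmem r).2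
    ⟨(hJ r).2 (by rw [hs1 r hr]; exact zero_mem _), subset_idealSpan hr⟩
  have LJ : ∀ j ∈ J, ∀ x ∈ L, j * x ∈ L ∧ x * j ∈ L := by
    intro j hj x hx
    obtain ⟨h, h'⟩ := (Lmem x).1 hx
    exact ⟨(Lmem _).2 ⟨mul_mem hj h, (idealSpan_mul s' h' (a := ⟨j, hj⟩)).1⟩,
      (Lmem _).2 ⟨mul_mem h hj, (idealSpan_mul s' h' (a := ⟨j, hj⟩)).2⟩⟩
  have hdec : ∀ a, ∃ j ∈ J, ∃ c : Fin k → K, a = j + ∑ i, c i • y i := by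
    intro a
    obtain ⟨c, hc⟩ := hy a
    exact ⟨_, (hJ _).2 hc, c, by abel⟩
  have left : ∀ x ∈ L, (∀ i, y i * x ∈ L) → ∀ a, a * x ∈ L := by
    intro x hx h a
    obtain ⟨j, hj, c, rfl⟩ := hdec a
    rw [add_mul, Finset.sum_mul]
    refine add_mem (LJ j hj x hx).1 (sum_mem fun i _ => ?_)
    rw [smul_mul_assoc]
    exact Submodule.smul_mem _ _ (h i)
  have right : ∀ x ∈ L, (∀ i, x * y i ∈ L) → ∀ a, x * a ∈ L := by
    intro x hx h a
    obtain ⟨j, hj, c, rfl⟩ := hdec a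
    rw [mul_add, Finset.mul_sum]
    refine add_mem (LJ j hj x hx).2 (sum_mem fun i _ => ?_)
    rw [mul_smul_comm]
    exact Submodule.smul_mem _ _ (h i)
  have g1 : ∀ r ∈ s, r ∈ L := fun r hr => Ls1 r (Or.inl (Or.inl (Or.inl hr)))
  have g2 : ∀ r ∈ s, ∀ i, y i * r ∈ L := fun r hr i =>
    Ls1 _ (Or.inl (Or.inl (Or.inr ⟨i, trivial, r, hr, rfl⟩)))
  have g3 : ∀ r ∈ s, ∀ i, r * y i ∈ L := fun r hr i =>
    Ls1 _ (Or.inl (Or.inr ⟨i, trivial, r, hr, rfl⟩))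
  have g4 : ∀ r ∈ s, ∀ i j, y i * r * y j ∈ L := fun r hr i j =>
    Ls1 _ (Or.inr ⟨(i, j), trivial, r, hr, rfl⟩)
  have k2 : ∀ r ∈ s, ∀ a, a * r ∈ L := fun r hr => left r (g1 r hr) (g2 r hr)
  have k3 : ∀ r ∈ s, ∀ a, r * a ∈ L := fun r hr => right r (g1 r hr) (g3 r hr)
  have k4 : ∀ r ∈ s, ∀ a b, a * r * b ∈ L := by
    intro r hr a b
    refine right _ (k2 r hr a) (fun i => ?_) b
    rw [mul_assoc]
    refine left _ (g3 r hr i) (fun j => ?_) a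
    rw [← mul_assoc]
    exact g4 r hr j i
  let T : Submodule K J :=
    { carrier := {x | (x : A') ∈ L ∧ (∀ a, a * (x : A') ∈ L) ∧ (∀ a, (x : A') * a ∈ L) ∧
        ∀ a b, a * (x : A') * b ∈ L}
      zero_mem' := by simp
      add_mem' := by
        rintro x z ⟨a1, a2, a3, a4⟩ ⟨b1, b2, b3, b4⟩
        refine ⟨add_mem a1 b1, fun a => ?_, fun a => ?_, fun a b => ?_⟩
        · simpa [mul_add] using add_mem (a2 a) (b2 a)
        · simpa [add_mul] using add_mem (a3 a) (b3 a)
        · simpa [mul_add, add_mul] using add_mem (a4 a b) (b4 a b)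
      smul_mem' := by
        rintro t x ⟨a1, a2, a3, a4⟩
        refine ⟨Submodule.smul_mem _ t a1, fun a => ?_, fun a => ?_, fun a b => ?_⟩
        · simpa [mul_smul_comm] using Submodule.smul_mem _ t (a2 a)
        · simpa [smul_mul_assoc] using Submodule.smul_mem _ t (a3 a)
        · simpa [mul_smul_comm, smul_mul_assoc] using Submodule.smul_mem _ t (a4 a b) }
  have hT : idealSpan K s' ≤ T := by
    refine idealSpan_le ?_ ?_
    · rintro ⟨x, hx⟩ h
      change x ∈ s1 at h
      change x ∈ L ∧ (∀ a, a * x ∈ L) ∧ (∀ a, x * a ∈ L) ∧ ∀ a b, a * x * b ∈ L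
      refine ⟨Ls1 x h, ?_⟩
      clear hx
      rcases h with (((h | ⟨i, _, r, h, rfl⟩) | ⟨i, _, r, h, rfl⟩) | ⟨i, _, r, h, rfl⟩)
      · exact ⟨k2 x h, k3 x h, k4 x h⟩
      · refine ⟨fun a => ?_, fun a => ?_, fun a b => ?_⟩
        · simpa [mul_assoc] using k2 r h (a * y i)
        · simpa [mul_assoc] using k4 r h (y i) a
        · simpa [mul_assoc] using k4 r h (a * y i) b
      · refine ⟨fun a => ?_, fun a => ?_, fun a b => ?_⟩
        · simpa [mul_assoc] using k4 r h a (y i)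
        · simpa [mul_assoc] using k3 r h (y i * a)
        · simpa [mul_assoc] using k4 r h a (y i * b)
      · refine ⟨fun a => ?_, fun a => ?_, fun a b => ?_⟩
        · simpa [mul_assoc] using k4 r h (a * y i.1) (y i.2)
        · simpa [mul_assoc] using k4 r h (y i.1) (y i.2 * a)
        · simpa [mul_assoc] using k4 r h (a * y i.1) (y i.2 * b)
    · rintro ⟨j, hj⟩ ⟨x, hx⟩ ⟨a1, a2, a3, a4⟩
      simp only at a1 a2 a3 a4
      constructor
      · change j * x ∈ L ∧ (∀ a, a * (j * x) ∈ L) ∧ (∀ a, j * x * a ∈ L) ∧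
          ∀ a b, a * (j * x) * b ∈ L
        refine ⟨a2 j, fun a => ?_, fun a => a4 j a, fun a b => ?_⟩
        · simpa [mul_assoc] using a2 (a * j)
        · simpa [mul_assoc] using a4 (a * j) b
      · change x * j ∈ L ∧ (∀ a, a * (x * j) ∈ L) ∧ (∀ a, x * j * a ∈ L) ∧
          ∀ a b, a * (x * j) * b ∈ L
        refine ⟨a3 j, fun a => ?_, fun a => ?_, fun a b => ?_⟩
        · simpa [mul_assoc] using a4 a j
        · simpa [mul_assoc] using a3 (j * a)
        · simpa [mul_assoc] using a4 a (j * b)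
  have hL : idealSpan K s ≤ L := by
    refine idealSpan_le (fun r hr => g1 r hr) ?_
    intro a b hb
    obtain ⟨h, h'⟩ := (Lmem b).1 hb
    obtain ⟨_, a2, a3, _⟩ := hT h'
    exact ⟨a2 a, a3 a⟩
  refine ⟨s', sprf, fun x => ⟨fun hx => ?_, fun hx => ?_⟩⟩
  · have h1 : f x = 0 := by rw [← hq, hx]; rfl
    obtain ⟨_, h⟩ := (Lmem _).1 (hL ((hs _).1 h1))
    exact h
  · have h2 := idealSpan_map (NonUnitalSubalgebraClass.subtype J) (t := s) (s := s') (by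
      rintro ⟨a, haJ⟩ ha
      exact (hs _).1 (hs1 a ha)) hx
    have h3 : f x = 0 := (hs _).2 h2
    apply Subtype.ext
    rw [hq, h3]; rfl

end Up

section FreeCase

variable {K : Type*} [CommRing K] {X : Type*} [Fintype X]

/-- linear extension from words -/
noncomputable def wlin {M : Type*} [AddCommGroup M] [Module K M] (v : FreeSemigroup X → M) :
    FreeNUAlg K X →ₗ[K] M :=
  (Finsupp.linearCombination K v).comp
    (MonoidAlgebra.coeffLinearEquiv K).toLinearMap

theorem wlin_wd {M : Type*} [AddCommGroup M] [Module K M] (v : FreeSemigroup X → M) (w) :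
    wlin (K := K) v (wd K w) = v w := by
  simp [wlin, wd]

/-- the automaton -/
noncomputable def ew [DecidableEq X] (c : X → X → X → K) : X → List X → (X → K)
  | x, [] => Pi.single x 1
  | x, y :: l => ∑ z, c x y z • ew c z l

/-- coordinates -/
noncomputable def rho (c : X → X → X → K) : X → List X → (X × X × List X →₀ K)
  | _, [] => 0
  | x, y :: l => Finsupp.single (x, y, l) 1 + ∑ z, c x y z • rho c z l

/-- basis elements of the right ideal -/
noncomputable def dd (c : X → X → X → K) (x y : X) (l : List X) : FreeNUAlg K X :=
  wd K ⟨x, y :: l⟩ - ∑ z, c x y z • wd K ⟨z, l⟩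

/-- the automaton map -/
noncomputable def eps [DecidableEq X] (c : X → X → X → K) : FreeNUAlg K X →ₗ[K] (X → K) :=
  wlin (fun w => ew c w.1 w.2)

theorem wlin_rho_dd (c : X → X → X → K) (x y : X) (l : List X) :
    wlin (fun w => rho c w.1 w.2) (dd c x y l) = Finsupp.single (x, y, l) 1 := by
  simp [dd, map_sub, map_sum, wlin_wd, rho]

theorem mem_span_dd [DecidableEq X] (c : X → X → X → K) (f : FreeNUAlg K X) :
    f - ∑ z, eps c f z • fo K z ∈
      Submodule.span K (Set.range (fun p : X × X × List X => dd c p.1 p.2.1 p.2.2)) := by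
  set M := Submodule.span K (Set.range (fun p : X × X × List X => dd c p.1 p.2.1 p.2.2))
  let φ : FreeNUAlg K X →ₗ[K] FreeNUAlg K X :=
    LinearMap.id - (Fintype.linearCombination K (fun z : X => fo K z)).comp (eps c)
  have hφ : ∀ f, φ f = f - ∑ z, eps c f z • fo K z := fun f => by
    simp [φ, Fintype.linearCombination_apply]
  have key : ∀ (l : List X) (x : X), φ (wd K ⟨x, l⟩) ∈ M := by
    intro l
    induction l with
    | nil =>
      intro x
      have : φ (wd K ⟨x, []⟩) = 0 := by
        rw [hφ]
        simp only [eps, wlin_wd, ew]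
        rw [Finset.sum_eq_single x]
        · simp [fo, FreeSemigroup.of]
        · intro j _ hj; simp [hj]
        · simp
      rw [this]; exact zero_mem _
    | cons y l ih =>
      intro x
      have h1 : φ (wd K ⟨x, y :: l⟩) = φ (dd c x y l) + ∑ z, c x y z • φ (wd K ⟨z, l⟩) := by
        simp [dd, map_sum]
      have h2 : φ (dd c x y l) = dd c x y l := by
        have : eps c (dd c x y l) = 0 := by
          simp [dd, eps, map_sum, wlin_wd, ew]
        rw [hφ, this]; simp
      rw [h1, h2]
      refine add_mem (Submodule.subset_span ⟨(x, y, l), rfl⟩) (sum_mem fun z _ => ?_)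
      exact Submodule.smul_mem _ _ (ih z)
  rw [← hφ]
  exact mem_of_wd (M.comap φ) (fun w => key w.2 w.1) f

theorem dd_mul_wd (c : X → X → X → K) (x y : X) (m : List X) (z : X) (l : List X) :
    dd c x y m * wd K ⟨z, l⟩ = dd c x y (m ++ z :: l) := by
  simp [dd, sub_mul, Finset.sum_mul, ← wd_mul, smul_mul_assoc]

theorem dd_mul_dd (c : X → X → X → K) (x y : X) (m : List X) (a b : X) (l : List X) :
    dd c x y m * dd c a b l = dd c x y (m ++ a :: b :: l) - ∑ r, c a b r • dd c x y (m ++ r :: l) := by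
  conv_lhs => rw [dd.eq_def c a b l]
  simp [mul_sub, Finset.mul_sum, dd_mul_wd, mul_smul_comm]

variable {P : Type*} [NonUnitalRing P] [Module K P] [IsScalarTower K P P] [SMulCommClass K P P]

/-- normal forms -/
noncomputable def DD (c : X → X → X → K) (t : X × X × Option X → P) : X → X → List X → P
  | x, y, [] => t (x, y, none)
  | x, y, [z] => t (x, y, some z)
  | x, y, z :: w :: l => t (x, y, none) * DD c t z w l + ∑ r, c z w r • DD c t x y (r :: l)
termination_by _ _ l => l.length

/-- generator images -/
noncomputable def gen (c : X → X → X → K) (p : X × X × Option X) : FreeNUAlg K X :=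
  dd c p.1 p.2.1 p.2.2.toList

/-- generators -/
noncomputable abbrev tt (K : Type*) [CommRing K] {X : Type*} (p : X × X × Option X) :
    FreeNUAlg K (X × X × Option X) := fo K p

theorem gen_DD (c : X → X → X → K) (n : ℕ) : ∀ (l : List X), l.length ≤ n → ∀ (x y : X),
    fl K (gen c) (DD c (tt K) x y l) = dd c x y l := by
  induction n with
  | zero =>
    intro l hl x y
    have : l = [] := by simpa using hl
    subst this
    simp [DD, fl_fo, gen]
  | succ n ih =>
    intro l hl x y
    match l, hl with
    | [], _ => simp [DD, fl_fo, gen]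
    | [z], _ => simp [DD, fl_fo, gen]
    | z :: w :: l, hl =>
      simp only [List.length_cons] at hl
      rw [DD, map_add, map_mul, map_sum, ih l (by omega), fl_fo]
      have : ∀ r, fl K (gen c) (c z w r • DD c (tt K) x y (r :: l)) = c z w r • dd c x y (r :: l) :=
        fun r => by rw [map_smul, ih (r :: l) (by simp; omega)]
      simp only [this]
      change dd c x y [] * _ + _ = _
      rw [dd_mul_dd]
      simp

/-- the relators -/
noncomputable def relr (c : X → X → X → K) (p : (X × X × X) × (X × X × Option X)) :
    FreeNUAlg K (X × X × Option X) :=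
  tt K (p.1.1, p.1.2.1, some p.1.2.2) * tt K p.2 -
    (DD c (tt K) p.1.1 p.1.2.1 (p.1.2.2 :: p.2.1 :: p.2.2.1 :: p.2.2.2.toList) -
      ∑ r, c p.2.1 p.2.2.1 r • DD c (tt K) p.1.1 p.1.2.1 (p.1.2.2 :: r :: p.2.2.2.toList))

theorem gen_relr (c : X → X → X → K) (p) : fl K (gen c) (relr c p) = 0 := by
  obtain ⟨⟨x, y, z⟩, ⟨a, b, o⟩⟩ := p
  have h : ∀ x y l, fl K (gen c) (DD c (tt K) x y l) = dd c x y l :=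
    fun x y l => gen_DD c _ l le_rfl x y
  simp only [relr, map_sub, map_mul, map_sum, map_smul, h, fl_fo]
  change dd c x y [z] * dd c a b o.toList - _ = 0
  rw [dd_mul_dd]
  simp

theorem DD_span (c : X → X → X → K) (x : FreeNUAlg K (X × X × Option X)) :
    x ∈ Submodule.span K (Set.range (fun p : X × X × List X => DD c (tt K) p.1 p.2.1 p.2.2)) ⊔
      idealSpan K (Set.range (relr c)) := by
  set N := idealSpan K (Set.range (relr c)) with hN
  set M0 := Submodule.span K (Set.range (fun p : X × X × List X => DD c (tt K) p.1 p.2.1 p.2.2))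
    with hM0
  set M := M0 ⊔ N with hM
  have MD : ∀ x y l, DD c (tt K) x y l ∈ M := fun x y l =>
    Submodule.mem_sup_left (Submodule.subset_span ⟨(x, y, l), rfl⟩)
  have MN : ∀ x ∈ N, x ∈ M := fun x hx => Submodule.mem_sup_right hx
  have ext1 : ∀ p, (∀ x y l, tt K p * DD c (tt K) x y l ∈ M) → ∀ m ∈ M, tt K p * m ∈ M := by
    intro p hp m hm
    obtain ⟨u, hu, n, hn, rfl⟩ := Submodule.mem_sup.1 hm
    rw [mul_add]
    refine add_mem ?_ (MN _ (idealSpan_mul _ hn).1)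
    have : M0 ≤ M.comap (LinearMap.mulLeft K (tt K p)) := by
      rw [hM0, Submodule.span_le]
      rintro _ ⟨⟨x, y, l⟩, rfl⟩
      exact hp x y l
    exact this hu
  have none1 : ∀ x y, ∀ m ∈ M, tt K (x, y, none) * m ∈ M := by
    intro x y
    refine ext1 _ (fun z w l => ?_)
    have : tt K (x, y, none) * DD c (tt K) z w l =
        DD c (tt K) x y (z :: w :: l) - ∑ r, c z w r • DD c (tt K) x y (r :: l) := by
      rw [DD]; abel
    rw [this]
    exact sub_mem (MD _ _ _) (sum_mem fun r _ => Submodule.smul_mem _ _ (MD _ _ _))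
  have rel1 : ∀ x y z a b (o : Option X), ∃ n ∈ N, tt K (x, y, some z) * tt K (a, b, o) =
      DD c (tt K) x y (z :: a :: b :: o.toList) -
        ∑ r, c a b r • DD c (tt K) x y (z :: r :: o.toList) + n := by
    intro x y z a b o
    refine ⟨_, subset_idealSpan ⟨((x, y, z), (a, b, o)), rfl⟩, ?_⟩
    simp only [relr]
    abel
  have rel2 : ∀ x y z a b (o : Option X), tt K (x, y, some z) * tt K (a, b, o) ∈ M := by
    intro x y z a b o
    obtain ⟨n, hn, h⟩ := rel1 x y z a b o
    rw [h]
    exact add_mem (sub_mem (MD _ _ _) (sum_mem fun r _ => Submodule.smul_mem _ _ (MD _ _ _)))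
      (MN _ hn)
  have some1 : ∀ (n : ℕ) (l : List X), l.length ≤ n → ∀ x y z a b,
      tt K (x, y, some z) * DD c (tt K) a b l ∈ M := by
    intro n
    induction n with
    | zero =>
      intro l hl x y z a b
      have : l = [] := by simpa using hl
      subst this
      rw [DD]; exact rel2 _ _ _ _ _ _
    | succ n ih =>
      intro l hl x y z a b
      match l, hl with
      | [], _ => rw [DD]; exact rel2 _ _ _ _ _ _
      | [e], _ => rw [DD]; exact rel2 _ _ _ _ _ _
      | e :: f :: l, hl =>
        simp only [List.length_cons] at hl
        have two : ∀ x y q b, DD c (tt K) x y [q, b] * DD c (tt K) e f l ∈ M := by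
          intro x y q b
          rw [DD, add_mul, Finset.sum_mul, mul_assoc]
          refine add_mem (none1 _ _ _ ?_) (sum_mem fun r _ => ?_)
          · rw [DD]; exact none1 _ _ _ (MD _ _ _)
          · rw [DD, smul_mul_assoc]
            exact Submodule.smul_mem _ _ (ih l (by omega) _ _ _ _ _)
        have three : ∀ x y z q b, DD c (tt K) x y [z, q, b] * DD c (tt K) e f l ∈ M := by
          intro x y z q b
          rw [DD, add_mul, Finset.sum_mul, mul_assoc]
          refine add_mem (none1 _ _ _ ?_) (sum_mem fun r _ => ?_)
          · rw [DD]; exact ih l (by omega) _ _ _ _ _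
          · rw [smul_mul_assoc]
            exact Submodule.smul_mem _ _ (two _ _ _ _)
        obtain ⟨m, hm, h⟩ := rel1 x y z a b none
        rw [DD, mul_add, ← mul_assoc, h, Finset.mul_sum, add_mul, sub_mul, Finset.sum_mul]
        refine add_mem (add_mem (sub_mem (three _ _ _ _ _) (sum_mem fun r _ => ?_))
          (MN _ (idealSpan_mul _ hm).2)) (sum_mem fun r _ => ?_)
        · rw [smul_mul_assoc]
          exact Submodule.smul_mem _ _ (two _ _ _ _)
        · rw [mul_smul_comm]
          exact Submodule.smul_mem _ _ (ih (r :: l) (by simp; omega) _ _ _ _ _)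
  refine free_induction M ?_ ?_ x
  · rintro ⟨x, y, _ | z⟩
    · have := MD x y []
      rwa [DD] at this
    · have := MD x y [z]
      rwa [DD] at this
  · rintro ⟨x, y, _ | z⟩
    · exact none1 x y
    · exact ext1 _ (fun a b l => some1 _ l le_rfl x y z a b)

theorem gen_FPh (c : X → X → X → K) : FPh (fl K (gen c)) := by
  refine ⟨Set.range (relr c), Set.finite_range _, fun x => ⟨fun hx => ?_, fun hx => ?_⟩⟩
  · obtain ⟨u, hu, n, hn, rfl⟩ := Submodule.mem_sup.1 (DD_span c x)
    have hn0 : fl K (gen c) n = 0 := by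
      have := idealSpan_map (fl K (gen c)) (t := ∅) (s := Set.range (relr c))
        (by rintro _ ⟨p, rfl⟩; rw [gen_relr]; exact zero_mem _) hn
      have h0 : idealSpan K (∅ : Set (FreeNUAlg K X)) ≤ ⊥ := by
        refine idealSpan_le (Set.empty_subset _) ?_
        rintro a b hb
        simp only [Submodule.mem_bot] at hb
        simp [hb]
      simpa using h0 this
    rw [map_add, hn0, add_zero] at hx
    obtain ⟨k, rfl⟩ := (Finsupp.mem_span_range_iff_exists_finsupp).1 hu
    have h1 : wlin (fun w => rho c w.1 w.2) (fl K (gen c)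
        (k.sum fun p a => a • DD c (tt K) p.1 p.2.1 p.2.2)) = k := by
      simp only [Finsupp.sum, map_sum, map_smul, gen_DD c _ _ le_rfl, wlin_rho_dd]
      conv_rhs => rw [← Finsupp.sum_single k]
      simp [Finsupp.sum]
    rw [hx, map_zero] at h1
    subst h1
    simpa using hn
  · have := idealSpan_map (fl K (gen c)) (t := ∅) (s := Set.range (relr c))
        (by rintro _ ⟨p, rfl⟩; rw [gen_relr]; exact zero_mem _) hx
    have h0 : idealSpan K (∅ : Set (FreeNUAlg K X)) ≤ ⊥ := by
      refine idealSpan_le (Set.empty_subset _) ?_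
      rintro a b hb
      simp only [Submodule.mem_bot] at hb
      simp [hb]
    simpa using h0 this

theorem eps_range [DecidableEq X] (c : X → X → X → K) (f : FreeNUAlg K X) (hf : eps c f = 0) :
    ∃ w, fl K (gen c) w = f := by
  have h := mem_span_dd c f
  rw [hf] at h
  simp only [Pi.zero_apply, zero_smul, Finset.sum_const_zero, sub_zero] at h
  obtain ⟨k, rfl⟩ := (Finsupp.mem_span_range_iff_exists_finsupp).1 h
  refine ⟨k.sum fun p a => a • DD c (tt K) p.1 p.2.1 p.2.2, ?_⟩
  simp only [Finsupp.sum, map_sum, map_smul, gen_DD c _ _ le_rfl]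

end FreeCase

section Main

variable {K : Type*} [CommRing K] [IsNoetherianRing K]
  {A : Type*} [NonUnitalRing A] [Module K A] [IsScalarTower K A A] [SMulCommClass K A A]

theorem compl_sub (B : NonUnitalSubalgebra K A) (hB : Module.Finite K (A ⧸ B.toSubmodule)) :
    ∃ (k : ℕ) (y : Fin k → A), ∀ a, ∃ c : Fin k → K, a - ∑ i, c i • y i ∈ B := by
  obtain ⟨k, y, hy⟩ := exists_compl (B.toSubmodule.mkQ)
  refine ⟨k, y, fun a => ?_⟩
  obtain ⟨c, hc⟩ := hy a
  rw [Submodule.ker_mkQ] at hc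
  exact ⟨c, hc⟩

theorem fp_up_dir (B : NonUnitalSubalgebra K A) (hB : Module.Finite K (A ⧸ B.toSubmodule))
    (h : NUAlgFP K B) : NUAlgFP K A := by
  obtain ⟨n, g, ⟨s, sf, hs⟩, hgs⟩ := FPh_of_fp h
  obtain ⟨k, y, hy⟩ := compl_sub B hB
  let g' : FreeNUAlg K (Fin n) →ₙₐ[K] A := (NonUnitalSubalgebraClass.subtype B).comp g
  have hg' : ∀ x, g' x = (g x : A) := fun x => rfl
  have hg : FPh g' := by
    refine ⟨s, sf, fun x => ?_⟩
    rw [← hs, hg']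
    simp
  obtain ⟨h1, h2⟩ := fp_up g' hg k y (fun a => by
    obtain ⟨c, hc⟩ := hy a
    obtain ⟨w, hw⟩ := hgs ⟨_, hc⟩
    refine ⟨w, c, ?_⟩
    rw [hg', hw]
    simp)
  exact fp_of_finite _ h1 h2

/-- complement of the right ideal `{b ∈ B | b A ⊆ B}` -/
theorem right_compl (B : NonUnitalSubalgebra K A) (hB : Module.Finite K (A ⧸ B.toSubmodule)) :
    ∃ R : Submodule K A, (∀ r ∈ R, r ∈ B) ∧ (∀ r ∈ R, ∀ a, r * a ∈ R) ∧
    ∃ (k : ℕ) (y : Fin k → A), ∀ a, ∃ c : Fin k → K, a - ∑ i, c i • y i ∈ R := by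
  obtain ⟨k, y, hy⟩ := compl_sub B hB
  let q := B.toSubmodule.mkQ
  have hq : ∀ a, q a = 0 ↔ a ∈ B := fun a => by
    change B.toSubmodule.mkQ a = 0 ↔ _
    rw [← LinearMap.mem_ker, Submodule.ker_mkQ]; rfl
  let φ : A →ₗ[K] (A ⧸ B.toSubmodule) × (Fin k → A ⧸ B.toSubmodule) :=
    q.prod (LinearMap.pi fun i => q.comp (LinearMap.mulRight K (y i)))
  have hφ : ∀ a, a ∈ LinearMap.ker φ ↔ a ∈ B ∧ ∀ i, a * y i ∈ B := fun a => by
    rw [LinearMap.mem_ker]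
    change ((q a, fun i => q (a * y i)) : (A ⧸ B.toSubmodule) × (Fin k → A ⧸ B.toSubmodule)) = 0 ↔ _
    simp only [Prod.mk_eq_zero, hq, funext_iff, Pi.zero_apply]
  have hR : ∀ r ∈ LinearMap.ker φ, ∀ a, r * a ∈ B := by
    intro r hr a
    obtain ⟨h1, h2⟩ := (hφ r).1 hr
    obtain ⟨c, hc⟩ := hy a
    have : r * a = r * (a - ∑ i, c i • y i) + ∑ i, c i • (r * y i) := by
      rw [mul_sub, Finset.mul_sum]
      simp [mul_smul_comm]
    rw [this]
    exact add_mem (mul_mem h1 hc) (sum_mem fun i _ => SMulMemClass.smul_mem _ (h2 i))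
  refine ⟨LinearMap.ker φ, fun r hr => ((hφ r).1 hr).1, fun r hr a => ?_, exists_compl φ⟩
  rw [hφ]
  refine ⟨hR r hr a, fun i => ?_⟩
  rw [mul_assoc]; exact hR r hr _

theorem fp_down_core {X : Type*} [Fintype X] (f : FreeNUAlg K X →ₙₐ[K] A) (hf : FPh f)
    (hs : Function.Surjective f)
    (B : NonUnitalSubalgebra K A) (R : Submodule K A) (hRB : ∀ r ∈ R, r ∈ B)
    (hRA : ∀ r ∈ R, ∀ a, r * a ∈ R)
    (hX : ∀ a, ∃ c : X → K, a - ∑ z, c z • f (fo K z) ∈ R) : NUAlgFP K B := by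
  classical
  choose c' hc' using hX
  let c : X → X → X → K := fun x y => c' (f (fo K x) * f (fo K y))
  have hof : ∀ z : X, wd K (⟨z, []⟩ : FreeSemigroup X) = fo K z := fun z => rfl
  have hnil : ∀ x y, f (dd c x y []) ∈ R := by
    intro x y
    have h1 : wd K (⟨x, [y]⟩ : FreeSemigroup X) = fo K x * fo K y := by
      rw [fo, fo, ← wd_mul]; rfl
    rw [dd, h1, map_sub, map_mul, map_sum]
    simp only [map_smul, hof]
    exact hc' _
  have hdd : ∀ x y l, f (dd c x y l) ∈ R := by
    intro x y l
    cases l with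
    | nil => exact hnil x y
    | cons z l =>
      have := dd_mul_wd c x y [] z l
      rw [List.nil_append] at this
      rw [← this, map_mul]
      exact hRA _ (hnil x y) _
  let J := B.comap f
  have hJ : ∀ x, x ∈ J ↔ f x ∈ B := fun x => NonUnitalSubalgebra.mem_comap _ _ _
  have hgen : ∀ p, gen c p ∈ J := fun p => (hJ _).2 (hRB _ (hdd _ _ _))
  let gJ : FreeNUAlg K (X × X × Option X) →ₙₐ[K] J := fl K (fun p => (⟨gen c p, hgen p⟩ : J))
  have hgJ : ∀ w, (gJ w : FreeNUAlg K X) = fl K (gen c) w := by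
    intro w
    refine free_ext ((NonUnitalSubalgebraClass.subtype J).comp gJ) (fl K (gen c)) (fun z => ?_) w
    simp [gJ, fl_fo]
  have hFJ : FPh gJ := by
    obtain ⟨s, sf, h⟩ := gen_FPh c
    refine ⟨s, sf, fun x => ?_⟩
    rw [← h, ← hgJ]
    simp
  have hfpJ : NUAlgFP K J := by
    obtain ⟨k, y, hy⟩ := exists_compl
      ((eps c).comp (NonUnitalSubalgebraClass.subtype J : J →ₗ[K] FreeNUAlg K X))
    obtain ⟨h1, h2⟩ := fp_up gJ hFJ k y (fun a => by
      obtain ⟨d, hd⟩ := hy a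
      obtain ⟨w, hw⟩ := eps_range c _ (LinearMap.mem_ker.1 hd)
      refine ⟨w, d, ?_⟩
      have : gJ w = a - ∑ i, d i • y i := by
        apply Subtype.ext
        rw [hgJ, hw]; rfl
      rw [this]; simp)
    exact fp_of_finite _ h1 h2
  let q : J →ₙₐ[K] B := NonUnitalAlgHom.codRestrict
    (f.comp (NonUnitalSubalgebraClass.subtype J)) B (fun x => (hJ _).1 x.2)
  have hq : ∀ x : J, (q x : A) = f x := fun x => rfl
  have hqs : Function.Surjective q := by
    rintro ⟨b, hb⟩
    obtain ⟨x, rfl⟩ := hs b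
    exact ⟨⟨x, (hJ _).2 hb⟩, rfl⟩
  let e := Fintype.equivFin X
  have hqF : FPh q := by
    refine ker_fg_sub f hf B (Fintype.card X) (fun i => fo K (e.symm i)) (fun a => ?_) q hq
    refine ⟨fun i => c' (f a) (e.symm i), ?_⟩
    have h1 := hRB _ (hc' (f a))
    have h2 : ∑ i, c' (f a) (e.symm i) • fo K (e.symm i) = ∑ z, c' (f a) z • fo K z :=
      Equiv.sum_comp e.symm (fun z => c' (f a) z • fo K z)
    rw [h2, map_sub, map_sum]
    simpa only [map_smul] using h1
  exact fp_quot hqF hqs hfpJ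

theorem fp_down_dir (B : NonUnitalSubalgebra K A) (hB : Module.Finite K (A ⧸ B.toSubmodule))
    (h : NUAlgFP K A) : NUAlgFP K B := by
  obtain ⟨n, g, hg, hgs⟩ := FPh_of_fp h
  obtain ⟨R, hRB, hRA, k, y, hy⟩ := right_compl B hB
  obtain ⟨h1, h2⟩ := fp_up g hg k y (fun a => by
    obtain ⟨w, hw⟩ := hgs a
    exact ⟨w, 0, by simp [hw]⟩)
  refine fp_down_core _ h1 h2 B R hRB hRA (fun a => ?_)
  obtain ⟨c, hc⟩ := hy a
  refine ⟨Sum.elim 0 c, ?_⟩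
  simpa [fl_fo] using hc

end Main

/-- Let `K` be a commutative Noetherian ring with identity, `A` an
associative `K`-algebra (not necessarily commutative or unital) and `B` a `K`-subalgebra
such that the quotient `K`-module `A/B` is finitely generated. Then `A` is finitely
presented as a `K`-algebra if and only if `B` is finitely presented as a `K`-algebra. -/
theorem subalgebra_finite_corank_fp_iff
    (K A : Type*) [CommRing K] [IsNoetherianRing K]
    [NonUnitalRing A] [Module K A] [IsScalarTower K A A] [SMulCommClass K A A]
    (B : NonUnitalSubalgebra K A)
    (hB : Module.Finite K (A ⧸ B.toSubmodule)) :
    NUAlgFP K A ↔ NUAlgFP K B := by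
  exact ⟨fp_down_dir B hB, fp_up_dir B hB⟩
end

section
/- Let R be a ring (not necessarily commutative or with identity), and let S be a subring of R such that the quotient R/S is a finitely generated abelian group. Then R is finitely presented as a ring if and only if S is finitely presented as a ring. -/
namespace FPProof

section Basics

theorem subset_idealSpan {A : Type*} [NonUnitalRing A] (s : Set A) :
    s ⊆ (idealSpan ℤ s : Submodule ℤ A) := by
  intro x hx
  simp only [idealSpan, SetLike.mem_coe, Submodule.mem_sInf, Set.mem_ofPred_eq]
  intro J hJ
  exact hJ.1 hx

theorem idealSpan_mul_left {A : Type*} [NonUnitalRing A] {s : Set A} (a : A) {b : A}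
    (hb : b ∈ idealSpan ℤ s) : a * b ∈ idealSpan ℤ s := by
  simp only [idealSpan, Submodule.mem_sInf, Set.mem_ofPred_eq] at hb ⊢
  intro J hJ
  exact (hJ.2 a b (hb J hJ)).1

theorem idealSpan_mul_right {A : Type*} [NonUnitalRing A] {s : Set A} (a : A) {b : A}
    (hb : b ∈ idealSpan ℤ s) : b * a ∈ idealSpan ℤ s := by
  simp only [idealSpan, Submodule.mem_sInf, Set.mem_ofPred_eq] at hb ⊢
  intro J hJ
  exact (hJ.2 a b (hb J hJ)).2

theorem idealSpan_le {A : Type*} [NonUnitalRing A] {s : Set A} {J : Submodule ℤ A}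
    (h1 : s ⊆ J) (h2 : ∀ a b : A, b ∈ J → a * b ∈ J ∧ b * a ∈ J) :
    idealSpan ℤ s ≤ J := sInf_le ⟨h1, h2⟩

theorem idealSpan_le_comap {A B : Type*} [NonUnitalRing A] [NonUnitalRing B]
    (f : A →ₙₐ[ℤ] B) {s : Set A} {t : Set B} (h : ∀ a ∈ s, f a ∈ idealSpan ℤ t)
    {a : A} (ha : a ∈ idealSpan ℤ s) : f a ∈ idealSpan ℤ t := by
  have : idealSpan ℤ s ≤ (idealSpan ℤ t).comap (f : A →ₗ[ℤ] B) := by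
    refine idealSpan_le (fun a ha => h a ha) ?_
    intro a b hb
    simp only [Submodule.mem_comap, LinearMap.coe_coe] at hb ⊢
    rw [map_mul, map_mul]
    exact ⟨idealSpan_mul_left _ hb, idealSpan_mul_right _ hb⟩
  exact this ha

theorem idealSpan_mono {A : Type*} [NonUnitalRing A] {s t : Set A} (h : s ⊆ t) :
    idealSpan ℤ s ≤ idealSpan ℤ t :=
  idealSpan_le (h.trans (subset_idealSpan t))
    (fun a _ hb => ⟨idealSpan_mul_left a hb, idealSpan_mul_right a hb⟩)

theorem idealSpan_eq_zero_of {A B : Type*} [NonUnitalRing A] [NonUnitalRing B]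
    (f : A →ₙₐ[ℤ] B) {s : Set A} (h : ∀ a ∈ s, f a = 0)
    {a : A} (ha : a ∈ idealSpan ℤ s) : f a = 0 := by
  have : idealSpan ℤ s ≤ LinearMap.ker (f : A →ₗ[ℤ] B) := by
    refine idealSpan_le (fun a ha => h a ha) ?_
    intro a b hb
    simp only [LinearMap.mem_ker, LinearMap.coe_coe] at hb ⊢
    rw [map_mul, map_mul, hb]
    simp
  exact this ha

/-- The generator of the free algebra. -/
noncomputable def fof {X : Type*} (x : X) : FreeNUAlg ℤ X :=
  MonoidAlgebra.single (FreeSemigroup.of x) 1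

theorem single_induct {X : Type*} {P : FreeNUAlg ℤ X → Prop}
    (hof : ∀ x, P (fof x)) (hmul : ∀ x b, P b → P (fof x * b)) :
    ∀ w : FreeSemigroup X, P (MonoidAlgebra.single w 1) := by
  intro w
  induction w using FreeSemigroup.recOnMul with
  | ih1 x => exact hof x
  | ih2 x y _ hy =>
    have := hmul x _ hy
    rwa [fof, MonoidAlgebra.single_mul_single, mul_one] at this

theorem finduct {X : Type*} {P : FreeNUAlg ℤ X → Prop} (h0 : P 0)
    (hof : ∀ x, P (fof x)) (hadd : ∀ a b, P a → P b → P (a + b))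
    (hneg : ∀ a, P a → P (-a)) (hmul : ∀ a b, P a → P b → P (a * b)) (a : FreeNUAlg ℤ X) :
    P a := by
  induction a using MonoidAlgebra.induction_linear with
  | zero => exact h0
  | add a b ha hb => exact hadd a b ha hb
  | single w r =>
    have h1 := single_induct (P := P) hof (fun x b hb => hmul _ _ (hof x) hb) w
    have e : (MonoidAlgebra.single w r : FreeNUAlg ℤ X) = r • MonoidAlgebra.single w 1 := by
      simp
    rw [e]
    induction r using Int.induction_on with
    | zero => simpa using h0
    | succ n ih =>
      rw [add_smul, one_smul]; exact hadd _ _ (ih (by simp)) h1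
    | pred n ih =>
      rw [sub_smul, one_smul, sub_eq_add_neg]; exact hadd _ _ (ih (by simp)) (hneg _ h1)

theorem submodule_induct {X : Type*} (V : Submodule ℤ (FreeNUAlg ℤ X))
    (hof : ∀ x, fof x ∈ V) (hmul : ∀ a b, a ∈ V → b ∈ V → a * b ∈ V)
    (a : FreeNUAlg ℤ X) : a ∈ V :=
  finduct (P := fun a => a ∈ V) V.zero_mem hof (fun _ _ => V.add_mem) (fun _ => V.neg_mem) hmul a

theorem exists_lift {X : Type*} {A : Type*} [NonUnitalRing A] (v : X → A) :
    ∃ f : FreeNUAlg ℤ X →ₙₐ[ℤ] A, ∀ x, f (fof x) = v x := by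
  refine ⟨MonoidAlgebra.liftMagma ℤ (FreeSemigroup.lift v), fun x => ?_⟩
  simp [fof]

theorem exists_rlin {X : Type*} (v : X → FreeNUAlg ℤ X) :
    ∃ l : FreeNUAlg ℤ X →ₗ[ℤ] FreeNUAlg ℤ X, (∀ x, l (fof x) = v x) ∧
      ∀ a b, l (a * b) = l a * b := by
  let r : FreeNUAlg ℤ X → List X → FreeNUAlg ℤ X :=
    fun a t => t.foldl (fun b z => b * fof z) a
  have hr : ∀ (t : List X) (a : FreeNUAlg ℤ X) (y : X),
      r a (y :: t) = a * MonoidAlgebra.single ⟨y, t⟩ 1 := by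
    intro t
    induction t with
    | nil => intro a y; rfl
    | cons z t ih =>
      intro a y
      have : r a (y :: z :: t) = r (a * fof y) (z :: t) := rfl
      rw [this, ih, mul_assoc, fof, MonoidAlgebra.single_mul_single, mul_one]
      rfl
  let l : FreeNUAlg ℤ X →ₗ[ℤ] FreeNUAlg ℤ X :=
    (Finsupp.linearCombination ℤ (fun w : FreeSemigroup X => r (v w.head) w.tail)) ∘ₗ
      (MonoidAlgebra.coeffLinearEquiv ℤ).toLinearMap
  have hl : ∀ w (c : ℤ), l (MonoidAlgebra.single w c) = c • r (v w.head) w.tail := by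
    intro w c
    simp [l]
  refine ⟨l, fun x => ?_, fun a b => ?_⟩
  · rw [fof, hl]; simp [FreeSemigroup.of, r]
  · induction a using MonoidAlgebra.induction_linear with
    | zero => simp
    | add a a' ha hb => rw [add_mul, map_add, map_add, add_mul, ha, hb]
    | single w c =>
      induction b using MonoidAlgebra.induction_linear with
      | zero => simp
      | add a a' ha hb => rw [mul_add, map_add, mul_add, ha, hb]
      | single w' c' =>
        rw [MonoidAlgebra.single_mul_single, hl, hl]
        have : r (v (w * w').head) (w * w').tail
            = r (r (v w.head) w.tail) (w'.head :: w'.tail) := by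
          simp [r, List.foldl_append]
        rw [this, hr]
        have e : (MonoidAlgebra.single w' c' : FreeNUAlg ℤ X) = c' • MonoidAlgebra.single w' 1 := by
          simp
        rw [e, mul_smul_comm, smul_mul_assoc, smul_smul, mul_comm c]

end Basics

section Extend

theorem fp_extend {R : Type*} [NonUnitalRing R] {m : ℕ}
    (e : FreeNUAlg ℤ (Fin m) →ₙₐ[ℤ] R) (P : Finset (FreeNUAlg ℤ (Fin m)))
    (hP : ∀ x, e x = 0 ↔ x ∈ idealSpan ℤ (P : Set (FreeNUAlg ℤ (Fin m))))
    {k : ℕ} (y : Fin k → R)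
    (hy : ∀ r, ∃ (c : Fin k →₀ ℤ) (a : _), r = Finsupp.linearCombination ℤ y c + e a) :
    NUAlgFP ℤ R := by
  classical
  obtain ⟨ε, hε⟩ := exists_lift (X := Fin (m + k))
    (Fin.addCases (fun z => e (fof z)) (fun j => y j) : Fin (m + k) → R)
  obtain ⟨ι, hι⟩ := exists_lift (X := Fin m) (A := FreeNUAlg ℤ (Fin (m + k)))
    (fun z => fof (Fin.castAdd k z))
  have hει : ∀ a, ε (ι a) = e a := by
    intro a
    refine finduct (P := fun a => ε (ι a) = e a) (by simp) ?_ ?_ ?_ ?_ a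
    · intro x; rw [hι, hε, Fin.addCases_left]
    · intro a b ha hb; simp [ha, hb]
    · intro a ha; simp [ha]
    · intro a b ha hb; simp [ha, hb]
  let η : (Fin k →₀ ℤ) →ₗ[ℤ] FreeNUAlg ℤ (Fin (m + k)) :=
    Finsupp.linearCombination ℤ (fun j => fof (Fin.natAdd m j))
  let π : (Fin k →₀ ℤ) →ₗ[ℤ] R := Finsupp.linearCombination ℤ y
  have hηj : ∀ j (r : ℤ), η (Finsupp.single j r) = r • fof (Fin.natAdd m j) := by
    intro j r; simp [η]
  have hεη : ∀ c, ε (η c) = π c := by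
    intro c
    induction c using Finsupp.induction_linear with
    | zero => simp
    | add a b ha hb => simp [ha, hb]
    | single j r => rw [hηj, map_zsmul, hε, Fin.addCases_right]; simp [π]
  choose qc qa hq using hy
  let E : R → FreeNUAlg ℤ (Fin (m + k)) := fun r => η (qc r) + ι (qa r)
  have hE : ∀ r, ε (E r) = r := by
    intro r; simp only [E, map_add, hεη, hει]; exact (hq r).symm
  let NS : Submodule ℤ (Fin k →₀ ℤ) := (LinearMap.range (e : FreeNUAlg ℤ (Fin m) →ₗ[ℤ] R)).comap π
  obtain ⟨T, hT⟩ : NS.FG := IsNoetherian.noetherian NS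
  have hTw : ∀ c : Fin k →₀ ℤ, ∃ a, c ∈ NS → e a = π c := by
    intro c
    by_cases hc : c ∈ NS
    · obtain ⟨a, ha⟩ := hc
      exact ⟨a, fun _ => ha⟩
    · exact ⟨0, fun h => absurd h hc⟩
  choose w hw using hTw
  let rel : Finset (FreeNUAlg ℤ (Fin (m + k))) :=
    P.image ι ∪ T.image (fun c => η c - ι (w c)) ∪
      (Finset.univ : Finset (Fin (m + k) × Fin (m + k))).image
        (fun p => fof p.1 * fof p.2 - E (ε (fof p.1 * fof p.2)))
  let K := idealSpan ℤ (rel : Set (FreeNUAlg ℤ (Fin (m + k))))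
  have hrel : ∀ x ∈ rel, x ∈ K := fun x hx => subset_idealSpan _ hx
  have hK1 : ∀ a, e a = 0 → ι a ∈ K := by
    intro a ha
    refine idealSpan_le_comap ι ?_ ((hP a).1 ha)
    intro b hb
    apply hrel
    simp only [rel, Finset.mem_union, Finset.mem_image]
    exact Or.inl (Or.inl ⟨b, hb, rfl⟩)
  have hK2 : ∀ c ∈ NS, ∃ b, η c - ι b ∈ K := by
    intro c hc
    rw [← hT] at hc
    induction hc using Submodule.span_induction with
    | mem c hc =>
      refine ⟨w c, hrel _ ?_⟩
      simp only [rel, Finset.mem_union, Finset.mem_image]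
      exact Or.inl (Or.inr ⟨c, hc, rfl⟩)
    | zero => exact ⟨0, by simp⟩
    | add c d _ _ hc hd =>
      obtain ⟨a, ha⟩ := hc
      obtain ⟨b, hb⟩ := hd
      refine ⟨a + b, ?_⟩
      have := K.add_mem ha hb
      rw [map_add, map_add]
      convert this using 1
      abel
    | smul r c _ hc =>
      obtain ⟨a, ha⟩ := hc
      refine ⟨r • a, ?_⟩
      have := K.smul_mem r ha
      rw [map_zsmul, map_smul]
      rwa [smul_sub] at this
  have hK3 : ∀ i j, fof i * fof j - E (ε (fof i * fof j)) ∈ K := by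
    intro i j
    apply hrel
    simp only [rel, Finset.mem_union, Finset.mem_image]
    exact Or.inr ⟨(i, j), Finset.mem_univ _, rfl⟩
  have hKε : ∀ a ∈ K, ε a = 0 := by
    intro a ha
    refine idealSpan_eq_zero_of ε ?_ ha
    intro b hb
    simp only [rel, Finset.mem_union, Finset.mem_image, Finset.mem_coe] at hb
    rcases hb with (⟨p, hp, rfl⟩ | ⟨c, hc, rfl⟩) | ⟨p, _, rfl⟩
    · rw [hει]; exact (hP p).2 (subset_idealSpan _ hp)
    · have : c ∈ NS := by rw [← hT]; exact Submodule.subset_span hc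
      rw [map_sub, hεη, hει, hw c this, sub_self]
    · rw [map_sub, hE, sub_self]
  -- the submodule spanned by everything in normal form
  let C : Submodule ℤ (FreeNUAlg ℤ (Fin (m + k))) :=
    LinearMap.range η ⊔ LinearMap.range (ι : FreeNUAlg ℤ (Fin m) →ₗ[ℤ] FreeNUAlg ℤ (Fin (m + k))) ⊔ K
  have hCη : ∀ c, η c ∈ C := fun c =>
    Submodule.mem_sup_left (Submodule.mem_sup_left ⟨c, rfl⟩)
  have hCι : ∀ a, ι a ∈ C := fun a =>
    Submodule.mem_sup_left (Submodule.mem_sup_right ⟨a, rfl⟩)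
  have hCK : ∀ a ∈ K, a ∈ C := fun a ha => Submodule.mem_sup_right ha
  have hCE : ∀ r, E r ∈ C := fun r => C.add_mem (hCη _) (hCι _)
  have hCel : ∀ x ∈ C, ∃ c a, ∃ t ∈ K, x = η c + ι a + t := by
    intro x hx
    obtain ⟨u, hu, t, ht, rfl⟩ := Submodule.mem_sup.1 hx
    obtain ⟨_, ⟨c, rfl⟩, _, ⟨a, rfl⟩, rfl⟩ := Submodule.mem_sup.1 hu
    exact ⟨c, a, t, ht, rfl⟩
  have hCgen : ∀ i j, fof i * fof j ∈ C := by
    intro i j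
    have := C.add_mem (hCK _ (hK3 i j)) (hCE (ε (fof i * fof j)))
    simpa using this
  have hgη : ∀ i c, fof i * η c ∈ C := by
    intro i c
    induction c using Finsupp.induction_linear with
    | zero => simp
    | add a b ha hb => rw [map_add, mul_add]; exact C.add_mem ha hb
    | single j r => rw [hηj, mul_smul_comm]; exact C.smul_mem r (hCgen _ _)
  have hηg : ∀ i c, η c * fof i ∈ C := by
    intro i c
    induction c using Finsupp.induction_linear with
    | zero => simp
    | add a b ha hb => rw [map_add, add_mul]; exact C.add_mem ha hb
    | single j r => rw [hηj, smul_mul_assoc]; exact C.smul_mem r (hCgen _ _)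
  have hηη : ∀ c d, η c * η d ∈ C := by
    intro c d
    induction c using Finsupp.induction_linear with
    | zero => simp
    | add a b ha hb => rw [map_add, add_mul]; exact C.add_mem ha hb
    | single j r => rw [hηj, smul_mul_assoc]; exact C.smul_mem r (hgη _ _)
  have hL : ∀ a, (∀ c, ι a * η c ∈ C) → ∀ x ∈ C, ι a * x ∈ C := by
    intro a ha x hx
    obtain ⟨c, b, t, ht, rfl⟩ := hCel x hx
    rw [mul_add, mul_add, ← map_mul]
    exact C.add_mem (C.add_mem (ha c) (hCι _)) (hCK _ (idealSpan_mul_left _ ht))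
  have hR : ∀ a, (∀ c, η c * ι a ∈ C) → ∀ x ∈ C, x * ι a ∈ C := by
    intro a ha x hx
    obtain ⟨c, b, t, ht, rfl⟩ := hCel x hx
    rw [add_mul, add_mul, ← map_mul]
    exact C.add_mem (C.add_mem (ha c) (hCι _)) (hCK _ (idealSpan_mul_right _ ht))
  have hιη : ∀ a c, ι a * η c ∈ C := by
    intro a
    refine finduct (P := fun a => ∀ c, ι a * η c ∈ C) (by simp) ?_ ?_ ?_ ?_ a
    · intro x c; rw [hι]; exact hgη _ _
    · intro a b ha hb c; rw [map_add, add_mul]; exact C.add_mem (ha c) (hb c)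
    · intro a ha c; rw [map_neg, neg_mul]; exact C.neg_mem (ha c)
    · intro a b ha hb c; rw [map_mul, mul_assoc]; exact hL a ha _ (hb c)
  have hηι : ∀ a c, η c * ι a ∈ C := by
    intro a
    refine finduct (P := fun a => ∀ c, η c * ι a ∈ C) (by simp) ?_ ?_ ?_ ?_ a
    · intro x c; rw [hι]; exact hηg _ _
    · intro a b ha hb c; rw [map_add, mul_add]; exact C.add_mem (ha c) (hb c)
    · intro a ha c; rw [map_neg, mul_neg]; exact C.neg_mem (ha c)
    · intro a b ha hb c; rw [map_mul, ← mul_assoc]; exact hR b hb _ (ha c)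
  have hCtop : ∀ x, x ∈ C := by
    refine submodule_induct C ?_ ?_
    · intro i
      refine Fin.addCases (fun z => ?_) (fun j => ?_) i
      · rw [← hι]; exact hCι _
      · have := hηj j 1
        rw [one_smul] at this
        rw [← this]; exact hCη _
    · intro x x' hx hx'
      obtain ⟨c, a, t, ht, rfl⟩ := hCel x hx
      rw [add_mul, add_mul]
      refine C.add_mem (C.add_mem ?_ (hL a (hιη a) _ hx')) (hCK _ (idealSpan_mul_right _ ht))
      obtain ⟨c', a', t', ht', rfl⟩ := hCel x' hx'
      rw [mul_add, mul_add]
      exact C.add_mem (C.add_mem (hηη _ _) (hηι _ _)) (hCK _ (idealSpan_mul_left _ ht'))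
  refine ⟨m + k, ε, fun r => ⟨E r, hE r⟩, rel, fun x => ⟨fun hx => ?_, hKε x⟩⟩
  obtain ⟨c, a, t, ht, rfl⟩ := hCel x (hCtop x)
  rw [map_add, map_add, hεη, hει, hKε t ht, add_zero] at hx
  have hc : c ∈ NS := ⟨-a, by
    rw [LinearMap.coe_coe, map_neg]
    exact neg_eq_of_add_eq_zero_left hx⟩
  obtain ⟨b, hb⟩ := hK2 c hc
  have h2 := hKε _ hb
  rw [map_sub, hεη, hει, sub_eq_zero] at h2
  have h3 : ι (b + a) ∈ K := hK1 _ (by rw [map_add, ← h2, hx])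
  have h4 := K.add_mem (K.add_mem hb h3) ht
  rw [map_add] at h4
  convert h4 using 1
  abel

end Extend

section LeftIdeal

theorem rlin_mem {X : Type*} (K : Submodule ℤ (FreeNUAlg ℤ X))
    (hK : ∀ a b, a ∈ K → a * b ∈ K) (Φ : FreeNUAlg ℤ X →ₗ[ℤ] FreeNUAlg ℤ X)
    (hΦ : ∀ a b, Φ (a * b) = Φ a * b) (h : ∀ z, Φ (fof z) ∈ K) (b : FreeNUAlg ℤ X) : Φ b ∈ K := by
  refine submodule_induct (K.comap Φ) h ?_ b
  intro a b ha _
  simp only [Submodule.mem_comap] at ha ⊢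
  rw [hΦ]
  exact hK _ _ ha

theorem leftIdeal_fg {U : Type} [Ring U] {n : ℕ} {κ : Type} [Fintype κ] (x : Fin n → U)
    (hgen : Subring.closure (Set.range x) = ⊤) (y : κ → U)
    (i0 : κ) (hi0 : y i0 = 1) (ix : Fin n → κ) (hix : ∀ j, y (ix j) = x j)
    (L : Submodule ℤ U) (hL : ∀ u, ∀ l ∈ L, u * l ∈ L)
    (hcov : ∀ u, ∃ c : κ →₀ ℤ, u - Finsupp.linearCombination ℤ y c ∈ L) :
    ∃ (m : ℕ) (ev : FreeNUAlg ℤ (Fin m) →ₙₐ[ℤ] U), ∀ u, u ∈ L ↔ ∃ a, ev a = u := by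
  classical
  let π : (κ →₀ ℤ) →ₗ[ℤ] U := Finsupp.linearCombination ℤ y
  have hπ : ∀ j (r : ℤ), π (Finsupp.single j r) = r • y j := by intro j r; simp [π]
  choose q hq using hcov
  let NL : Submodule ℤ (κ →₀ ℤ) := L.comap π
  obtain ⟨T, hT⟩ : NL.FG := IsNoetherian.noetherian NL
  let Z0 : Finset U := T.image π ∪ (Finset.univ : Finset (κ × κ)).image
    (fun p => y p.1 * y p.2 - π (q (y p.1 * y p.2)))
  have hZ0L : ∀ z ∈ Z0, z ∈ L := by
    intro z hz
    simp only [Z0, Finset.mem_union, Finset.mem_image] at hz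
    rcases hz with ⟨c, hc, rfl⟩ | ⟨p, _, rfl⟩
    · have : c ∈ NL := by rw [← hT]; exact Submodule.subset_span hc
      exact this
    · exact hq _
  let Z : Finset U := ((Finset.univ : Finset (κ)) ×ˢ Z0).image (fun p => y p.1 * p.2)
  have hZ : ∀ i, ∀ z ∈ Z0, y i * z ∈ Z := by
    intro i z hz
    exact Finset.mem_image.2 ⟨(i, z), by simp [hz], rfl⟩
  obtain ⟨ev, hev⟩ := exists_lift (X := Fin Z.card) (fun j => ((Z.equivFin.symm j : Z) : U))
  have hevZ : ∀ z ∈ Z, ∃ a, ev a = z := by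
    intro z hz
    exact ⟨fof (Z.equivFin ⟨z, hz⟩), by rw [hev]; simp⟩
  have hevL : ∀ a, ev a ∈ L := by
    refine submodule_induct (L.comap (ev : FreeNUAlg ℤ (Fin Z.card) →ₗ[ℤ] U)) ?_ ?_
    · intro j
      simp only [Submodule.mem_comap, LinearMap.coe_coe]
      rw [hev]
      obtain ⟨p, hp, hpe⟩ := Finset.mem_image.1 (Z.equivFin.symm j).2
      rw [← hpe]
      exact hL _ _ (hZ0L _ (Finset.mem_product.1 hp).2)
    · intro a b _ hb
      simp only [Submodule.mem_comap, LinearMap.coe_coe] at hb ⊢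
      rw [map_mul]
      exact hL _ _ hb
  let W : Submodule ℤ U := LinearMap.range (ev : FreeNUAlg ℤ (Fin Z.card) →ₗ[ℤ] U)
  have hWmul : ∀ a ∈ W, ∀ b ∈ W, a * b ∈ W := by
    rintro _ ⟨a, rfl⟩ _ ⟨b, rfl⟩
    exact ⟨a * b, map_mul ev a b⟩
  have hWZ : ∀ i, ∀ z ∈ Z0, y i * z ∈ W := fun i z hz => hevZ _ (hZ i z hz)
  have hWZ0 : ∀ z ∈ Z0, z ∈ W := by
    intro z hz
    have := hWZ i0 z hz
    rwa [hi0, one_mul] at this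
  have hw : ∀ i j, y i * y j - π (q (y i * y j)) ∈ Z0 := by
    intro i j
    exact Finset.mem_union_right _ (Finset.mem_image.2 ⟨(i, j), Finset.mem_univ _, rfl⟩)
  have hπW : ∀ c, ∀ z ∈ Z0, π c * z ∈ W := by
    intro c z hz
    induction c using Finsupp.induction_linear with
    | zero => simp
    | add a b ha hb => rw [map_add, add_mul]; exact W.add_mem ha hb
    | single j r => rw [hπ, smul_mul_assoc]; exact W.smul_mem r (hWZ _ _ hz)
  have hyW : ∀ i, ∀ a, y i * ev a ∈ W := by
    intro i
    refine submodule_induct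
      (W.comap ((LinearMap.mulLeft ℤ (y i)) ∘ₗ (ev : FreeNUAlg ℤ (Fin Z.card) →ₗ[ℤ] U))) ?_ ?_
    · intro j
      change y i * ev (fof j) ∈ W
      rw [hev]
      obtain ⟨⟨i', z⟩, hp, hpe⟩ := Finset.mem_image.1 (Z.equivFin.symm j).2
      rw [← hpe]
      have hz := (Finset.mem_product.1 hp).2
      have e : y i * (y i' * z) = (y i * y i' - π (q (y i * y i'))) * z
          + π (q (y i * y i')) * z := by
        rw [sub_mul, sub_add_cancel, mul_assoc]
      simp only
      rw [e]
      exact W.add_mem (hWmul _ (hWZ0 _ (hw _ _)) _ (hWZ0 _ hz)) (hπW _ _ hz)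
    · intro a b ha _
      change y i * ev (a * b) ∈ W
      rw [map_mul, ← mul_assoc]
      exact hWmul _ ha _ ⟨b, rfl⟩
  let D : Submodule ℤ U := LinearMap.range π ⊔ W
  have hD : ∀ u : U, ∀ d ∈ D, u * d ∈ D := by
    intro u
    have hu : u ∈ Subring.closure (Set.range x) := by rw [hgen]; trivial
    induction hu using Subring.closure_induction with
    | mem u hu =>
      obtain ⟨j, rfl⟩ := hu
      rw [← hix]
      intro d hd
      obtain ⟨_, ⟨c, rfl⟩, _, ⟨a, rfl⟩, rfl⟩ := Submodule.mem_sup.1 hd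
      rw [mul_add]
      refine D.add_mem ?_ (Submodule.mem_sup_right (hyW _ _))
      induction c using Finsupp.induction_linear with
      | zero => simp
      | add a b ha hb =>
        rw [map_add, mul_add]
        refine D.add_mem (ha ?_) (hb ?_)
        · exact D.add_mem (Submodule.mem_sup_left ⟨_, rfl⟩) (Submodule.mem_sup_right ⟨_, rfl⟩)
        · exact D.add_mem (Submodule.mem_sup_left ⟨_, rfl⟩) (Submodule.mem_sup_right ⟨_, rfl⟩)
      | single i r =>
        rw [hπ, mul_smul_comm]
        refine D.smul_mem r ?_
        rw [← sub_add_cancel (y (ix j) * y i) (π (q (y (ix j) * y i)))]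
        exact D.add_mem (Submodule.mem_sup_right (hWZ0 _ (hw _ _)))
          (Submodule.mem_sup_left ⟨_, rfl⟩)
    | zero => intro d _; rw [zero_mul]; exact D.zero_mem
    | one => intro d hd; rwa [one_mul]
    | add a b _ _ ha hb => intro d hd; rw [add_mul]; exact D.add_mem (ha d hd) (hb d hd)
    | neg a _ ha => intro d hd; rw [neg_mul]; exact D.neg_mem (ha d hd)
    | mul a b _ _ ha hb => intro d hd; rw [mul_assoc]; exact ha _ (hb d hd)
  refine ⟨Z.card, ev, fun u => ⟨fun hu => ?_, ?_⟩⟩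
  · have h1 : (1 : U) ∈ D := by
      refine Submodule.mem_sup_left ⟨Finsupp.single i0 1, ?_⟩
      rw [hπ, hi0, one_smul]
    have h2 := hD u 1 h1
    rw [mul_one] at h2
    obtain ⟨_, ⟨c, rfl⟩, _, ⟨a, rfl⟩, rfl⟩ := Submodule.mem_sup.1 h2
    have hc : c ∈ NL := by
      have := L.sub_mem hu (hevL a)
      rwa [LinearMap.coe_coe, add_sub_cancel_right] at this
    have hcW : π c ∈ W := by
      have : NL ≤ W.comap π := by
        rw [← hT, Submodule.span_le]
        intro c hc
        exact hWZ0 _ (Finset.mem_union_left _ (Finset.mem_image.2 ⟨c, hc, rfl⟩))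
      exact this hc
    exact W.add_mem hcW ⟨a, rfl⟩
  · rintro ⟨a, rfl⟩
    exact hevL a

end LeftIdeal

section LeftIdealFP

theorem leftIdeal_fp {U : Type} [Ring U] {n : ℕ} {κ : Type} [Fintype κ] (x : Fin n → U)
    (hgen : Subring.closure (Set.range x) = ⊤)
    (huniv : ∀ (M : Type) [AddCommGroup M] (μ : Fin n → Module.End ℤ M),
      ∃ g : U →+* Module.End ℤ M, ∀ j, g (x j) = μ j)
    (y : κ → U)
    (i0 : κ) (hi0 : y i0 = 1) (ix : Fin n → κ) (hix : ∀ j, y (ix j) = x j)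
    (L : Submodule ℤ U) (hL : ∀ u, ∀ l ∈ L, u * l ∈ L)
    (hcov : ∀ u, ∃ c : κ →₀ ℤ, u - Finsupp.linearCombination ℤ y c ∈ L) :
    ∃ (m : ℕ) (ev : FreeNUAlg ℤ (Fin m) →ₙₐ[ℤ] U), (∀ u, u ∈ L ↔ ∃ a, ev a = u) ∧
      ∃ s : Finset (FreeNUAlg ℤ (Fin m)),
        ∀ a, ev a = 0 ↔ a ∈ idealSpan ℤ (s : Set (FreeNUAlg ℤ (Fin m))) := by
  classical
  obtain ⟨m, ev, hev⟩ := leftIdeal_fg x hgen y i0 hi0 ix hix L hL hcov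
  have hevL : ∀ a, ev a ∈ L := fun a => (hev _).2 ⟨a, rfl⟩
  let evl : FreeNUAlg ℤ (Fin m) →ₗ[ℤ] U := ev
  have hevl : ∀ a, evl a = ev a := fun _ => rfl
  let π : (κ →₀ ℤ) →ₗ[ℤ] U := Finsupp.linearCombination ℤ y
  have hπ : ∀ j (r : ℤ), π (Finsupp.single j r) = r • y j := by intro j r; simp [π]
  let p : ((κ →₀ ℤ) × FreeNUAlg ℤ (Fin m)) →ₗ[ℤ] U := π.coprod evl
  have hp : ∀ c, p c = π c.1 + ev c.2 := fun c => rfl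
  have hpsurj : Function.Surjective p := by
    intro u
    obtain ⟨c, hc⟩ := hcov u
    obtain ⟨a, ha⟩ := (hev _).1 hc
    refine ⟨(c, a), ?_⟩
    rw [hp, ha]
    exact add_sub_cancel _ _
  have hQex : ∀ i, ∃ Q : (κ →₀ ℤ) →ₗ[ℤ] ((κ →₀ ℤ) × FreeNUAlg ℤ (Fin m)),
      ∀ c, p (Q c) = y i * π c := by
    intro i
    obtain ⟨Q, hQ⟩ := Module.projective_lifting_property p ((LinearMap.mulLeft ℤ (y i)) ∘ₗ π) hpsurj
    exact ⟨Q, fun c => LinearMap.congr_fun hQ c⟩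
  choose Q hQ using hQex
  let NL : Submodule ℤ (κ →₀ ℤ) := L.comap π
  obtain ⟨w, hw⟩ : ∃ w : NL →ₗ[ℤ] FreeNUAlg ℤ (Fin m), ∀ c : NL, ev (w c) = π c := by
    let e' : FreeNUAlg ℤ (Fin m) →ₗ[ℤ] L := evl.codRestrict L hevL
    let π' : NL →ₗ[ℤ] L := (π ∘ₗ NL.subtype).codRestrict L (fun c => c.2)
    have hs : Function.Surjective e' := by
      rintro ⟨u, hu⟩
      obtain ⟨a, ha⟩ := (hev u).1 hu
      exact ⟨a, Subtype.ext ha⟩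
    obtain ⟨w, hw⟩ := Module.projective_lifting_property e' π' hs
    exact ⟨w, fun c => congrArg Subtype.val (LinearMap.congr_fun hw c)⟩
  have hlamex : ∀ i, ∃ l : FreeNUAlg ℤ (Fin m) →ₗ[ℤ] FreeNUAlg ℤ (Fin m),
      (∀ a b, l (a * b) = l a * b) ∧ ∀ a, ev (l a) = y i * ev a := by
    intro i
    have : ∀ z : Fin m, ∃ a, ev a = y i * ev (fof z) := fun z => (hev _).1 (hL _ _ (hevL _))
    choose v hv using this
    obtain ⟨l, hl1, hl2⟩ := exists_rlin v
    refine ⟨l, hl2, fun a => ?_⟩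
    refine finduct (P := fun a => ev (l a) = y i * ev a) (by simp) ?_ ?_ ?_ ?_ a
    · intro z; rw [hl1, hv]
    · intro a b ha hb; rw [map_add, map_add, map_add, ha, hb, mul_add]
    · intro a ha; rw [map_neg, map_neg, map_neg, ha, mul_neg]
    · intro a b ha _; rw [hl2, map_mul, map_mul, ha, mul_assoc]
  choose lam hlam hevlam using hlamex
  let Λ : (κ →₀ ℤ) →ₗ[ℤ] (FreeNUAlg ℤ (Fin m) →ₗ[ℤ] FreeNUAlg ℤ (Fin m)) :=
    Finsupp.linearCombination ℤ lam
  have hΛj : ∀ j (r : ℤ), Λ (Finsupp.single j r) = r • lam j := by intro j r; simp [Λ]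
  have hΛ : ∀ c a b, Λ c (a * b) = Λ c a * b := by
    intro c a b
    induction c using Finsupp.induction_linear with
    | zero => simp
    | add c d hc hd => simp only [map_add, LinearMap.add_apply, hc, hd, add_mul]
    | single j r => simp only [hΛj, LinearMap.smul_apply, hlam, smul_mul_assoc]
  have hevΛ : ∀ c a, ev (Λ c a) = π c * ev a := by
    intro c a
    induction c using Finsupp.induction_linear with
    | zero => simp
    | add c d hc hd => simp only [map_add, LinearMap.add_apply, hc, hd, add_mul]
    | single j r => simp only [hΛj, LinearMap.smul_apply, map_zsmul, hevlam, hπ, smul_mul_assoc]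
  have hQNL : ∀ i (c : NL), (Q i c).1 ∈ NL := by
    intro i c
    have h1 := hQ i c
    rw [hp] at h1
    have h2 : y i * π c ∈ L := hL _ _ c.2
    rw [← h1] at h2
    have := L.sub_mem h2 (hevL (Q i c).2)
    rwa [add_sub_cancel_right] at this
  let Qr : ∀ _ : κ, NL →ₗ[ℤ] NL := fun i =>
    ((LinearMap.fst ℤ _ _) ∘ₗ (Q i) ∘ₗ NL.subtype).codRestrict NL (hQNL i)
  have hQr : ∀ i c, ((Qr i c : NL) : κ →₀ ℤ) = (Q i c).1 := fun _ _ => rfl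
  let r4 : ∀ _ : κ, NL →ₗ[ℤ] FreeNUAlg ℤ (Fin m) := fun i =>
    w ∘ₗ Qr i + (LinearMap.snd ℤ _ _) ∘ₗ (Q i) ∘ₗ NL.subtype - lam i ∘ₗ w
  have hr4 : ∀ i c, r4 i c = w (Qr i c) + (Q i c).2 - lam i (w c) := fun _ _ => rfl
  obtain ⟨T, hT⟩ : (⊤ : Submodule ℤ NL).FG := IsNoetherian.noetherian ⊤
  let P0 : Finset (FreeNUAlg ℤ (Fin m)) :=
    ((Finset.univ : Finset (Fin m)).image (fun z => lam i0 (fof z) - fof z)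
    ∪ (Finset.univ : Finset (κ × κ × Fin m)).image
        (fun t => lam t.1 (lam t.2.1 (fof t.2.2))
          - Λ (Q t.1 (Finsupp.single t.2.1 1)).1 (fof t.2.2)
          - (Q t.1 (Finsupp.single t.2.1 1)).2 * fof t.2.2))
    ∪ ((T ×ˢ (Finset.univ : Finset (Fin m))).image (fun t => Λ t.1 (fof t.2) - w t.1 * fof t.2)
    ∪ (T ×ˢ (Finset.univ : Finset (κ))).image (fun t => r4 t.2 t.1))
  have hP0ev : ∀ a ∈ P0, ev a = 0 := by
    intro a ha
    simp only [P0, Finset.mem_union, Finset.mem_image] at ha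
    rcases ha with (⟨z, _, rfl⟩ | ⟨⟨i, j, z⟩, _, rfl⟩) | (⟨⟨c, z⟩, _, rfl⟩ | ⟨⟨c, i⟩, _, rfl⟩)
    · rw [map_sub, hevlam, hi0, one_mul, sub_self]
    · simp only [map_sub, hevlam, hevΛ, map_mul]
      have h1 := hQ i (Finsupp.single j 1)
      rw [hp, hπ, one_smul] at h1
      rw [← mul_assoc, ← h1, add_mul]
      abel
    · simp only [map_sub, hevΛ, map_mul, hw, sub_self]
    · simp only [hr4, map_sub, map_add, hw, hevlam, hQr]
      rw [← hQ, hp, sub_self]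
  let P1 : Finset (FreeNUAlg ℤ (Fin m)) :=
    P0 ∪ ((Finset.univ : Finset (κ)) ×ˢ P0).image (fun t => lam t.1 t.2)
  have hP1ev : ∀ a ∈ P1, ev a = 0 := by
    intro a ha
    simp only [P1, Finset.mem_union, Finset.mem_image] at ha
    rcases ha with ha | ⟨⟨i, b⟩, hb, rfl⟩
    · exact hP0ev a ha
    · rw [hevlam, hP0ev b (Finset.mem_product.1 hb).2, mul_zero]
  let K := idealSpan ℤ (P1 : Set (FreeNUAlg ℤ (Fin m)))
  have hP1K : ∀ a ∈ P1, a ∈ K := fun a ha => subset_idealSpan _ ha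
  have hP0K : ∀ a ∈ P0, a ∈ K := fun a ha => hP1K a (Finset.mem_union_left _ ha)
  have hKr : ∀ a b, a ∈ K → a * b ∈ K := fun a b ha => idealSpan_mul_right b ha
  have hKl : ∀ a b, b ∈ K → a * b ∈ K := fun a b hb => idealSpan_mul_left a hb
  have F1 : ∀ b, lam i0 b - b ∈ K := by
    refine rlin_mem K hKr (lam i0 - LinearMap.id) ?_ ?_
    · intro a b; simp only [LinearMap.sub_apply, LinearMap.id_apply, hlam, sub_mul]
    · intro z
      apply hP0K
      simp only [P0, Finset.mem_union, Finset.mem_image]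
      exact Or.inl (Or.inl ⟨z, Finset.mem_univ _, rfl⟩)
  have F2j : ∀ i j b, lam i (lam j b) - Λ (Q i (Finsupp.single j 1)).1 b
      - (Q i (Finsupp.single j 1)).2 * b ∈ K := by
    intro i j
    refine rlin_mem K hKr (lam i ∘ₗ lam j - Λ (Q i (Finsupp.single j 1)).1
      - LinearMap.mulLeft ℤ (Q i (Finsupp.single j 1)).2) ?_ ?_
    · intro a b
      simp only [LinearMap.sub_apply, LinearMap.comp_apply, hlam, sub_mul, hΛ,
        LinearMap.mulLeft_apply, mul_assoc]
    · intro z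
      apply hP0K
      simp only [P0, Finset.mem_union, Finset.mem_image]
      exact Or.inl (Or.inr ⟨(i, j, z), Finset.mem_univ _, rfl⟩)
  have F2 : ∀ i c b, lam i (Λ c b) - Λ (Q i c).1 b - (Q i c).2 * b ∈ K := by
    intro i c b
    induction c using Finsupp.induction_linear with
    | zero => simp
    | add c d hc hd =>
      convert K.add_mem hc hd using 1
      simp only [map_add, LinearMap.add_apply, Prod.fst_add, Prod.snd_add, add_mul]
      abel
    | single j r =>
      convert K.smul_mem r (F2j i j b) using 1
      have : (Finsupp.single j r : κ →₀ ℤ) = r • Finsupp.single j 1 := by simp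
      rw [this]
      simp only [map_smul, Prod.smul_fst, Prod.smul_snd, LinearMap.smul_apply, smul_sub,
        smul_mul_assoc, hΛj, one_smul]
  have F3 : ∀ (c : NL) b, Λ c b - w c * b ∈ K := by
    intro c
    have hc : c ∈ Submodule.span ℤ (T : Set NL) := by rw [hT]; trivial
    induction hc using Submodule.span_induction with
    | mem c hc =>
      refine rlin_mem K hKr (Λ c - LinearMap.mulLeft ℤ (w c)) ?_ ?_
      · intro a b
        simp only [LinearMap.sub_apply, sub_mul, hΛ, LinearMap.mulLeft_apply, mul_assoc]
      · intro z
        apply hP0K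
        simp only [P0, Finset.mem_union, Finset.mem_image]
        exact Or.inr (Or.inl ⟨(c, z), Finset.mem_product.2 ⟨hc, Finset.mem_univ _⟩, rfl⟩)
    | zero => intro b; simp
    | add c d _ _ hc hd =>
      intro b
      convert K.add_mem (hc b) (hd b) using 1
      simp only [map_add, LinearMap.add_apply, Submodule.coe_add, add_mul]
      abel
    | smul r c _ hc =>
      intro b
      convert K.smul_mem r (hc b) using 1
      simp only [map_smul, LinearMap.smul_apply, Submodule.coe_smul, smul_sub, smul_mul_assoc]
  have F4 : ∀ i (c : NL), r4 i c ∈ K := by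
    intro i c
    have hle : (⊤ : Submodule ℤ NL) ≤ K.comap (r4 i) := by
      rw [← hT, Submodule.span_le]
      intro c hc
      apply hP0K
      simp only [P0, Finset.mem_union, Finset.mem_image]
      exact Or.inr (Or.inr ⟨(c, i), Finset.mem_product.2 ⟨hc, Finset.mem_univ _⟩, rfl⟩)
    exact hle (Submodule.mem_top (x := c))
  have hΛP0 : ∀ c, ∀ a ∈ P0, Λ c a ∈ K := by
    intro c a ha
    induction c using Finsupp.induction_linear with
    | zero => simp
    | add c d hc hd => rw [map_add]; exact K.add_mem hc hd
    | single j r =>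
      rw [hΛj]
      refine K.smul_mem r (hP1K _ (Finset.mem_union_right _ (Finset.mem_image.2
        ⟨(j, a), Finset.mem_product.2 ⟨Finset.mem_univ _, ha⟩, rfl⟩)))
  have hlamP1 : ∀ i, ∀ a ∈ P1, lam i a ∈ K := by
    intro i a ha
    simp only [P1, Finset.mem_union, Finset.mem_image] at ha
    rcases ha with ha | ⟨⟨j, b⟩, hb, rfl⟩
    · have := hΛP0 (Finsupp.single i 1) a ha
      rwa [hΛj, one_smul] at this
    · have hb := (Finset.mem_product.1 hb).2
      have h1 := K.add_mem (K.add_mem (F2j i j b) (hΛP0 (Q i (Finsupp.single j 1)).1 b hb))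
        (hKl (Q i (Finsupp.single j 1)).2 b (hP0K b hb))
      convert h1 using 1
      simp only
      abel
  have hlamK : ∀ i, ∀ a ∈ K, lam i a ∈ K := by
    intro i a ha
    have hle : K ≤ K ⊓ K.comap (lam i) := by
      refine idealSpan_le (fun a ha => ⟨hP1K a ha, hlamP1 i a ha⟩) ?_
      rintro a b ⟨hb1, hb2⟩
      refine ⟨⟨hKl _ _ hb1, ?_⟩, ⟨hKr _ _ hb1, ?_⟩⟩
      · change lam i (a * b) ∈ K
        rw [hlam]; exact hKl _ _ hb1
      · change lam i (b * a) ∈ K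
        rw [hlam]; exact hKr _ _ hb2
    exact (hle ha).2
  have hKev : ∀ a ∈ K, ev a = 0 := fun a ha => idealSpan_eq_zero_of ev hP1ev ha
  -- the module
  let Θ : (NL × FreeNUAlg ℤ (Fin m)) →ₗ[ℤ] ((κ →₀ ℤ) × FreeNUAlg ℤ (Fin m)) :=
    (NL.subtype ∘ₗ LinearMap.fst ℤ _ _).prod (LinearMap.snd ℤ _ _ - w ∘ₗ LinearMap.fst ℤ _ _)
  let D : Submodule ℤ ((κ →₀ ℤ) × FreeNUAlg ℤ (Fin m)) := (Submodule.prod ⊤ K).map Θ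
  have hDmem : ∀ (c : NL) a, a ∈ K → ((c : κ →₀ ℤ), a - w c) ∈ D :=
    fun c a ha => ⟨(c, a), ⟨trivial, ha⟩, rfl⟩
  have hDel : ∀ d ∈ D, ∃ (c : NL) (a : _), a ∈ K ∧ d = ((c : κ →₀ ℤ), a - w c) := by
    rintro _ ⟨⟨c, a⟩, ⟨_, ha⟩, rfl⟩
    exact ⟨c, a, ha, rfl⟩
  have hD0 : ∀ a, ((0 : κ →₀ ℤ), a) ∈ D ↔ a ∈ K := by
    intro a
    constructor
    · intro h
      obtain ⟨c, b, hb, he⟩ := hDel _ h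
      have h1 : c = 0 := Subtype.ext (congrArg Prod.fst he).symm
      have h2 := congrArg Prod.snd he
      simp only [h1, map_zero, sub_zero] at h2
      rw [h2]; exact hb
    · intro h
      have := hDmem 0 a h
      simpa using this
  let μ0 : ∀ _ : κ, ((κ →₀ ℤ) × FreeNUAlg ℤ (Fin m)) →ₗ[ℤ]
      ((κ →₀ ℤ) × FreeNUAlg ℤ (Fin m)) := fun i =>
    Q i ∘ₗ LinearMap.fst ℤ _ _ + LinearMap.inr ℤ _ _ ∘ₗ lam i ∘ₗ LinearMap.snd ℤ _ _
  have hμ0 : ∀ i c a, μ0 i (c, a) = ((Q i c).1, (Q i c).2 + lam i a) := by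
    intro i c a
    change Q i c + (0, lam i a) = _
    ext <;> simp
  have hμ0D : ∀ i, D ≤ D.comap (μ0 i) := by
    intro i d hd
    obtain ⟨c, a, ha, rfl⟩ := hDel d hd
    rw [Submodule.mem_comap, hμ0]
    have := hDmem (Qr i c) (r4 i c + lam i a) (K.add_mem (F4 i c) (hlamK i a ha))
    convert this using 2
    · rfl
    · rw [hr4, map_sub]
      abel
  let μ : ∀ _ : κ, Module.End ℤ (_ ⧸ D) := fun i => D.mapQ D (μ0 i) (hμ0D i)
  have hμ : ∀ i d, μ i (D.mkQ d) = D.mkQ (μ0 i d) := fun i d => rfl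
  let ρ0 : ∀ _ : FreeNUAlg ℤ (Fin m), ((κ →₀ ℤ) × FreeNUAlg ℤ (Fin m)) →ₗ[ℤ]
      ((κ →₀ ℤ) × FreeNUAlg ℤ (Fin m)) := fun b =>
    LinearMap.inr ℤ _ _ ∘ₗ (Λ.flip b ∘ₗ LinearMap.fst ℤ _ _ +
      LinearMap.mulRight ℤ b ∘ₗ LinearMap.snd ℤ _ _)
  have hρ0 : ∀ b c a, ρ0 b (c, a) = (0, Λ c b + a * b) := fun b c a => rfl
  have hρ0D : ∀ b, D ≤ D.comap (ρ0 b) := by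
    intro b d hd
    obtain ⟨c, a, ha, rfl⟩ := hDel d hd
    rw [Submodule.mem_comap, hρ0, hD0]
    convert K.add_mem (F3 c b) (hKr a b ha) using 1
    rw [sub_mul]
    abel
  let ρ : ∀ _ : FreeNUAlg ℤ (Fin m), Module.End ℤ (_ ⧸ D) := fun b => D.mapQ D (ρ0 b) (hρ0D b)
  have hρ : ∀ i d, ρ i (D.mkQ d) = D.mkQ (ρ0 i d) := fun i d => rfl
  have hpD : D ≤ LinearMap.ker p := by
    intro d hd
    obtain ⟨c, a, ha, rfl⟩ := hDel d hd
    rw [LinearMap.mem_ker, hp]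
    simp only [map_sub, hw, hKev a ha]
    abel
  let pb : (_ ⧸ D) →ₗ[ℤ] U := D.liftQ p hpD
  have hpb : ∀ d, pb (D.mkQ d) = p d := fun d => rfl
  have hmk : ∀ q : (_ ⧸ D), ∃ d, D.mkQ d = q := D.mkQ_surjective
  obtain ⟨g, hg⟩ := huniv (_ ⧸ D) (fun j => μ (ix j))
  have hA : ∀ u q, pb (g u q) = u * pb q := by
    intro u
    have hu : u ∈ Subring.closure (Set.range x) := by rw [hgen]; trivial
    induction hu using Subring.closure_induction with
    | mem u hu =>
      obtain ⟨j, rfl⟩ := hu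
      intro q
      obtain ⟨⟨c, a⟩, rfl⟩ := hmk q
      rw [hg, hμ, hμ0, hpb, hpb, hp, hp]
      simp only [map_add, hevlam]
      rw [← add_assoc, ← hp, hQ, mul_add, hix]
    | zero => intro q; simp
    | one => intro q; simp
    | add a b _ _ ha hb => intro q; rw [map_add, LinearMap.add_apply, map_add, ha, hb, add_mul]
    | neg a _ ha => intro q; rw [map_neg, LinearMap.neg_apply, map_neg, ha, neg_mul]
    | mul a b _ _ ha hb => intro q; rw [map_mul, Module.End.mul_apply, ha, hb, mul_assoc]
  have hB : ∀ b u q, g u (ρ b q) = ρ b (g u q) := by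
    intro b u
    have hu : u ∈ Subring.closure (Set.range x) := by rw [hgen]; trivial
    induction hu using Subring.closure_induction with
    | mem u hu =>
      obtain ⟨j, rfl⟩ := hu
      intro q
      obtain ⟨⟨c, a⟩, rfl⟩ := hmk q
      rw [hg, hμ, hρ, hρ, hμ, ← sub_eq_zero, ← map_sub, hμ0, hρ0, hρ0, hμ0]
      rw [Submodule.mkQ_apply, Submodule.Quotient.mk_eq_zero]
      have h1 : ((Q (ix j) 0).1, (Q (ix j) 0).2 + lam (ix j) (Λ c b + a * b))
          - (0, Λ (Q (ix j) c).1 b + ((Q (ix j) c).2 + lam (ix j) a) * b)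
          = ((0 : κ →₀ ℤ), lam (ix j) (Λ c b) - Λ (Q (ix j) c).1 b - (Q (ix j) c).2 * b) := by
        rw [map_zero, map_add, hlam, add_mul]
        ext1
        · simp
        · simp only [Prod.snd_sub, Prod.snd_zero]
          abel
      rw [h1, hD0]
      exact F2 _ _ _
    | zero => intro q; simp
    | one => intro q; simp
    | add a b _ _ ha hb => intro q; simp only [map_add, LinearMap.add_apply, ha, hb]
    | neg a _ ha => intro q; simp only [map_neg, LinearMap.neg_apply, ha]
    | mul a b _ _ ha hb => intro q; simp only [map_mul, Module.End.mul_apply, ha, hb]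
  let one : (_ ⧸ D) := D.mkQ (Finsupp.single i0 1, 0)
  have hpone : pb one = 1 := by
    rw [hpb, hp]; simp only [map_zero, add_zero]
    rw [hπ, hi0, one_smul]
  have hone : ∀ b, ρ b one = D.mkQ (0, b) := by
    intro b
    rw [hρ, hρ0, ← sub_eq_zero, ← map_sub, Submodule.mkQ_apply, Submodule.Quotient.mk_eq_zero]
    have : ((0 : κ →₀ ℤ), Λ (Finsupp.single i0 1) b + 0 * b) - (0, b) = (0, lam i0 b - b) := by
      rw [hΛj, one_smul, zero_mul, add_zero]
      ext1 <;> simp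
    rw [this, hD0]
    exact F1 b
  have hsig : ∀ l ∈ L, ∃ a, g l one = D.mkQ (0, a) ∧ ev a = l := by
    intro l hl
    obtain ⟨⟨c, b⟩, hcb⟩ := hmk (g l one)
    have h1 := hA l one
    rw [hpone, mul_one, ← hcb, hpb, hp] at h1
    simp only at h1
    have hc : c ∈ NL := by
      have := L.sub_mem hl (hevL b)
      rw [← h1, add_sub_cancel_right] at this
      exact this
    refine ⟨b + w ⟨c, hc⟩, ?_, ?_⟩
    · rw [← hcb, ← sub_eq_zero, ← map_sub, Submodule.mkQ_apply, Submodule.Quotient.mk_eq_zero]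
      convert hDmem ⟨c, hc⟩ 0 K.zero_mem using 1
      ext1
      · simp
      · simp
    · rw [map_add, hw, add_comm]; exact h1
  choose s hs1 hs2 using fun z : Fin m => hsig (ev (fof z)) (hevL _)
  let P2 : Finset (FreeNUAlg ℤ (Fin m)) :=
    P1 ∪ (Finset.univ : Finset (Fin m)).image (fun z => s z - fof z)
  let K2 := idealSpan ℤ (P2 : Set (FreeNUAlg ℤ (Fin m)))
  have hKK2 : K ≤ K2 := idealSpan_mono (by
    intro a ha
    exact Finset.mem_union_left _ ha)
  have hmain : ∀ a, ∃ a', g (ev a) one = D.mkQ (0, a') ∧ a' - a ∈ K2 := by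
    intro a
    refine finduct (P := fun a => ∃ a', g (ev a) one = D.mkQ (0, a') ∧ a' - a ∈ K2)
      ?_ ?_ ?_ ?_ ?_ a
    · refine ⟨0, ?_, by simp⟩
      rw [map_zero, map_zero]
      exact (map_zero D.mkQ).symm
    · intro z
      exact ⟨s z, hs1 z, subset_idealSpan _ (Finset.mem_union_right _
        (Finset.mem_image.2 ⟨z, Finset.mem_univ _, rfl⟩))⟩
    · rintro a b ⟨a', ha, ha'⟩ ⟨b', hb, hb'⟩
      refine ⟨a' + b', ?_, ?_⟩
      · rw [map_add, map_add, LinearMap.add_apply, ha, hb, ← map_add]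
        simp
      · convert K2.add_mem ha' hb' using 1
        abel
    · rintro a ⟨a', ha, ha'⟩
      refine ⟨-a', ?_, ?_⟩
      · rw [map_neg, map_neg, LinearMap.neg_apply, ha, ← map_neg]
        simp
      · convert K2.neg_mem ha' using 1
        abel
    · rintro a b ⟨a', ha, ha'⟩ ⟨b', hb, hb'⟩
      refine ⟨a' * b', ?_, ?_⟩
      · rw [map_mul, map_mul, Module.End.mul_apply, hb, ← hone, hB, ha, hρ, hρ0]
        simp
      · have h1 : a' * b' - a * b = a' * (b' - b) + (a' - a) * b := by
          rw [mul_sub, sub_mul]; abel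
        rw [h1]
        exact K2.add_mem (idealSpan_mul_left _ hb') (idealSpan_mul_right _ ha')
  refine ⟨m, ev, hev, P2, fun a => ⟨fun ha => ?_, fun ha => ?_⟩⟩
  · obtain ⟨a', h1, h2⟩ := hmain a
    rw [ha, map_zero, LinearMap.zero_apply] at h1
    have h3 := h1.symm
    rw [Submodule.mkQ_apply, Submodule.Quotient.mk_eq_zero, hD0] at h3
    have := K2.sub_mem (hKK2 h3) h2
    rwa [sub_sub_cancel] at this
  · refine idealSpan_eq_zero_of ev ?_ ha
    intro b hb
    rcases Finset.mem_union.1 hb with hb | hb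
    · exact hP1ev b hb
    · obtain ⟨z, _, rfl⟩ := Finset.mem_image.1 hb
      rw [map_sub, hs2, sub_self]

end LeftIdealFP

section Final

theorem lc_mem {κ A : Type*} [AddCommGroup A] (V : Submodule ℤ A) (y : κ → A)
    (h : ∀ j, y j ∈ V) (c : κ →₀ ℤ) : Finsupp.linearCombination ℤ y c ∈ V := by
  have : Finsupp.linearCombination ℤ y c ∈ Submodule.span ℤ (Set.range y) :=
    (Finsupp.range_linearCombination ℤ (v := y)) ▸ LinearMap.mem_range_self _ c
  refine (Submodule.span_le.2 ?_) this
  rintro _ ⟨j, rfl⟩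
  exact h j

theorem cofin {A M : Type*} [AddCommGroup A] [AddCommGroup M] [IsNoetherian ℤ M]
    (ψ : A →ₗ[ℤ] M) :
    ∃ (k : ℕ) (y : Fin k → A), ∀ a, ∃ c : Fin k →₀ ℤ,
      ψ (a - Finsupp.linearCombination ℤ y c) = 0 := by
  obtain ⟨k, v, hv⟩ := Submodule.fg_iff_exists_fin_generating_family.1
    (IsNoetherian.noetherian (LinearMap.range ψ))
  have hy : ∀ j, ∃ a, ψ a = v j := by
    intro j
    have : v j ∈ LinearMap.range ψ := by rw [← hv]; exact Submodule.subset_span ⟨j, rfl⟩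
    exact this
  choose y hy using hy
  refine ⟨k, y, fun a => ?_⟩
  have ha : ψ a ∈ Submodule.span ℤ (Set.range v) := by rw [hv]; exact ⟨a, rfl⟩
  obtain ⟨c, hc⟩ := (Finsupp.mem_span_range_iff_exists_finsupp).1 ha
  refine ⟨c, ?_⟩
  rw [map_sub, sub_eq_zero, ← hc, Finsupp.linearCombination_apply, map_finsuppSum]
  simp [hy]

theorem leftIdeal_fp_of_fp {R : Type*} [NonUnitalRing R] {n : ℕ}
    (f : FreeNUAlg ℤ (Fin n) →ₙₐ[ℤ] R) (hf : Function.Surjective f)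
    (P : Finset (FreeNUAlg ℤ (Fin n)))
    (hP : ∀ x, f x = 0 ↔ x ∈ idealSpan ℤ (P : Set (FreeNUAlg ℤ (Fin n))))
    (L : Submodule ℤ R) (hL : ∀ r, ∀ l ∈ L, r * l ∈ L)
    {κ : Type} [Fintype κ] (y : κ → R)
    (hcov : ∀ r, ∃ c : κ →₀ ℤ, r - Finsupp.linearCombination ℤ y c ∈ L) :
    ∃ (m : ℕ) (e : FreeNUAlg ℤ (Fin m) →ₙₐ[ℤ] R), (∀ r, r ∈ L ↔ ∃ a, e a = r) ∧
      ∃ s : Finset (FreeNUAlg ℤ (Fin m)),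
        ∀ a, e a = 0 ↔ a ∈ idealSpan ℤ (s : Set (FreeNUAlg ℤ (Fin m))) := by
  classical
  let F := FreeNUAlg ℤ (Fin n)
  let U := Unitization ℤ F
  let inr : F → U := fun a => (Unitization.inr a : Unitization ℤ F)
  have inr_add : ∀ a b, inr (a + b) = inr a + inr b := fun a b => Unitization.inr_add ℤ a b
  have inr_neg : ∀ a, inr (-a) = -inr a := fun a => Unitization.inr_neg ℤ a
  have inr_zero : inr 0 = 0 := Unitization.inr_zero ℤ
  have inr_mul : ∀ a b, inr (a * b) = inr a * inr b := fun a b => Unitization.inr_mul ℤ a b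
  have inr_smul : ∀ (r : ℤ) a, inr (r • a) = r • inr a := fun r a => Unitization.inr_smul ℤ r a
  have inr_inj : ∀ a b, inr a = inr b → a = b := fun a b h =>
    congrArg (fun u : Unitization ℤ F => u.snd) h
  have hdecomp : ∀ u : U, u = u.fst • (1 : U) + inr u.snd := by
    intro u
    have h1 : (Unitization.inl u.fst : U) = u.fst • (1 : U) := by
      rw [← Algebra.algebraMap_eq_smul_one]
      exact (congrFun (Unitization.algebraMap_eq_inl (R := ℤ) (A := F)) u.fst).symm
    rw [← h1]
    exact (Unitization.inl_fst_add_inr_snd_eq u).symm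
  let x : Fin n → U := fun j => inr (fof j)
  have hgen : Subring.closure (Set.range x) = ⊤ := by
    rw [eq_top_iff]
    intro u _
    rw [hdecomp u]
    refine Subring.add_mem _ (Subring.zsmul_mem _ (Subring.one_mem _) _) ?_
    refine finduct (P := fun a => inr a ∈ Subring.closure (Set.range x)) ?_ ?_ ?_ ?_ ?_ u.snd
    · rw [inr_zero]; exact Subring.zero_mem _
    · intro j; exact Subring.subset_closure ⟨j, rfl⟩
    · intro a b ha hb; rw [inr_add]; exact Subring.add_mem _ ha hb
    · intro a ha; rw [inr_neg]; exact Subring.neg_mem _ ha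
    · intro a b ha hb; rw [inr_mul]; exact Subring.mul_mem _ ha hb
  have huniv : ∀ (M : Type) [AddCommGroup M] (μ : Fin n → Module.End ℤ M),
      ∃ g : U →+* Module.End ℤ M, ∀ j, g (x j) = μ j := by
    intro M _ μ
    obtain ⟨φ, hφ⟩ := exists_lift μ
    refine ⟨(Unitization.lift φ : Unitization ℤ F →ₐ[ℤ] Module.End ℤ M).toRingHom, fun j => ?_⟩
    rw [← hφ]
    exact congrArg (fun ψ : FreeNUAlg ℤ (Fin n) →ₙₐ[ℤ] Module.End ℤ M => ψ (fof j))
      (Unitization.lift.symm_apply_apply φ)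
  -- preimages of submodules
  let pre : Submodule ℤ R → Submodule ℤ U := fun V =>
    { carrier := {u | u.fst = 0 ∧ f u.snd ∈ V}
      add_mem' := by
        rintro a b ⟨ha, ha'⟩ ⟨hb, hb'⟩
        refine ⟨by rw [Unitization.fst_add, ha, hb, add_zero], ?_⟩
        rw [Unitization.snd_add, map_add]
        exact V.add_mem ha' hb'
      zero_mem' := ⟨rfl, by rw [Unitization.snd_zero, map_zero]; exact V.zero_mem⟩
      smul_mem' := by
        rintro r a ⟨ha, ha'⟩
        refine ⟨by rw [Unitization.fst_smul, ha, smul_zero], ?_⟩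
        rw [Unitization.snd_smul, map_zsmul]
        exact V.smul_mem r ha' }
  have hpre : ∀ V u, u ∈ pre V ↔ u.fst = 0 ∧ f u.snd ∈ V := fun V u => Iff.rfl
  have hpreinr : ∀ V a, inr a ∈ pre V ↔ f a ∈ V := by
    intro V a
    rw [hpre]
    simp [inr]
  have hpreel : ∀ V, ∀ u ∈ pre V, ∃ a, inr a = u ∧ f a ∈ V := by
    rintro V u ⟨h1, h2⟩
    refine ⟨u.snd, ?_, h2⟩
    conv_rhs => rw [hdecomp u, h1, zero_smul, zero_add]
  have hpreL : ∀ V : Submodule ℤ R, (∀ r, ∀ l ∈ V, r * l ∈ V) → ∀ u, ∀ l ∈ pre V, u * l ∈ pre V := by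
    intro V hV u l hl
    obtain ⟨a, rfl, ha⟩ := hpreel V l hl
    rw [hdecomp u, add_mul, smul_mul_assoc, one_mul, ← inr_mul]
    refine (pre V).add_mem ((pre V).smul_mem _ hl) ?_
    rw [hpreinr, map_mul]
    exact hV _ _ ha
  have hpreR : ∀ V : Submodule ℤ R, (∀ r, ∀ l ∈ V, l * r ∈ V) → ∀ u, ∀ l ∈ pre V, l * u ∈ pre V := by
    intro V hV u l hl
    obtain ⟨a, rfl, ha⟩ := hpreel V l hl
    rw [hdecomp u, mul_add, mul_smul_comm, mul_one, ← inr_mul]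
    refine (pre V).add_mem ((pre V).smul_mem _ hl) ?_
    rw [hpreinr, map_mul]
    exact hV _ _ ha
  choose yl hyl using fun j => hf (y j)
  let Y : Option (Fin n ⊕ κ) → U := fun o =>
    match o with
    | none => 1
    | some (Sum.inl j) => x j
    | some (Sum.inr j) => inr (yl j)
  have hcovU : ∀ u, ∃ c : Option (Fin n ⊕ κ) →₀ ℤ,
      u - Finsupp.linearCombination ℤ Y c ∈ pre L := by
    intro u
    let W : Submodule ℤ U := Submodule.span ℤ (Set.range Y)
    obtain ⟨c, hc⟩ := hcov (f u.snd)
    have h1 : inr (Finsupp.linearCombination ℤ yl c) ∈ W := by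
      have : ∀ a, a ∈ Submodule.span ℤ (Set.range yl) → inr a ∈ W := by
        intro a ha
        induction ha using Submodule.span_induction with
        | mem a ha => obtain ⟨j, rfl⟩ := ha; exact Submodule.subset_span ⟨some (Sum.inr j), rfl⟩
        | zero => rw [inr_zero]; exact W.zero_mem
        | add a b _ _ ha hb => rw [inr_add]; exact W.add_mem ha hb
        | smul r a _ ha => rw [inr_smul]; exact W.smul_mem r ha
      exact this _ (lc_mem (Submodule.span ℤ (Set.range yl)) yl
        (fun j => Submodule.subset_span (Set.mem_range_self j)) c)
    have h2 : u.fst • (1 : U) + inr (Finsupp.linearCombination ℤ yl c) ∈ W :=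
      W.add_mem (W.smul_mem _ (Submodule.subset_span ⟨none, rfl⟩)) h1
    obtain ⟨C, hC⟩ := (Finsupp.mem_span_range_iff_exists_finsupp).1 h2
    refine ⟨C, ?_⟩
    rw [Finsupp.linearCombination_apply, hC]
    have h3 : u - (u.fst • (1 : U) + inr (Finsupp.linearCombination ℤ yl c))
        = inr (u.snd + -(Finsupp.linearCombination ℤ yl c)) := by
      rw [inr_add, inr_neg]
      nth_rewrite 1 [hdecomp u]
      abel
    rw [h3, hpreinr, map_add, map_neg, ← sub_eq_add_neg]
    convert hc using 2
    rw [Finsupp.linearCombination_apply, Finsupp.linearCombination_apply, map_finsuppSum]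
    simp [hyl]
  obtain ⟨m, ev, hev, s0, hs0⟩ := leftIdeal_fp x hgen huniv Y none rfl
    (fun j => some (Sum.inl j)) (fun j => rfl) (pre L) (hpreL L hL) hcovU
  have hevpre : ∀ a, ev a ∈ pre L := fun a => (hev _).2 ⟨a, rfl⟩
  choose hz hhz _ using fun z : Fin m => hpreel L _ (hevpre (fof z))
  obtain ⟨h, hh⟩ := exists_lift hz
  have hinrh : ∀ a, inr (h a) = ev a := by
    intro a
    refine finduct (P := fun a => inr (h a) = ev a) ?_ ?_ ?_ ?_ ?_ a
    · rw [map_zero, map_zero, inr_zero]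
    · intro z; rw [hh, hhz]
    · intro a b ha hb; rw [map_add, map_add, inr_add, ha, hb]
    · intro a ha; rw [map_neg, map_neg, inr_neg, ha]
    · intro a b ha hb; rw [map_mul, map_mul, inr_mul, ha, hb]
  have hbot1 : ∀ u, ∀ l ∈ pre ⊥, u * l ∈ pre ⊥ := hpreL ⊥ (by
    intro r l hl; rw [Submodule.mem_bot] at hl ⊢; rw [hl, mul_zero])
  have hbot2 : ∀ u, ∀ l ∈ pre ⊥, l * u ∈ pre ⊥ := hpreR ⊥ (by
    intro r l hl; rw [Submodule.mem_bot] at hl ⊢; rw [hl, zero_mul])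
  have hbotL : ∀ u ∈ pre ⊥, u ∈ pre L := by
    rintro u ⟨h1, h2⟩
    rw [Submodule.mem_bot] at h2
    exact ⟨h1, by rw [h2]; exact L.zero_mem⟩
  have hPbot : ∀ p ∈ P, inr p ∈ pre ⊥ := by
    intro p hp
    rw [hpreinr, Submodule.mem_bot, hP]
    exact subset_idealSpan _ hp
  have hlift : ∀ t : Option (Fin n ⊕ κ) × F × Option (Fin n ⊕ κ), ∃ b, t.2.1 ∈ P →
      ev b = Y t.1 * inr t.2.1 * Y t.2.2 := by
    rintro ⟨i, p, j⟩
    by_cases hp : p ∈ P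
    · obtain ⟨b, hb⟩ := (hev _).1 (hbotL _ (hbot2 (Y j) _ (hbot1 (Y i) _ (hPbot p hp))))
      exact ⟨b, fun _ => hb⟩
    · exact ⟨0, fun h => absurd h hp⟩
  choose bl hbl using hlift
  let s : Finset (FreeNUAlg ℤ (Fin m)) := s0 ∪
    ((Finset.univ : Finset (Option (Fin n ⊕ κ))) ×ˢ (P ×ˢ
      (Finset.univ : Finset (Option (Fin n ⊕ κ))))).image bl
  let K := idealSpan ℤ (s : Set (FreeNUAlg ℤ (Fin m)))
  have hker : ∀ a, ev a = 0 → a ∈ K := fun a ha =>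
    idealSpan_mono (fun b hb => Finset.mem_union_left _ hb) ((hs0 a).1 ha)
  let J : Submodule ℤ U := K.map (ev : FreeNUAlg ℤ (Fin m) →ₗ[ℤ] U)
  have hJl : ∀ l ∈ pre L, ∀ v ∈ J, l * v ∈ J := by
    rintro l hl _ ⟨b, hb, rfl⟩
    obtain ⟨a, rfl⟩ := (hev l).1 hl
    exact ⟨a * b, idealSpan_mul_left a hb, map_mul ev a b⟩
  have hJr : ∀ l ∈ pre L, ∀ v ∈ J, v * l ∈ J := by
    rintro l hl _ ⟨b, hb, rfl⟩
    obtain ⟨a, rfl⟩ := (hev l).1 hl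
    exact ⟨b * a, idealSpan_mul_right a hb, map_mul ev b a⟩
  have hJY : ∀ i j, ∀ p ∈ P, Y i * inr p * Y j ∈ J := by
    intro i j p hp
    refine ⟨bl (i, p, j), subset_idealSpan _ (Finset.mem_union_right _ (Finset.mem_image.2
      ⟨(i, p, j), by simp [hp], rfl⟩)), ?_⟩
    exact hbl (i, p, j) hp
  have hsplit : ∀ u, ∃ c : Option (Fin n ⊕ κ) →₀ ℤ, ∃ l ∈ pre L,
      u = Finsupp.linearCombination ℤ Y c + l := by
    intro u
    obtain ⟨c, hc⟩ := hcovU u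
    exact ⟨c, _, hc, (add_sub_cancel _ _).symm⟩
  have hJ1 : ∀ i v, ∀ p ∈ P, Y i * inr p * v ∈ J := by
    intro i v p hp
    obtain ⟨c, l, hl, rfl⟩ := hsplit v
    rw [mul_add]
    refine J.add_mem ?_ (hJr l hl _ ?_)
    · exact lc_mem (J.comap (LinearMap.mulLeft ℤ (Y i * inr p))) Y (fun j => hJY i j p hp) c
    · have := hJY i none p hp
      rwa [show Y none = 1 from rfl, mul_one] at this
  have hJ2 : ∀ u v, ∀ p ∈ P, u * inr p * v ∈ J := by
    intro u v p hp
    obtain ⟨c, l, hl, rfl⟩ := hsplit u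
    rw [mul_assoc, add_mul]
    refine J.add_mem ?_ (hJl l hl _ ?_)
    · refine lc_mem (J.comap (LinearMap.mulRight ℤ (inr p * v))) Y (fun i => ?_) c
      have := hJ1 i v p hp
      rwa [mul_assoc] at this
    · have := hJ1 none v p hp
      rwa [show Y none = 1 from rfl, one_mul] at this
  let V : Submodule ℤ F :=
    { carrier := {a | ∀ u v, u * inr a * v ∈ J}
      add_mem' := by
        intro a b ha hb u v
        rw [inr_add, mul_add, add_mul]
        exact J.add_mem (ha u v) (hb u v)
      zero_mem' := by
        intro u v
        rw [inr_zero, mul_zero, zero_mul]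
        exact J.zero_mem
      smul_mem' := by
        intro r a ha u v
        rw [inr_smul, mul_smul_comm, smul_mul_assoc]
        exact J.smul_mem r (ha u v) }
  have hV : ∀ a, f a = 0 → inr a ∈ J := by
    intro a ha
    have hle : idealSpan ℤ (P : Set (FreeNUAlg ℤ (Fin n))) ≤ V := by
      refine idealSpan_le (fun p hp u v => hJ2 u v p hp) ?_
      intro a b hb
      refine ⟨fun u v => ?_, fun u v => ?_⟩
      · rw [inr_mul, ← mul_assoc]; exact hb _ _
      · rw [inr_mul, ← mul_assoc, mul_assoc]; exact hb _ _
    have := hle ((hP a).1 ha) 1 1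
    rwa [one_mul, mul_one] at this
  refine ⟨m, f.comp h, fun r => ⟨fun hr => ?_, ?_⟩, s, fun a => ⟨fun ha => ?_, fun ha => ?_⟩⟩
  · obtain ⟨a, rfl⟩ := hf r
    obtain ⟨b, hb⟩ := (hev _).1 ((hpreinr L a).2 hr)
    rw [← hinrh] at hb
    exact ⟨b, by rw [NonUnitalAlgHom.comp_apply, inr_inj _ _ hb]⟩
  · rintro ⟨a, rfl⟩
    rw [NonUnitalAlgHom.comp_apply, ← hpreinr, hinrh]
    exact hevpre a
  · have h1 := hV (h a) ha
    rw [hinrh] at h1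
    obtain ⟨b, hb, hba⟩ := h1
    have h2 : a - b ∈ K := hker _ (by
      rw [map_sub, sub_eq_zero]; exact hba.symm)
    have := K.add_mem h2 hb
    rwa [sub_add_cancel] at this
  · refine idealSpan_eq_zero_of (f.comp h) ?_ ha
    intro b hb
    rw [NonUnitalAlgHom.comp_apply, ← Submodule.mem_bot ℤ, ← hpreinr, hinrh]
    rcases Finset.mem_union.1 hb with hb | hb
    · rw [(hs0 b).2 (subset_idealSpan _ hb)]
      exact (pre ⊥).zero_mem
    · obtain ⟨⟨i, p, j⟩, hp, rfl⟩ := Finset.mem_image.1 hb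
      have hp : p ∈ P := (Finset.mem_product.1 (Finset.mem_product.1 hp).2).1
      rw [hbl _ hp]
      exact hbot2 _ _ (hbot1 _ _ (hPbot p hp))

end Final

end FPProof

/-- Let `R` be a ring (not necessarily commutative or with identity,
i.e. a `ℤ`-algebra), and let `S` be a subring of `R` such that the quotient `R/S` is a
finitely generated abelian group. Then `R` is finitely presented as a ring if and only if
`S` is finitely presented as a ring. -/
theorem subring_fg_quotient_fp_iff
    (R : Type*) [NonUnitalRing R] (S : NonUnitalSubring R)
    (h : AddGroup.FG (R ⧸ S.toAddSubgroup)) :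
    NUAlgFP ℤ R ↔ NUAlgFP ℤ S := by
  classical
  let S' : Submodule ℤ R := AddSubgroup.toIntSubmodule S.toAddSubgroup
  have hS' : ∀ r, r ∈ S' ↔ r ∈ S := fun r => Iff.rfl
  have hfin : Module.Finite ℤ (R ⧸ S') := Module.Finite.iff_addGroup_fg.2 h
  have hnoeth : IsNoetherian ℤ (R ⧸ S') := inferInstance
  obtain ⟨k, y, hy⟩ := FPProof.cofin S'.mkQ
  have hy' : ∀ r, ∃ c : Fin k →₀ ℤ, r - Finsupp.linearCombination ℤ y c ∈ S := by
    intro r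
    obtain ⟨c, hc⟩ := hy r
    refine ⟨c, ?_⟩
    rwa [Submodule.mkQ_apply, Submodule.Quotient.mk_eq_zero] at hc
  constructor
  · rintro ⟨n, f, hf, P, hP⟩
    let ψ : R →ₗ[ℤ] (Fin k → R ⧸ S') :=
      LinearMap.pi (fun j => S'.mkQ ∘ₗ LinearMap.mulLeft ℤ (y j))
    have hψ : ∀ s, ψ s = 0 ↔ ∀ j, y j * s ∈ S := by
      intro s
      rw [funext_iff]
      refine forall_congr' fun j => ?_
      change S'.mkQ (y j * s) = 0 ↔ _
      rw [Submodule.mkQ_apply, Submodule.Quotient.mk_eq_zero]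
      rfl
    let L : Submodule ℤ R := S' ⊓ LinearMap.ker ψ
    have hLmem : ∀ s, s ∈ L ↔ s ∈ S ∧ ∀ j, y j * s ∈ S := by
      intro s
      rw [← hψ]
      rfl
    have hLS : ∀ r, ∀ l ∈ L, r * l ∈ S := by
      intro r l hl
      rw [hLmem] at hl
      obtain ⟨c, hc⟩ := hy' r
      rw [← sub_add_cancel r (Finsupp.linearCombination ℤ y c), add_mul]
      refine S.add_mem (S.mul_mem hc hl.1) ?_
      exact FPProof.lc_mem (S'.comap (LinearMap.mulRight ℤ l)) y hl.2 c
    have hL : ∀ r, ∀ l ∈ L, r * l ∈ L := by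
      intro r l hl
      rw [hLmem]
      refine ⟨hLS r l hl, fun j => ?_⟩
      rw [← mul_assoc]
      exact hLS _ l hl
    obtain ⟨k', y', hy2⟩ := FPProof.cofin (ψ ∘ₗ S'.subtype)
    let y2 : Fin k' → S := y'
    have hy2' : ∀ s : S, ∃ c : Fin k' →₀ ℤ,
        ((s - Finsupp.linearCombination ℤ y2 c : S) : R) ∈ L := by
      intro s
      obtain ⟨c, hc⟩ := hy2 s
      exact ⟨c, (s - Finsupp.linearCombination ℤ y2 c : S).2, hc⟩
    let sub : S →ₗ[ℤ] R := S'.subtype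
    have hsub : ∀ s : S, sub s = (s : R) := fun _ => rfl
    obtain ⟨m, e, he, t, ht⟩ := FPProof.leftIdeal_fp_of_fp f hf P hP L hL
      (κ := Fin k ⊕ Fin k') (Sum.elim y (fun j => (y2 j : R))) (by
        intro r
        obtain ⟨c, hc⟩ := hy' r
        obtain ⟨d, hd⟩ := hy2' ⟨_, hc⟩
        refine ⟨Finsupp.sumElim c d, ?_⟩
        convert hd using 1
        rw [← hsub, map_sub, hsub, Finsupp.sumElim_eq_add, map_add,
          Finsupp.linearCombination_mapDomain, Finsupp.linearCombination_mapDomain,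
          Sum.elim_comp_inl, Sum.elim_comp_inr, sub_add_eq_sub_sub]
        congr 1
        rw [Finsupp.linearCombination_apply, Finsupp.linearCombination_apply, map_finsuppSum]
        rfl)
    have heS : ∀ a, e a ∈ S := fun a => ((hLmem _).1 ((he _).2 ⟨a, rfl⟩)).1
    obtain ⟨e', he'⟩ := FPProof.exists_lift (fun z : Fin m => (⟨e (FPProof.fof z), heS _⟩ : S))
    have hee : ∀ a, ((e' a : S) : R) = e a := by
      intro a
      refine FPProof.finduct (P := fun a => ((e' a : S) : R) = e a) ?_ ?_ ?_ ?_ ?_ a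
      · simp
      · intro z; rw [he']
      · intro a b ha hb; simp [ha, hb]
      · intro a ha; simp [ha]
      · intro a b ha hb; simp [ha, hb]
    refine FPProof.fp_extend e' t (fun a => ?_) y2 ?_
    · rw [← ht, ← hee]
      exact Subtype.ext_iff
    · intro s
      obtain ⟨c, hc⟩ := hy2' s
      obtain ⟨a, ha⟩ := (he _).1 hc
      refine ⟨c, a, ?_⟩
      rw [← sub_eq_iff_eq_add']
      exact Subtype.ext (by rw [hee, ha])
  · rintro ⟨n, f, hf, P, hP⟩
    obtain ⟨e, he⟩ := FPProof.exists_lift (fun z : Fin n => ((f (FPProof.fof z) : S) : R))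
    have hee : ∀ a, e a = ((f a : S) : R) := by
      intro a
      refine FPProof.finduct (P := fun a => e a = ((f a : S) : R)) ?_ ?_ ?_ ?_ ?_ a
      · simp
      · intro z; rw [he]
      · intro a b ha hb; simp [ha, hb]
      · intro a ha; simp [ha]
      · intro a b ha hb; simp [ha, hb]
    refine FPProof.fp_extend e P (fun a => ?_) y ?_
    · rw [← hP, hee]
      exact ⟨fun h => Subtype.ext h, fun h => by rw [h]; rfl⟩
    · intro r
      obtain ⟨c, hc⟩ := hy' r
      obtain ⟨a, ha⟩ := hf ⟨_, hc⟩
      refine ⟨c, a, ?_⟩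
      rw [hee, ha]
      exact (add_sub_cancel _ _).symm
end

section
/- Let R be a ring (not necessarily commutative or with identity), and let S be a subring of finite index in R (i.e. S has finite index as an additive subgroup of R). Then R is finitely presented as a ring if and only if S is finitely presented as a ring. -/
namespace FPIdx
set_option linter.unusedSectionVars false

section basics

variable {K : Type*} [CommRing K] {X : Type*}

/-- free generator -/
noncomputable def gen (K : Type*) [CommRing K] {X : Type*} (x : X) : FreeNUAlg K X :=
  MonoidAlgebra.single (FreeSemigroup.of x) 1

theorem free_top (M : Submodule K (FreeNUAlg K X)) (h1 : ∀ x, gen K x ∈ M)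
    (h2 : ∀ x, ∀ m ∈ M, gen K x * m ∈ M) (g : FreeNUAlg K X) : g ∈ M := by
  have key : ∀ w : FreeSemigroup X, (MonoidAlgebra.single w (1 : K) : FreeNUAlg K X) ∈ M := by
    intro w
    induction w using FreeSemigroup.recOnMul with
    | ih1 x => exact h1 x
    | ih2 x y _ hy =>
      have := h2 x _ hy
      simpa [gen, MonoidAlgebra.single_mul_single] using this
  induction g using MonoidAlgebra.induction_linear with
  | zero => exact M.zero_mem
  | add f g hf hg => exact M.add_mem hf hg
  | single w c =>
    have := M.smul_mem c (key w)
    simpa [MonoidAlgebra.smul_single] using this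

variable {A : Type*} [NonUnitalRing A] [Module K A] [IsScalarTower K A A] [SMulCommClass K A A]

noncomputable def liftF (f : X → A) : FreeNUAlg K X →ₙₐ[K] A :=
  MonoidAlgebra.liftMagma K (FreeSemigroup.lift f)

@[simp] theorem liftF_gen (f : X → A) (x : X) : liftF (K := K) f (gen K x) = f x := by
  simp [liftF, gen, MonoidAlgebra.liftMagma]

/-- linear map out of the free algebra, right linear, with prescribed values on generators -/
noncomputable def wordMap (h : X → FreeNUAlg K X) (w : FreeSemigroup X) : FreeNUAlg K X :=
  match w with
  | ⟨y, []⟩ => h y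
  | ⟨y, z :: l⟩ => h y * MonoidAlgebra.single ⟨z, l⟩ 1

theorem exists_rlin (h : X → FreeNUAlg K X) :
    ∃ φ : FreeNUAlg K X →ₗ[K] FreeNUAlg K X, (∀ x, φ (gen K x) = h x) ∧
      ∀ a b, φ (a * b) = φ a * b := by
  let φ : FreeNUAlg K X →ₗ[K] FreeNUAlg K X :=
    (Finsupp.linearCombination K (wordMap h)).comp
      (MonoidAlgebra.coeffLinearEquiv (S := K) (R := K) (M := FreeSemigroup X)).toLinearMap
  have h0 : ∀ w, φ (MonoidAlgebra.single w 1) = wordMap h w := by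
    intro w
    simp [φ]
  have h1 : ∀ x, φ (gen K x) = h x := fun x => h0 _
  have h2 : ∀ x b, φ (gen K x * b) = h x * b := by
    intro x b
    induction b using MonoidAlgebra.induction_linear with
    | zero => simp
    | add f g hf hg => rw [mul_add, map_add, hf, hg, mul_add]
    | single w c =>
      have e : (MonoidAlgebra.single w c : FreeNUAlg K X) = c • MonoidAlgebra.single w 1 := by
        simp [MonoidAlgebra.smul_single]
      rw [e, mul_smul_comm, mul_smul_comm, map_smul, gen, MonoidAlgebra.single_mul_single, one_mul,
        h0]
      obtain ⟨z, l⟩ := w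
      rfl
  refine ⟨φ, h1, fun a b => ?_⟩
  let M : Submodule K (FreeNUAlg K X) :=
    { carrier := {a | φ (a * b) = φ a * b}
      zero_mem' := by simp
      add_mem' := by
        intro u v hu hv
        simp only [Set.mem_ofPred_eq] at *
        rw [add_mul, map_add, hu, hv, map_add, add_mul]
      smul_mem' := by
        intro c u hu
        simp only [Set.mem_ofPred_eq] at *
        rw [smul_mul_assoc, map_smul, hu, map_smul, smul_mul_assoc] }
  refine free_top M (fun x => ?_) (fun x m _ => ?_) a
  · change φ (_ * _) = _
    rw [h2, h1]
  · change φ (_ * _) = φ _ * _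
    rw [mul_assoc, h2, h2, mul_assoc]

theorem subset_ideal (s : Set A) : s ⊆ idealSpan K s := by
  intro x hx
  simp only [idealSpan, SetLike.mem_coe, Submodule.mem_sInf, Set.mem_ofPred_eq]
  exact fun J hJ => hJ.1 hx

theorem ideal_le {s : Set A} {J : Submodule K A} (h : s ⊆ J)
    (h2 : ∀ a b : A, b ∈ J → a * b ∈ J ∧ b * a ∈ J) : idealSpan K s ≤ J :=
  sInf_le ⟨h, h2⟩

theorem ideal_mul (s : Set A) (a b : A) (hb : b ∈ idealSpan K s) :
    a * b ∈ idealSpan K s ∧ b * a ∈ idealSpan K s := by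
  simp only [idealSpan, Submodule.mem_sInf, Set.mem_ofPred_eq] at *
  exact ⟨fun J hJ => (hJ.2 a b (hb J hJ)).1, fun J hJ => (hJ.2 a b (hb J hJ)).2⟩

theorem ideal_mono {s t : Set A} (h : s ⊆ t) : idealSpan K s ≤ idealSpan K t :=
  ideal_le (h.trans (subset_ideal t)) (ideal_mul t)

theorem ideal_le_ker {A' : Type*} [NonUnitalRing A'] [Module K A']
    (f : A →ₙₐ[K] A') {s : Set A} (h : ∀ x ∈ s, f x = 0) {x : A} (hx : x ∈ idealSpan K s) :
    f x = 0 := by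
  have : idealSpan K s ≤ LinearMap.ker (f : A →ₗ[K] A') := by
    refine ideal_le (fun x hx => h x hx) (fun a b hb => ?_)
    have hb' : f b = 0 := hb
    constructor
    · change f (a * b) = 0
      rw [map_mul, hb', mul_zero]
    · change f (b * a) = 0
      rw [map_mul, hb', zero_mul]
  exact this hx

theorem ideal_map {A' : Type*} [NonUnitalRing A'] [Module K A']
    [IsScalarTower K A' A'] [SMulCommClass K A' A']
    (f : A →ₙₐ[K] A') {s : Set A} {x : A} (hx : x ∈ idealSpan K s) :
    f x ∈ idealSpan K (f '' s) := by
  have : idealSpan K s ≤ (idealSpan K (f '' s)).comap (f : A →ₗ[K] A') := by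
    refine ideal_le (fun x hx => subset_ideal _ ⟨x, hx, rfl⟩) (fun a b hb => ?_)
    have hb' : f b ∈ idealSpan K (f '' s) := hb
    constructor
    · change f (a * b) ∈ idealSpan K (f '' s)
      rw [map_mul]; exact (ideal_mul _ _ _ hb').1
    · change f (b * a) ∈ idealSpan K (f '' s)
      rw [map_mul]; exact (ideal_mul _ _ _ hb').2
  exact this hx

theorem hom_ext_gen {f g : FreeNUAlg K X →ₙₐ[K] A} (h : ∀ x, f (gen K x) = g (gen K x))
    (a : FreeNUAlg K X) : f a = g a := by
  have := free_top (LinearMap.eqLocus (f : FreeNUAlg K X →ₗ[K] A) (g : FreeNUAlg K X →ₗ[K] A))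
    (fun x => h x) (fun x m hm => ?_) a
  · exact this
  · have hm' : f m = g m := hm
    change f _ = g _
    rw [map_mul, map_mul, h, hm']

/-- Criterion for finite presentability. -/
theorem fp_of (X : Type*) [Finite X] (f : FreeNUAlg K X →ₙₐ[K] A) (hf : Function.Surjective f)
    (s : Set (FreeNUAlg K X)) (hs : s.Finite) (h1 : ∀ x ∈ s, f x = 0)
    (h2 : ∀ x, f x = 0 → x ∈ idealSpan K s) : NUAlgFP K A := by
  classical
  obtain ⟨n, ⟨e⟩⟩ := Finite.exists_equiv_fin X
  let u : FreeNUAlg K X →ₙₐ[K] FreeNUAlg K (Fin n) := liftF (fun x => gen K (e x))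
  let v : FreeNUAlg K (Fin n) →ₙₐ[K] FreeNUAlg K X := liftF (fun x => gen K (e.symm x))
  have huv : ∀ a, u (v a) = a := fun a =>
    hom_ext_gen (f := u.comp v) (g := NonUnitalAlgHom.id K _) (by intro x; simp [u, v]) a
  have hvu : ∀ a, v (u a) = a := fun a =>
    hom_ext_gen (f := v.comp u) (g := NonUnitalAlgHom.id K _) (by intro x; simp [u, v]) a
  refine ⟨n, f.comp v, ?_, (hs.image u).toFinset, fun x => ?_⟩
  · intro a
    obtain ⟨b, rfl⟩ := hf a
    exact ⟨u b, by simp [hvu]⟩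
  · rw [Set.Finite.coe_toFinset]
    constructor
    · intro hx
      have := ideal_map u (h2 (v x) hx)
      rwa [huv] at this
    · intro hx
      refine ideal_le_ker (f.comp v) ?_ hx
      rintro _ ⟨y, hy, rfl⟩
      simp [hvu, h1 y hy]

end basics

section linalg

theorem exists_complement {K : Type*} [CommRing K] [IsDomain K] [IsPrincipalIdealRing K]
    {C G : Type*} [AddCommGroup C] [Module K C] [Module.Free K C] [Module.Finite K C]
    [AddCommGroup G] [Module K G] (W : Submodule K (C × G)) :
    ∃ V : Submodule K (C × G), V.FG ∧ V ≤ W ∧ (∀ g : G, ((0, g) : C × G) ∈ V → g = 0) ∧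
      ∀ w ∈ W, ∃ k : G, w - (0, k) ∈ V := by
  let D : Submodule K C := W.map (LinearMap.fst K C G)
  let p : W →ₗ[K] D :=
    LinearMap.codRestrict D ((LinearMap.fst K C G).comp W.subtype)
      (fun w => ⟨w.1, w.2, rfl⟩)
  have hp : Function.Surjective p := by
    rintro ⟨c, w, hw, rfl⟩
    exact ⟨⟨w, hw⟩, rfl⟩
  obtain ⟨s, hs⟩ := Module.projective_lifting_property p LinearMap.id hp
  have hs' : ∀ d, p (s d) = d := fun d => LinearMap.congr_fun hs d
  have hs1 : ∀ d, ((s d : W) : C × G).1 = d := fun d => congrArg Subtype.val (hs' d)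
  refine ⟨LinearMap.range (W.subtype.comp s), ?_, ?_, ?_, ?_⟩
  · rw [LinearMap.range_eq_map]
    exact Submodule.FG.map _ (Module.Finite.fg_top)
  · rintro _ ⟨d, rfl⟩
    exact (s d).2
  · rintro g ⟨d, hd⟩
    have h1 : ((s d : W) : C × G) = (0, g) := hd
    have h2 : d = 0 := by
      apply Subtype.ext
      rw [← hs1, h1]; rfl
    rw [h2, map_zero] at h1
    exact (congrArg Prod.snd h1).symm
  · intro w hw
    let d := p ⟨w, hw⟩
    refine ⟨w.2 - ((s d : W) : C × G).2, ⟨d, ?_⟩⟩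
    change ((s d : W) : C × G) = _
    apply Prod.ext
    · rw [hs1]; simp only [Prod.fst_sub, sub_zero]; rfl
    · simp

end linalg

section fg

variable {K : Type*} [CommRing K] [IsDomain K] [IsPrincipalIdealRing K]
  {R : Type*} [NonUnitalRing R] [Module K R] [IsScalarTower K R R] [SMulCommClass K R R]
  {A : Type*} [NonUnitalRing A] [Module K A] [IsScalarTower K A A] [SMulCommClass K A A]

theorem fg_ideal (i : A →ₙₐ[K] R) (hi : Function.Injective i)
    (hl : ∀ r a, ∃ a', i a' = r * i a)
    {ι : Type*} [Finite ι] (b : ι → R)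
    (hB : ∀ r, ∃ a, r - i a ∈ Submodule.span K (Set.range b))
    {X : Type*} [Finite X] (φ : FreeNUAlg K X →ₙₐ[K] R) (hφ : Function.Surjective φ) :
    ∃ Y : Set A, Y.Finite ∧
      Function.Surjective (liftF (K := K) (fun y : Y => (y : A))) := by
  classical
  choose a ha using hB
  choose ml hml using hl
  let il : A →ₗ[K] R := (i : A →ₗ[K] R)
  let SB : Submodule K R := Submodule.span K (Set.range b)
  have hSB : SB.FG := Submodule.fg_span (Set.finite_range b)
  have hD : (SB ⊓ LinearMap.range il).FG := by
    have : IsNoetherian K SB := isNoetherian_of_fg_of_noetherian SB hSB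
    exact Submodule.FG.of_le hSB inf_le_left
  obtain ⟨S, hS⟩ := hD
  let Y0 : Set A := (Set.range fun x => a (φ (gen K x))) ∪
    (Set.range fun p : X × ι => a (φ (gen K p.1) * b p.2)) ∪ i ⁻¹' (S : Set R)
  have hY0 : Y0.Finite := ((Set.finite_range _).union (Set.finite_range _)).union
    (S.finite_toSet.preimage hi.injOn)
  let Y : Set A := Y0 ∪ Set.image2 (fun k y => ml (b k) y) Set.univ Y0
  have hY : Y.Finite := hY0.union (Set.Finite.image2 _ Set.finite_univ hY0)
  refine ⟨Y, hY, ?_⟩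
  set π := liftF (K := K) (fun y : Y => (y : A)) with hπ
  let q : FreeNUAlg K Y →ₙₐ[K] R := i.comp π
  let Q : Submodule K R := LinearMap.range (q : FreeNUAlg K Y →ₗ[K] R)
  have hqQ : ∀ g, q g ∈ Q := fun g => ⟨g, rfl⟩
  have hQm : ∀ u ∈ Q, ∀ v ∈ Q, u * v ∈ Q := by
    rintro _ ⟨u, rfl⟩ _ ⟨v, rfl⟩
    exact ⟨u * v, map_mul q u v⟩
  have hYQ : ∀ y ∈ Y, i y ∈ Q := by
    intro y hy
    refine ⟨gen K ⟨y, hy⟩, ?_⟩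
    change i (π _) = _
    rw [hπ, liftF_gen]
  have hY0Q : ∀ y ∈ Y0, i y ∈ Q := fun y hy => hYQ y (Or.inl hy)
  have T1 : ∀ y ∈ Y0, ∀ r ∈ SB, r * i y ∈ Q := by
    intro y hy r hr
    have : SB ≤ Q.comap (LinearMap.mulRight K (i y)) := by
      refine Submodule.span_le.2 ?_
      rintro _ ⟨k, rfl⟩
      change b k * i y ∈ Q
      rw [← hml]
      exact hYQ _ (Or.inr ⟨k, Set.mem_univ _, y, hy, rfl⟩)
    exact this hr
  have T2 : ∀ t, a t ∈ Y0 → ∀ y ∈ Y0, t * i y ∈ Q := by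
    intro t ht y hy
    have : t * i y = (t - i (a t)) * i y + i (a t) * i y := by noncomm_ring
    rw [this]
    exact Q.add_mem (T1 y hy _ (ha t)) (hQm _ (hY0Q _ ht) _ (hY0Q _ hy))
  have hx1 : ∀ x, a (φ (gen K x)) ∈ Y0 := fun x => Or.inl (Or.inl ⟨x, rfl⟩)
  have hx2 : ∀ x k, a (φ (gen K x) * b k) ∈ Y0 := fun x k => Or.inl (Or.inr ⟨(x, k), rfl⟩)
  have T3 : ∀ x, ∀ y ∈ Y, φ (gen K x) * i y ∈ Q := by
    rintro x y (hy | ⟨k, -, y, hy, rfl⟩)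
    · exact T2 _ (hx1 x) y hy
    · change φ (gen K x) * i (ml (b k) y) ∈ Q
      rw [hml, ← mul_assoc]
      exact T2 _ (hx2 x k) y hy
  have T4 : ∀ x g, φ (gen K x) * q g ∈ Q := by
    intro x g
    refine free_top (Q.comap ((LinearMap.mulLeft K (φ (gen K x))).comp
      (q : FreeNUAlg K Y →ₗ[K] R))) (fun y => ?_) (fun y m _ => ?_) g
    · change φ (gen K x) * i (π (gen K y)) ∈ Q
      rw [hπ, liftF_gen]
      exact T3 x y y.2
    · change φ (gen K x) * q (gen K y * m) ∈ Q
      rw [map_mul, ← mul_assoc]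
      refine hQm _ ?_ _ (hqQ m)
      change φ (gen K x) * i (π (gen K y)) ∈ Q
      rw [hπ, liftF_gen]
      exact T3 x y y.2
  have hsplit : ∀ t, a t ∈ Y0 → t ∈ Q ⊔ SB := by
    intro t ht
    have : t = i (a t) + (t - i (a t)) := by abel
    rw [this]
    exact Submodule.add_mem_sup (hY0Q _ ht) (ha t)
  have T5 : ∀ f, φ f ∈ Q ⊔ SB := by
    intro f
    refine free_top ((Q ⊔ SB).comap (φ : FreeNUAlg K X →ₗ[K] R)) (fun x => hsplit _ (hx1 x))
      (fun x m hm => ?_) f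
    have hm' : φ m ∈ Q ⊔ SB := hm
    change φ (gen K x * m) ∈ Q ⊔ SB
    rw [map_mul]
    have : Q ⊔ SB ≤ (Q ⊔ SB).comap (LinearMap.mulLeft K (φ (gen K x))) := by
      refine sup_le ?_ (Submodule.span_le.2 ?_)
      · rintro _ ⟨g, rfl⟩
        exact Submodule.mem_sup_left (T4 x g)
      · rintro _ ⟨k, rfl⟩
        exact hsplit _ (hx2 x k)
    exact this hm'
  intro z
  obtain ⟨f, hf⟩ := hφ (i z)
  obtain ⟨_, ⟨g, rfl⟩, r, hr, hgr⟩ := Submodule.mem_sup.1 (hf ▸ T5 f)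
  have hgr' : i (π g) + r = i z := hgr
  have hr2 : r ∈ SB ⊓ LinearMap.range il := by
    refine ⟨hr, z - π g, ?_⟩
    change i _ = _
    rw [map_sub, ← hgr']; abel
  have hDQ : SB ⊓ LinearMap.range il ≤ Q := by
    rw [← hS]
    refine Submodule.span_le.2 (fun s hs => ?_)
    have : s ∈ SB ⊓ LinearMap.range il := by
      rw [← hS]; exact Submodule.subset_span hs
    obtain ⟨c, hc⟩ := this.2
    have hc' : i c = s := hc
    rw [← hc']
    refine hY0Q _ (Or.inr ?_)
    change i c ∈ (S : Set R)
    rw [hc']; exact hs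
  obtain ⟨g', hg'⟩ := hDQ hr2
  have hg2 : i (π g') = r := hg'
  refine ⟨g + g', hi ?_⟩
  rw [map_add, map_add, hg2, hgr']

end fg

section operators

variable {K : Type*} [CommRing K]
  {R : Type*} [NonUnitalRing R] [Module K R] [IsScalarTower K R R] [SMulCommClass K R R]
  {X Y : Type*}

theorem exists_lam (φ : FreeNUAlg K X →ₙₐ[K] R) (q : FreeNUAlg K Y →ₙₐ[K] R)
    (hq : ∀ r g, ∃ g', q g' = r * q g) :
    ∃ lam : FreeNUAlg K X →ₙₐ[K] Module.End K (FreeNUAlg K Y),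
      (∀ f g g', lam f (g * g') = lam f g * g') ∧ ∀ f g, q (lam f g) = φ f * q g := by
  choose h hh using hq
  choose l0 hl0 hl1 using fun x : X =>
    exists_rlin (K := K) (fun y : Y => h (φ (gen K x)) (gen K y))
  let lam : FreeNUAlg K X →ₙₐ[K] Module.End K (FreeNUAlg K Y) := liftF l0
  have hlx : ∀ x, lam (gen K x) = l0 x := fun x => liftF_gen _ _
  have hx : ∀ x g, q (l0 x g) = φ (gen K x) * q g := by
    intro x g
    refine free_top (LinearMap.eqLocus ((q : FreeNUAlg K Y →ₗ[K] R).comp (l0 x))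
      ((LinearMap.mulLeft K (φ (gen K x))).comp (q : FreeNUAlg K Y →ₗ[K] R)))
      (fun y => ?_) (fun y m _ => ?_) g
    · change q (l0 x (gen K y)) = φ (gen K x) * q (gen K y)
      rw [hl0, hh]
    · change q (l0 x (gen K y * m)) = φ (gen K x) * q (gen K y * m)
      rw [hl1, map_mul, map_mul, hl0, hh, mul_assoc]
  refine ⟨lam, fun f g g' => ?_, fun f g => ?_⟩
  · let M : Submodule K (FreeNUAlg K X) :=
      { carrier := {f | ∀ g, lam f (g * g') = lam f g * g'}
        zero_mem' := by intro g; simp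
        add_mem' := by
          intro u v hu hv g
          rw [map_add, LinearMap.add_apply, LinearMap.add_apply, hu, hv, add_mul]
        smul_mem' := by
          intro c u hu g
          rw [map_smul, LinearMap.smul_apply, LinearMap.smul_apply, hu, smul_mul_assoc] }
    refine free_top M (fun x g => ?_) (fun x m hm g => ?_) f g
    · rw [hlx, hl1]
    · have hm' : ∀ g, lam m (g * g') = lam m g * g' := hm
      rw [map_mul lam, Module.End.mul_apply, Module.End.mul_apply, hm', hlx, hl1]
  · let M : Submodule K (FreeNUAlg K X) :=
      { carrier := {f | ∀ g, q (lam f g) = φ f * q g}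
        zero_mem' := by intro g; simp
        add_mem' := by
          intro u v hu hv g
          rw [map_add, LinearMap.add_apply, map_add, hu, hv, map_add, add_mul]
        smul_mem' := by
          intro c u hu g
          rw [map_smul, LinearMap.smul_apply, map_smul, hu, map_smul, smul_mul_assoc] }
    refine free_top M (fun x g => ?_) (fun x m hm g => ?_) f g
    · rw [hlx, hx]
    · have hm' : ∀ g, q (lam m g) = φ m * q g := hm
      rw [map_mul, Module.End.mul_apply, hlx, hx, hm', map_mul, mul_assoc]

theorem exists_rho (φ : FreeNUAlg K X →ₙₐ[K] R) (q : FreeNUAlg K Y →ₙₐ[K] R)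
    {ι : Type*} (b : ι → R)
    (hB : ∀ r, ∃ g, r - q g ∈ Submodule.span K (Set.range b))
    (lam : FreeNUAlg K X →ₙₐ[K] Module.End K (FreeNUAlg K Y))
    (hlam : ∀ f g, q (lam f g) = φ f * q g) :
    ∃ (Ψ : ((Option ι →₀ K) × FreeNUAlg K Y) →ₗ[K] Unitization K R)
      (ρ : FreeNUAlg K X →ₙₐ[K] Module.End K ((Option ι →₀ K) × FreeNUAlg K Y))
      (e : (Option ι →₀ K) × FreeNUAlg K Y),
      (∀ g, Ψ (0, g) = Unitization.inr (q g)) ∧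
      (∀ f n, Ψ (ρ f n) = Unitization.inr (φ f) * Ψ n) ∧
      (∀ f g, ρ f (0, g) = (0, lam f g)) ∧ Ψ e = 1 := by
  classical
  let inrL : R →ₗ[K] Unitization K R := Unitization.inrHom K K R
  have hinrL : ∀ r, inrL r = Unitization.inr r := fun r => rfl
  let ψ : (Option ι →₀ K) →ₗ[K] Unitization K R :=
    Finsupp.linearCombination K (fun o => o.elim 1 (fun k => Unitization.inr (b k)))
  have hψ1 : ψ (Finsupp.single none 1) = 1 := by simp [ψ]
  have hψ2 : ∀ k, ψ (Finsupp.single (some k) 1) = Unitization.inr (b k) := by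
    intro k; simp [ψ]
  let Ψ : ((Option ι →₀ K) × FreeNUAlg K Y) →ₗ[K] Unitization K R :=
    LinearMap.coprod ψ (inrL.comp (q : FreeNUAlg K Y →ₗ[K] R))
  have hΨ : ∀ c g, Ψ (c, g) = ψ c + Unitization.inr (q g) := fun c g => rfl
  have hΨ0 : ∀ g, Ψ (0, g) = Unitization.inr (q g) := by
    intro g; rw [hΨ, map_zero, zero_add]
  have hsurj : Function.Surjective Ψ := by
    rw [← LinearMap.range_eq_top, eq_top_iff]
    have hone : (1 : Unitization K R) ∈ LinearMap.range Ψ :=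
      ⟨(Finsupp.single none 1, 0), by rw [hΨ, hψ1, map_zero, Unitization.inr_zero, add_zero]⟩
    have hspan : Submodule.span K (Set.range b) ≤ (LinearMap.range Ψ).comap inrL := by
      refine Submodule.span_le.2 ?_
      rintro _ ⟨k, rfl⟩
      exact ⟨(Finsupp.single (some k) 1, 0), by
        rw [hΨ, hψ2, map_zero, Unitization.inr_zero, add_zero, hinrL]⟩
    have hr : ∀ r : R, (Unitization.inr r : Unitization K R) ∈ LinearMap.range Ψ := by
      intro r
      obtain ⟨g, hg⟩ := hB r
      have h1 : inrL (r - q g) ∈ LinearMap.range Ψ := hspan hg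
      have h2 : (Unitization.inr r : Unitization K R) = inrL (r - q g) + Ψ (0, g) := by
        rw [hΨ0, map_sub, hinrL, hinrL]; abel
      rw [h2]
      exact Submodule.add_mem _ h1 ⟨_, rfl⟩
    rintro z -
    induction z using Unitization.ind with
    | inl_add_inr c r =>
      refine Submodule.add_mem _ ?_ (hr r)
      have : (Unitization.inl c : Unitization K R) = c • 1 := by
        apply Unitization.ext
        · simp
        · simp
      rw [this]
      exact Submodule.smul_mem _ _ hone
  choose lc hlc using fun x : X => Module.projective_lifting_property Ψ
    ((LinearMap.mulLeft K (Unitization.inr (φ (gen K x)) : Unitization K R)).comp ψ) hsurj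
  have hlc' : ∀ x c, Ψ (lc x c) = Unitization.inr (φ (gen K x)) * ψ c :=
    fun x c => LinearMap.congr_fun (hlc x) c
  let ρ0 : X → Module.End K ((Option ι →₀ K) × FreeNUAlg K Y) := fun x =>
    LinearMap.coprod (lc x) ((LinearMap.inr K _ _).comp (lam (gen K x)))
  have hρ0 : ∀ x c g, ρ0 x (c, g) = lc x c + (0, lam (gen K x) g) := fun x c g => rfl
  let ρ : FreeNUAlg K X →ₙₐ[K] Module.End K ((Option ι →₀ K) × FreeNUAlg K Y) := liftF ρ0
  have hρx : ∀ x, ρ (gen K x) = ρ0 x := fun x => liftF_gen _ _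
  have hx1 : ∀ x n, Ψ (ρ0 x n) = Unitization.inr (φ (gen K x)) * Ψ n := by
    rintro x ⟨c, g⟩
    rw [hρ0, map_add, hlc', hΨ0, hlam, hΨ, mul_add, Unitization.inr_mul]
  have hx2 : ∀ x g, ρ0 x (0, g) = (0, lam (gen K x) g) := by
    intro x g
    rw [hρ0, map_zero, zero_add]
  refine ⟨Ψ, ρ, (Finsupp.single none 1, 0), hΨ0, fun f n => ?_, fun f g => ?_, ?_⟩
  · let M : Submodule K (FreeNUAlg K X) :=
      { carrier := {f | ∀ n, Ψ (ρ f n) = Unitization.inr (φ f) * Ψ n}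
        zero_mem' := by intro g; simp
        add_mem' := by
          intro u v hu hv g
          rw [map_add, LinearMap.add_apply, map_add, hu, hv, map_add, Unitization.inr_add, add_mul]
        smul_mem' := by
          intro c u hu g
          rw [map_smul, LinearMap.smul_apply, map_smul, hu, map_smul, Unitization.inr_smul,
            smul_mul_assoc] }
    refine free_top M (fun x n => ?_) (fun x m hm n => ?_) f n
    · rw [hρx, hx1]
    · have hm' : ∀ n, Ψ (ρ m n) = Unitization.inr (φ m) * Ψ n := hm
      rw [map_mul, Module.End.mul_apply, hρx, hx1, hm', map_mul, Unitization.inr_mul, mul_assoc]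
  · let M : Submodule K (FreeNUAlg K X) :=
      { carrier := {f | ∀ g, ρ f (0, g) = (0, lam f g)}
        zero_mem' := by intro g; rw [map_zero, map_zero]; rfl
        add_mem' := by
          intro u v hu hv g
          rw [map_add, LinearMap.add_apply, hu, hv, map_add, LinearMap.add_apply]
          simp
        smul_mem' := by
          intro c u hu g
          rw [map_smul, LinearMap.smul_apply, hu, map_smul, LinearMap.smul_apply]
          simp }
    refine free_top M (fun x n => ?_) (fun x m hm n => ?_) f g
    · rw [hρx, hx2]
    · have hm' : ∀ n, ρ m (0, n) = (0, lam m n) := hm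
      rw [map_mul, Module.End.mul_apply, hρx, hm', hx2, map_mul, Module.End.mul_apply]
  · rw [hΨ, hψ1, map_zero, Unitization.inr_zero, add_zero]

end operators

section main

variable {K : Type*} [CommRing K] [IsDomain K] [IsPrincipalIdealRing K]
  {R : Type*} [NonUnitalRing R] [Module K R] [IsScalarTower K R R] [SMulCommClass K R R]

theorem ker_fg {X Y ι : Type*} [Finite X] [Finite Y] [Finite ι]
    (φ : FreeNUAlg K X →ₙₐ[K] R) (hφ : Function.Surjective φ)
    (rels : Finset (FreeNUAlg K X)) (hrels : ∀ x, φ x = 0 ↔ x ∈ idealSpan K (rels : Set _))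
    (q : FreeNUAlg K Y →ₙₐ[K] R)
    (hq : ∀ r g, ∃ g', q g' = r * q g)
    (b : ι → R) (hB : ∀ r, ∃ g, r - q g ∈ Submodule.span K (Set.range b)) :
    ∃ s : Set (FreeNUAlg K Y), s.Finite ∧ (∀ g ∈ s, q g = 0) ∧
      ∀ g, q g = 0 → g ∈ idealSpan K s := by
  classical
  obtain ⟨lam, lam_mul, hlam⟩ := exists_lam φ q hq
  obtain ⟨Ψ, ρ, e, hΨ0, hΨρ, hρ0, hΨe⟩ := exists_rho φ q b hB lam hlam
  obtain ⟨V, hVfg, hVW, hV0, hVk⟩ := exists_complement (LinearMap.ker Ψ)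
  have hVk' : ∀ w, ∃ k, Ψ w = 0 → q k = 0 ∧ w - (0, k) ∈ V := by
    intro w
    by_cases hw : Ψ w = 0
    · obtain ⟨k, hk⟩ := hVk w hw
      refine ⟨k, fun _ => ⟨?_, hk⟩⟩
      have h1 : Ψ (w - (0, k)) = 0 := hVW hk
      rw [map_sub, hw, hΨ0, zero_sub, neg_eq_zero] at h1
      exact Unitization.inr_injective (R := K) (by rw [h1, Unitization.inr_zero])
    · exact ⟨0, fun h => absurd h hw⟩
  choose θ hθ using hVk'
  choose σ hσ using hφ
  -- coset decomposition in the free algebra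
  let bf : ι → FreeNUAlg K X := fun k => σ (b k)
  have hdec : ∀ t : FreeNUAlg K X, ∃ u ∈ Submodule.span K (Set.range bf), ∃ j : FreeNUAlg K Y,
      φ t = φ u + q j := by
    intro t
    obtain ⟨g, hg⟩ := hB (φ t)
    have : Submodule.span K (Set.range b) ≤
        (Submodule.span K (Set.range bf)).map (φ : FreeNUAlg K X →ₗ[K] R) := by
      refine Submodule.span_le.2 ?_
      rintro _ ⟨k, rfl⟩
      exact ⟨bf k, Submodule.subset_span ⟨k, rfl⟩, hσ (b k)⟩
    obtain ⟨u, hu, hu2⟩ := this hg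
    have hu3 : φ u = φ t - q g := hu2
    exact ⟨u, hu, g, by rw [hu3]; abel⟩
  choose u hu j hj using hdec
  obtain ⟨VS, hVS⟩ := hVfg
  let fy : Y → FreeNUAlg K X := fun y => σ (q (gen K y))
  let N := (Option ι →₀ K) × FreeNUAlg K Y
  let T : Set (FreeNUAlg K X) := (Set.range fun x : X => gen K x) ∪
    (Set.range fun p : X × ι => gen K p.1 * bf p.2)
  have hT : T.Finite := (Set.finite_range _).union (Set.finite_range _)
  let Wf : Set N :=
    (Set.image2 (fun (x : X) (v : N) => ρ (gen K x) v) Set.univ (VS : Set N)) ∪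
    (Set.range fun y => ρ (fy y) e - ((0, gen K y) : N)) ∪
    (Set.image2 (fun r (k : Option ι) => ρ r ((Finsupp.single k 1, 0) : N))
      (rels : Set (FreeNUAlg K X)) Set.univ)
  have hWf : Wf.Finite :=
    ((Set.Finite.image2 _ Set.finite_univ VS.finite_toSet).union (Set.finite_range _)).union
      (Set.Finite.image2 _ rels.finite_toSet Set.finite_univ)
  have hrel0 : ∀ r ∈ rels, φ r = 0 := fun r hr => (hrels r).2 (subset_ideal _ hr)
  have hWf0 : ∀ w ∈ Wf, Ψ w = 0 := by
    rintro w ((⟨x, -, v, hv, rfl⟩ | ⟨y, rfl⟩) | ⟨r, hr, k, -, rfl⟩)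
    · have : v ∈ V := by rw [← hVS]; exact Submodule.subset_span hv
      have hv0 : Ψ v = 0 := hVW this
      change Ψ (ρ _ _) = 0
      rw [hΨρ, hv0, mul_zero]
    · change Ψ (_ - _) = 0
      rw [map_sub, hΨρ, hΨ0, hΨe, mul_one, hσ, sub_self]
    · change Ψ (ρ _ _) = 0
      rw [hΨρ, hrel0 r hr, Unitization.inr_zero, zero_mul]
  let Kf : Set (FreeNUAlg K Y) :=
    (Set.range fun p : Y × Y => lam (fy p.1) (gen K p.2) - gen K p.1 * gen K p.2) ∪
    (Set.image2 (fun r y => lam r (gen K y)) (rels : Set (FreeNUAlg K X)) Set.univ) ∪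
    (Set.image2 (fun t y => lam t (gen K y) - lam (u t) (gen K y) - j t * gen K y) T Set.univ)
  have hKf : Kf.Finite :=
    ((Set.finite_range _).union (Set.Finite.image2 _ rels.finite_toSet Set.finite_univ)).union
      (Set.Finite.image2 _ hT Set.finite_univ)
  have hKf0 : ∀ g ∈ Kf, q g = 0 := by
    rintro g ((⟨p, rfl⟩ | ⟨r, hr, y, -, rfl⟩) | ⟨t, -, y, -, rfl⟩)
    · change q (_ - _) = 0
      rw [map_sub, hlam, hσ, map_mul, sub_self]
    · change q (lam _ _) = 0
      rw [hlam, hrel0 r hr, zero_mul]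
    · change q (_ - _ - _) = 0
      rw [map_sub, map_sub, hlam, hlam, map_mul, hj t, add_mul]
      abel
  let Rel0 : Set (FreeNUAlg K Y) := Kf ∪ θ '' Wf
  have hRel0f : Rel0.Finite := hKf.union (hWf.image θ)
  have hRel00 : ∀ g ∈ Rel0, q g = 0 := by
    rintro g (hg | ⟨w, hw, rfl⟩)
    · exact hKf0 g hg
    · exact (hθ w (hWf0 w hw)).1
  let Rel : Set (FreeNUAlg K Y) :=
    Rel0 ∪ Set.image2 (fun k r => lam (bf k) r) Set.univ Rel0
  refine ⟨Rel, hRel0f.union (Set.Finite.image2 _ Set.finite_univ hRel0f), ?_, ?_⟩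
  · rintro g (hg | ⟨k, -, r, hr, rfl⟩)
    · exact hRel00 g hg
    · change q (lam _ _) = 0
      rw [hlam, hRel00 r hr, mul_zero]
  set K0 := idealSpan K Rel with hK0
  have mem0 : ∀ r ∈ Rel0, r ∈ K0 := fun r hr => subset_ideal _ (Or.inl hr)
  have memKf : ∀ r ∈ Kf, r ∈ K0 := fun r hr => mem0 r (Or.inl hr)
  have mulr : ∀ k ∈ K0, ∀ g, k * g ∈ K0 := fun k hk g => (ideal_mul _ g k hk).2
  have mull : ∀ k ∈ K0, ∀ g, g * k ∈ K0 := fun k hk g => (ideal_mul _ g k hk).1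
  have S1 : ∀ δ : FreeNUAlg K Y →ₗ[K] FreeNUAlg K Y, (∀ g g', δ (g * g') = δ g * g') →
      (∀ y, δ (gen K y) ∈ K0) → ∀ g, δ g ∈ K0 := by
    intro δ h1 h2 g
    refine free_top (K0.comap δ) h2 (fun y m _ => ?_) g
    change δ (gen K y * m) ∈ K0
    rw [h1]
    exact mulr _ (h2 y) m
  have S2a : ∀ r ∈ Rel0, ∀ v ∈ Submodule.span K (Set.range bf), lam v r ∈ K0 := by
    intro r hr v hv
    have : Submodule.span K (Set.range bf) ≤ K0.comap
        ((LinearMap.applyₗ r).comp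
          (lam : FreeNUAlg K X →ₗ[K] Module.End K (FreeNUAlg K Y))) := by
      refine Submodule.span_le.2 ?_
      rintro _ ⟨k, rfl⟩
      exact subset_ideal _ (Or.inr ⟨k, Set.mem_univ _, r, hr, rfl⟩)
    exact this hv
  have S2b : ∀ t ∈ T, ∀ r ∈ Rel0, lam t r ∈ K0 := by
    intro t ht r hr
    have h1 : (lam t - lam (u t) - LinearMap.mulLeft K (j t)) r ∈ K0 := by
      refine S1 _ (fun g g' => ?_) (fun y => ?_) r
      · simp only [LinearMap.sub_apply, LinearMap.mulLeft_apply]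
        rw [lam_mul, lam_mul]
        noncomm_ring
      · exact memKf _ (Or.inr ⟨t, ht, y, Set.mem_univ _, rfl⟩)
    have h2 : lam t r = (lam t - lam (u t) - LinearMap.mulLeft K (j t)) r
        + lam (u t) r + j t * r := by
      simp only [LinearMap.sub_apply, LinearMap.mulLeft_apply]
      abel
    rw [h2]
    exact K0.add_mem (K0.add_mem h1 (S2a r hr _ (hu t))) (mull _ (mem0 r hr) _)
  have S2 : ∀ x, ∀ k ∈ K0, lam (gen K x) k ∈ K0 := by
    intro x k hk
    have : K0 ≤ K0 ⊓ K0.comap (lam (gen K x)) := by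
      refine ideal_le ?_ ?_
      · intro r hr
        refine ⟨subset_ideal _ hr, ?_⟩
        change lam (gen K x) r ∈ K0
        rcases hr with hr | ⟨k, -, r, hr, rfl⟩
        · exact S2b _ (Or.inl ⟨x, rfl⟩) r hr
        · change lam (gen K x) (lam (bf k) r) ∈ K0
          rw [← Module.End.mul_apply, ← map_mul lam]
          exact S2b _ (Or.inr ⟨(x, k), rfl⟩) r hr
      · rintro g k ⟨hk1, hk2⟩
        have hk2' : lam (gen K x) k ∈ K0 := hk2
        refine ⟨⟨mull _ hk1 _, ?_⟩, ⟨mulr _ hk1 _, ?_⟩⟩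
        · change lam (gen K x) (g * k) ∈ K0
          rw [lam_mul]; exact mull _ hk1 _
        · change lam (gen K x) (k * g) ∈ K0
          rw [lam_mul]; exact mulr _ hk2' _
    exact (this hk).2
  let W0 : Submodule K N := V ⊔ K0.map (LinearMap.inr K _ _)
  have hW0k : ∀ k ∈ K0, ((0, k) : N) ∈ W0 := fun k hk => Submodule.mem_sup_right ⟨k, hk, rfl⟩
  have hWfW0 : ∀ w ∈ Wf, w ∈ W0 := by
    intro w hw
    have h1 := (hθ w (hWf0 w hw)).2
    have h2 : w = (w - (0, θ w)) + (0, θ w) := by abel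
    rw [h2]
    exact W0.add_mem (Submodule.mem_sup_left h1) (hW0k _ (mem0 _ (Or.inr ⟨w, hw, rfl⟩)))
  have S3 : ∀ x, ∀ w ∈ W0, ρ (gen K x) w ∈ W0 := by
    intro x w hw
    have : W0 ≤ W0.comap (ρ (gen K x)) := by
      refine sup_le ?_ ?_
      · rw [← hVS]
        refine Submodule.span_le.2 (fun v hv => ?_)
        exact hWfW0 _ (Or.inl (Or.inl ⟨x, Set.mem_univ _, v, hv, rfl⟩))
      · rintro _ ⟨k, hk, rfl⟩
        change ρ (gen K x) (0, k) ∈ W0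
        rw [hρ0]
        exact hW0k _ (S2 x k hk)
    exact this hw
  have S3' : ∀ f, ∀ w ∈ W0, ρ f w ∈ W0 := by
    intro f
    let M : Submodule K (FreeNUAlg K X) :=
      { carrier := {f | ∀ w ∈ W0, ρ f w ∈ W0}
        zero_mem' := by
          intro w _
          rw [map_zero]; exact W0.zero_mem
        add_mem' := by
          intro f g hf hg w hw
          rw [map_add, LinearMap.add_apply]
          exact W0.add_mem (hf w hw) (hg w hw)
        smul_mem' := by
          intro c f hf w hw
          rw [map_smul, LinearMap.smul_apply]
          exact W0.smul_mem _ (hf w hw) }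
    refine free_top M S3 (fun x m hm w hw => ?_) f
    rw [map_mul, Module.End.mul_apply]
    exact S3 x _ (hm w hw)
  let ζ : FreeNUAlg K Y →ₙₐ[K] FreeNUAlg K X := liftF fy
  have hζ : ∀ y, ζ (gen K y) = fy y := fun y => liftF_gen _ _
  have hφζ : ∀ g, φ (ζ g) = q g := fun g =>
    hom_ext_gen (f := φ.comp ζ) (g := q) (fun y => by
      rw [NonUnitalAlgHom.comp_apply, hζ, hσ]) g
  have S4 : ∀ g, ρ (ζ g) e - ((0, g) : N) ∈ W0 := by
    intro g
    refine free_top (W0.comap (((LinearMap.applyₗ e).comp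
      ((ρ : FreeNUAlg K X →ₗ[K] Module.End K N).comp
        (ζ : FreeNUAlg K Y →ₗ[K] FreeNUAlg K X))) - LinearMap.inr K _ _))
      (fun y => ?_) (fun y m hm => ?_) g
    · change ρ (ζ (gen K y)) e - ((0, gen K y) : N) ∈ W0
      rw [hζ]
      exact hWfW0 _ (Or.inl (Or.inr ⟨y, rfl⟩))
    · have hm' : ρ (ζ m) e - ((0, m) : N) ∈ W0 := hm
      change ρ (ζ (gen K y * m)) e - ((0, gen K y * m) : N) ∈ W0
      have h1 : (lam (fy y) - LinearMap.mulLeft K (gen K y)) m ∈ K0 := by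
        refine S1 _ (fun g g' => ?_) (fun y' => ?_) m
        · simp only [LinearMap.sub_apply, LinearMap.mulLeft_apply]
          rw [lam_mul]
          noncomm_ring
        · exact memKf _ (Or.inl (Or.inl ⟨(y, y'), rfl⟩))
      have h2 : ρ (ζ (gen K y * m)) e - ((0, gen K y * m) : N) =
          ρ (fy y) (ρ (ζ m) e - ((0, m) : N)) +
            (0, (lam (fy y) - LinearMap.mulLeft K (gen K y)) m) := by
        rw [map_mul, map_mul, Module.End.mul_apply, hζ, map_sub, hρ0]
        simp only [LinearMap.sub_apply, LinearMap.mulLeft_apply]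
        apply Prod.ext
        · simp
        · simp
      rw [h2]
      exact W0.add_mem (S3' _ _ hm') (hW0k _ h1)
  have S5 : ∀ f ∈ idealSpan K (rels : Set (FreeNUAlg K X)), ∀ n : N, ρ f n ∈ W0 := by
    let M : Submodule K (FreeNUAlg K X) :=
      { carrier := {f | ∀ w : N, ρ f w ∈ W0}
        zero_mem' := by
          intro w
          rw [map_zero]; exact W0.zero_mem
        add_mem' := by
          intro f g hf hg w
          rw [map_add, LinearMap.add_apply]
          exact W0.add_mem (hf w) (hg w)
        smul_mem' := by
          intro c f hf w
          rw [map_smul, LinearMap.smul_apply]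
          exact W0.smul_mem _ (hf w) }
    have : idealSpan K (rels : Set (FreeNUAlg K X)) ≤ M := by
      refine ideal_le ?_ ?_
      · rintro r hr ⟨c, g⟩
        have h1 : ((c, g) : N) = (c, 0) + (0, g) := by simp
        rw [h1, map_add]
        refine W0.add_mem ?_ ?_
        · induction c using Finsupp.induction_linear with
          | zero =>
            have : (((0 : Option ι →₀ K), (0 : FreeNUAlg K Y)) : N) = 0 := rfl
            rw [this, map_zero]; exact W0.zero_mem
          | add c d hc hd =>
            have : ((c + d, (0 : FreeNUAlg K Y)) : N) = (c, 0) + (d, 0) := by simp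
            rw [this, map_add]
            exact W0.add_mem (hc (by simp)) (hd (by simp))
          | single k c =>
            have : ((Finsupp.single k c, (0 : FreeNUAlg K Y)) : N) =
              c • ((Finsupp.single k 1, 0) : N) := by simp
            rw [this, map_smul]
            exact W0.smul_mem _ (hWfW0 _ (Or.inr ⟨r, hr, k, Set.mem_univ _, rfl⟩))
        · rw [hρ0]
          refine hW0k _ (S1 _ (lam_mul r) (fun y => ?_) g)
          exact memKf _ (Or.inl (Or.inr ⟨r, hr, y, Set.mem_univ _, rfl⟩))
      · intro a f hf
        constructor
        · intro w
          rw [map_mul, Module.End.mul_apply]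
          exact S3' _ _ (hf w)
        · intro w
          rw [map_mul, Module.End.mul_apply]
          exact hf _
    exact fun f hf n => this hf n
  intro g hg
  have h1 : ρ (ζ g) e ∈ W0 := S5 _ ((hrels _).1 (by rw [hφζ, hg])) e
  have h2 : ((0, g) : N) ∈ W0 := by
    have := W0.sub_mem h1 (S4 g)
    rwa [sub_sub_cancel] at this
  obtain ⟨v, hv, _, ⟨k, hk, rfl⟩, hvk⟩ := Submodule.mem_sup.1 h2
  have hvk' : v + ((0, k) : N) = (0, g) := hvk
  have hv2 : v = ((0, g - k) : N) := by
    rw [eq_sub_of_add_eq hvk']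
    apply Prod.ext
    · simp
    · simp
  rw [hv2] at hv
  have := hV0 _ hv
  rw [sub_eq_zero.1 this]
  exact hk

theorem fp_ideal
    {A : Type*} [NonUnitalRing A] [Module K A] [IsScalarTower K A A] [SMulCommClass K A A]
    (i : A →ₙₐ[K] R) (hi : Function.Injective i)
    (hl : ∀ r a, ∃ a', i a' = r * i a)
    {ι : Type*} [Finite ι] (b : ι → R)
    (hB : ∀ r, ∃ a, r - i a ∈ Submodule.span K (Set.range b))
    (hR : NUAlgFP K R) : NUAlgFP K A := by
  obtain ⟨n, φ, hφ, rels, hrels⟩ := hR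
  obtain ⟨Y, hY, hπ⟩ := fg_ideal i hi hl b hB φ hφ
  have : Finite Y := hY
  set π := liftF (K := K) (fun y : Y => (y : A))
  obtain ⟨s, hs, hs0, hs1⟩ := ker_fg φ hφ rels hrels (i.comp π)
    (fun r g => by
      obtain ⟨a', ha'⟩ := hl r (π g)
      obtain ⟨g', rfl⟩ := hπ a'
      exact ⟨g', ha'⟩) b
    (fun r => by
      obtain ⟨a', ha'⟩ := hB r
      obtain ⟨g', rfl⟩ := hπ a'
      exact ⟨g', ha'⟩)
  refine fp_of Y π hπ s hs (fun g hg => hi ?_) (fun g hg => hs1 g ?_)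
  · rw [map_zero]; exact hs0 g hg
  · rw [NonUnitalAlgHom.comp_apply, hg, map_zero]

end main

section ext

variable {K : Type*} [CommRing K] [IsDomain K] [IsPrincipalIdealRing K]
  {R : Type*} [NonUnitalRing R] [Module K R] [IsScalarTower K R R] [SMulCommClass K R R]
  {A : Type*} [NonUnitalRing A] [Module K A] [IsScalarTower K A A] [SMulCommClass K A A]

theorem fp_ext (i : A →ₙₐ[K] R) (hi : Function.Injective i)
    (hl : ∀ r a, ∃ a', i a' = r * i a) (hr : ∀ r a, ∃ a', i a' = i a * r)
    {ι : Type*} [Finite ι] (b : ι → R)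
    (hB : ∀ r, ∃ a, r - i a ∈ Submodule.span K (Set.range b))
    (hA : NUAlgFP K A) : NUAlgFP K R := by
  classical
  obtain ⟨n, π, hπ, s, hs⟩ := hA
  choose a ha using hB
  choose ml hml using hl
  choose mr hmr using hr
  choose g hg using hπ
  let F := FreeNUAlg K (Fin n ⊕ ι)
  let φ : F →ₙₐ[K] R := liftF (Sum.elim (fun k => i (π (gen K k))) b)
  let y : Fin n → F := fun k => gen K (Sum.inl k)
  let z : ι → F := fun k => gen K (Sum.inr k)
  have hφy : ∀ k, φ (y k) = i (π (gen K k)) := fun k => liftF_gen _ _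
  have hφz : ∀ k, φ (z k) = b k := fun k => liftF_gen _ _
  let κ : FreeNUAlg K (Fin n) →ₙₐ[K] F := liftF y
  have hκ : ∀ k, κ (gen K k) = y k := fun k => liftF_gen _ _
  have hφκ : ∀ x, φ (κ x) = i (π x) := fun x =>
    hom_ext_gen (f := φ.comp κ) (g := i.comp π) (fun k => by
      rw [NonUnitalAlgHom.comp_apply, NonUnitalAlgHom.comp_apply, hκ, hφy]) x
  let SB : Submodule K F := Submodule.span K (Set.range z)
  have hSB : SB.FG := Submodule.fg_span (Set.finite_range z)
  have hu : ∀ r, ∃ u ∈ SB, φ u = r - i (a r) := by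
    intro r
    have : Submodule.span K (Set.range b) ≤ SB.map (φ : F →ₗ[K] R) := by
      refine Submodule.span_le.2 ?_
      rintro _ ⟨k, rfl⟩
      exact ⟨z k, Submodule.subset_span ⟨k, rfl⟩, hφz k⟩
    exact this (ha r)
  choose u hu hφu using hu
  let D : Submodule K F :=
    SB ⊓ (LinearMap.range (i : A →ₗ[K] R)).comap (φ : F →ₗ[K] R)
  have hD : D.FG := by
    have : IsNoetherian K SB := isNoetherian_of_fg_of_noetherian SB hSB
    exact Submodule.FG.of_le hSB inf_le_left
  obtain ⟨S, hS⟩ := hD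
  have hd : ∀ f, ∃ c, f ∈ D → i c = φ f := by
    intro f
    by_cases h : f ∈ D
    · obtain ⟨c, hc⟩ := h.2
      exact ⟨c, fun _ => hc⟩
    · exact ⟨0, fun h' => absurd h' h⟩
  choose d hd using hd
  have hSD : ∀ f ∈ S, f ∈ D := by
    intro f hf
    rw [← hS]; exact Submodule.subset_span hf
  let Rel : Set F := κ '' (s : Set (FreeNUAlg K (Fin n))) ∪
    (Set.range fun p : Fin n × ι => y p.1 * z p.2 - κ (g (mr (b p.2) (π (gen K p.1))))) ∪
    (Set.range fun p : Fin n × ι => z p.2 * y p.1 - κ (g (ml (b p.2) (π (gen K p.1))))) ∪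
    (Set.range fun p : ι × ι =>
      z p.1 * z p.2 - u (b p.1 * b p.2) - κ (g (a (b p.1 * b p.2)))) ∪
    ((fun f => f - κ (g (d f))) '' (S : Set F))
  have hRel : Rel.Finite :=
    ((((s.finite_toSet.image κ).union (Set.finite_range _)).union (Set.finite_range _)).union
      (Set.finite_range _)).union (S.finite_toSet.image _)
  have hRel0 : ∀ f ∈ Rel, φ f = 0 := by
    rintro f ((((⟨x, hx, rfl⟩ | ⟨p, rfl⟩) | ⟨p, rfl⟩) | ⟨p, rfl⟩) | ⟨f, hf, rfl⟩)
    · rw [hφκ, (hs x).2 (subset_ideal _ hx), map_zero]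
    · change φ (_ - _) = 0
      rw [map_sub, map_mul, hφκ, hg, hmr, hφy, hφz, sub_self]
    · change φ (_ - _) = 0
      rw [map_sub, map_mul, hφκ, hg, hml, hφy, hφz, sub_self]
    · change φ (_ - _ - _) = 0
      rw [map_sub, map_sub, map_mul, hφκ, hg, hφz, hφz, hφu]
      abel
    · change φ (_ - _) = 0
      rw [map_sub, hφκ, hg, hd f (hSD f hf), sub_self]
  let K0 : Submodule K F := idealSpan K Rel
  have mulr : ∀ k ∈ K0, ∀ g, k * g ∈ K0 := fun k hk g => (ideal_mul _ g k hk).2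
  have mull : ∀ k ∈ K0, ∀ g, g * k ∈ K0 := fun k hk g => (ideal_mul _ g k hk).1
  let Q : Submodule K F := LinearMap.range (κ : FreeNUAlg K (Fin n) →ₗ[K] F)
  have hκQ : ∀ x, κ x ∈ Q := fun x => ⟨x, rfl⟩
  have hQm : ∀ u ∈ Q, ∀ v ∈ Q, u * v ∈ Q := by
    rintro _ ⟨u, rfl⟩ _ ⟨v, rfl⟩
    exact ⟨u * v, map_mul κ u v⟩
  have hyz : ∀ k j, y k * z j ∈ Q ⊔ K0 := by
    intro k j
    have h1 : y k * z j - κ (g (mr (b j) (π (gen K k)))) ∈ K0 :=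
      subset_ideal _ (Or.inl (Or.inl (Or.inl (Or.inr ⟨(k, j), rfl⟩))))
    have := Submodule.add_mem_sup (hκQ (g (mr (b j) (π (gen K k))))) h1
    rwa [add_sub_cancel] at this
  have hzy : ∀ k j, z j * y k ∈ Q ⊔ K0 := by
    intro k j
    have h1 : z j * y k - κ (g (ml (b j) (π (gen K k)))) ∈ K0 :=
      subset_ideal _ (Or.inl (Or.inl (Or.inr ⟨(k, j), rfl⟩)))
    have := Submodule.add_mem_sup (hκQ (g (ml (b j) (π (gen K k))))) h1
    rwa [add_sub_cancel] at this
  have hle : Q ⊔ K0 ≤ Q ⊔ K0 ⊔ SB := le_sup_left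
  have hSBle : SB ≤ Q ⊔ K0 ⊔ SB := le_sup_right
  have hzz : ∀ k j, z k * z j ∈ Q ⊔ K0 ⊔ SB := by
    intro k j
    have h1 : z k * z j - u (b k * b j) - κ (g (a (b k * b j))) ∈ K0 :=
      subset_ideal _ (Or.inl (Or.inr ⟨(k, j), rfl⟩))
    have h2 := Submodule.add_mem_sup (Submodule.add_mem_sup (hκQ (g (a (b k * b j)))) h1)
      (hu (b k * b j))
    have h3 : κ (g (a (b k * b j))) + (z k * z j - u (b k * b j) - κ (g (a (b k * b j)))) +
      u (b k * b j) = z k * z j := by abel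
    rwa [h3] at h2
  have hzκ : ∀ j x, z j * κ x ∈ Q ⊔ K0 := by
    intro j x
    refine free_top ((Q ⊔ K0).comap ((LinearMap.mulLeft K (z j)).comp
      (κ : FreeNUAlg K (Fin n) →ₗ[K] F))) (fun k => ?_) (fun k m _ => ?_) x
    · change z j * κ (gen K k) ∈ Q ⊔ K0
      rw [hκ]; exact hzy k j
    · change z j * κ (gen K k * m) ∈ Q ⊔ K0
      rw [map_mul, ← mul_assoc, hκ]
      obtain ⟨c, hc, k', hk', hck⟩ := Submodule.mem_sup.1 (hzy k j)
      rw [← hck, add_mul]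
      exact Submodule.add_mem_sup (hQm _ hc _ (hκQ m)) (mulr _ hk' _)
  have htop : ∀ f, f ∈ Q ⊔ K0 ⊔ SB := by
    refine free_top _ ?_ ?_
    · rintro (k | j)
      · refine hle (Submodule.mem_sup_left ?_)
        have := hκQ (gen K k)
        rwa [hκ] at this
      · exact hSBle (Submodule.subset_span ⟨j, rfl⟩)
    · intro x m hm
      have : Q ⊔ K0 ⊔ SB ≤ (Q ⊔ K0 ⊔ SB).comap (LinearMap.mulLeft K (gen K x)) := by
        refine sup_le (sup_le ?_ ?_) (Submodule.span_le.2 ?_)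
        · rintro _ ⟨w, rfl⟩
          change gen K x * κ w ∈ _ ⊔ SB
          refine hle ?_
          rcases x with k | j
          · refine Submodule.mem_sup_left (hQm _ ?_ _ (hκQ w))
            have := hκQ (gen K k)
            rwa [hκ] at this
          · exact hzκ j w
        · intro k hk
          exact hle (Submodule.mem_sup_right (mull k hk _))
        · rintro _ ⟨j, rfl⟩
          rcases x with k | j'
          · exact hle (hyz k j)
          · exact hzz j' j
      exact this hm
  have hDQ : D ≤ Q ⊔ K0 := by
    rw [← hS]
    refine Submodule.span_le.2 (fun f hf => ?_)
    have h1 : f - κ (g (d f)) ∈ K0 := subset_ideal _ (Or.inr ⟨f, hf, rfl⟩)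
    have := Submodule.add_mem_sup (hκQ (g (d f))) h1
    rwa [add_sub_cancel] at this
  refine fp_of (Fin n ⊕ ι) φ ?_ Rel hRel hRel0 ?_
  · intro r
    refine ⟨u r + κ (g (a r)), ?_⟩
    rw [map_add, hφu, hφκ, hg]; abel
  · intro f hf
    have hker : ∀ k ∈ K0, φ k = 0 := fun k hk => ideal_le_ker φ hRel0 hk
    obtain ⟨w, hw, v, hv, hwv⟩ := Submodule.mem_sup.1 (htop f)
    obtain ⟨_, ⟨x, rfl⟩, k, hk, hxk⟩ := Submodule.mem_sup.1 hw
    have hxk' : κ x + k = w := hxk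
    have hvD : v ∈ D := by
      refine ⟨hv, - π x, ?_⟩
      change i (- π x) = φ v
      have h1 : φ f = i (π x) + φ v := by
        rw [← hwv, ← hxk', map_add, map_add, hφκ, hker k hk, add_zero]
      rw [hf] at h1
      rw [map_neg]
      exact neg_eq_of_add_eq_zero_right h1.symm
    have hfm : f ∈ Q ⊔ K0 := by
      rw [← hwv]
      exact Submodule.add_mem _ hw (hDQ hvD)
    obtain ⟨_, ⟨x', rfl⟩, k', hk', hxk2⟩ := Submodule.mem_sup.1 hfm
    have hxk3 : κ x' + k' = f := hxk2
    have h0 : π x' = 0 := by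
      apply hi
      rw [map_zero, ← hφκ, ← hf, ← hxk3, map_add, hker k' hk', add_zero]
    have h1 : κ x' ∈ K0 := by
      refine ideal_mono ?_ (ideal_map κ ((hs x').1 h0))
      exact fun w hw => Or.inl (Or.inl (Or.inl (Or.inl hw)))
    rw [← hxk3]
    exact K0.add_mem h1 hk'

end ext

section assembly

theorem fp_iff_of_ideal {R A : Type*} [NonUnitalRing R] [NonUnitalRing A]
    (i : A →ₙ+* R) (hi : Function.Injective i)
    (hl : ∀ r a, ∃ a', i a' = r * i a) (hr : ∀ r a, ∃ a', i a' = i a * r)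
    (H : AddSubgroup R) (hH : ∀ x ∈ H, ∃ a, i a = x) (hf : H.FiniteIndex) :
    NUAlgFP ℤ R ↔ NUAlgFP ℤ A := by
  have hfin : Finite (R ⧸ H) := AddSubgroup.finite_quotient_of_finiteIndex
  let j : A →ₙₐ[ℤ] R :=
    { toFun := i
      map_smul' := fun m x => map_zsmul i m x
      map_zero' := map_zero i
      map_add' := map_add i
      map_mul' := map_mul i }
  have hB : ∀ r, ∃ a, r - j a ∈
      Submodule.span ℤ (Set.range (fun q : R ⧸ H => Quotient.out q)) := by
    intro r
    have h1 : -(Quotient.out (r : R ⧸ H)) + r ∈ H := by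
      rw [← QuotientAddGroup.eq]
      exact Quotient.out_eq (r : R ⧸ H)
    obtain ⟨a, ha⟩ := hH _ h1
    refine ⟨a, ?_⟩
    have h2 : r - j a = Quotient.out (r : R ⧸ H) := by
      change r - i a = _
      rw [ha]; abel
    rw [h2]
    exact Submodule.subset_span ⟨_, rfl⟩
  exact ⟨fp_ideal j hi hl _ hB, fp_ext j hi hl hr _ hB⟩

variable {R : Type*} [NonUnitalRing R]

/-- The largest two-sided ideal of `R` contained in the subring `S`. -/
def core (S : NonUnitalSubring R) : NonUnitalSubring R where
  carrier := {x | x ∈ S ∧ (∀ r, x * r ∈ S) ∧ (∀ r, r * x ∈ S) ∧ ∀ r r', r * x * r' ∈ S}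
  zero_mem' := by simp
  add_mem' := by
    rintro x y ⟨h1, h2, h3, h4⟩ ⟨k1, k2, k3, k4⟩
    refine ⟨S.add_mem h1 k1, fun r => ?_, fun r => ?_, fun r r' => ?_⟩
    · rw [add_mul]; exact S.add_mem (h2 r) (k2 r)
    · rw [mul_add]; exact S.add_mem (h3 r) (k3 r)
    · rw [mul_add, add_mul]; exact S.add_mem (h4 r r') (k4 r r')
  neg_mem' := by
    rintro x ⟨h1, h2, h3, h4⟩
    refine ⟨S.neg_mem h1, fun r => ?_, fun r => ?_, fun r r' => ?_⟩
    · rw [neg_mul]; exact S.neg_mem (h2 r)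
    · rw [mul_neg]; exact S.neg_mem (h3 r)
    · rw [mul_neg, neg_mul]; exact S.neg_mem (h4 r r')
  mul_mem' := by
    rintro x y ⟨h1, h2, h3, h4⟩ -
    refine ⟨h2 y, fun r => ?_, fun r => ?_, fun r r' => ?_⟩
    · rw [mul_assoc]; exact h2 _
    · rw [← mul_assoc]; exact h4 _ _
    · rw [← mul_assoc, mul_assoc]; exact h4 _ _

theorem mem_core {S : NonUnitalSubring R} {x : R} : x ∈ core S ↔
    x ∈ S ∧ (∀ r, x * r ∈ S) ∧ (∀ r, r * x ∈ S) ∧ ∀ r r', r * x * r' ∈ S := Iff.rfl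

theorem core_left {S : NonUnitalSubring R} (r : R) {x : R} (h : x ∈ core S) :
    r * x ∈ core S := by
  obtain ⟨h1, h2, h3, h4⟩ := mem_core.1 h
  refine mem_core.2 ⟨h3 r, h4 r, fun r' => ?_, fun r' r'' => ?_⟩
  · rw [← mul_assoc]; exact h3 _
  · rw [← mul_assoc]; exact h4 _ _

theorem core_right {S : NonUnitalSubring R} (r : R) {x : R} (h : x ∈ core S) :
    x * r ∈ core S := by
  obtain ⟨h1, h2, h3, h4⟩ := mem_core.1 h
  refine mem_core.2 ⟨h2 r, fun r' => ?_, fun r' => ?_, fun r' r'' => ?_⟩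
  · rw [mul_assoc]; exact h2 _
  · rw [← mul_assoc]; exact h4 _ _
  · rw [← mul_assoc, mul_assoc]; exact h4 _ _

theorem finiteIndex_comap (H : AddSubgroup R) [H.FiniteIndex] (f : R →+ R) :
    (H.comap f).FiniteIndex := by
  have : Finite (R ⧸ H) := AddSubgroup.finite_quotient_of_finiteIndex
  have h2 : H.comap f = ((QuotientAddGroup.mk' H).comp f).ker := by
    ext x; simp [AddMonoidHom.mem_ker]
  rw [h2]
  have : Finite (R ⧸ ((QuotientAddGroup.mk' H).comp f).ker) :=
    Finite.of_injective _ (QuotientAddGroup.kerLift_injective ((QuotientAddGroup.mk' H).comp f))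
  exact AddSubgroup.finiteIndex_of_finite_quotient

theorem core_finiteIndex (S : NonUnitalSubring R) (h : Finite (R ⧸ S.toAddSubgroup)) :
    (core S).toAddSubgroup.FiniteIndex := by
  have hS : S.toAddSubgroup.FiniteIndex := AddSubgroup.finiteIndex_of_finite_quotient
  let Q := R ⧸ S.toAddSubgroup
  let b : Q → R := fun q => Quotient.out q
  have hb : ∀ r, ∃ q, ∃ s ∈ S, r = b q + s := by
    intro r
    refine ⟨(r : Q), -(Quotient.out (r : Q)) + r, ?_, ?_⟩
    · change _ ∈ S.toAddSubgroup
      rw [← QuotientAddGroup.eq]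
      exact Quotient.out_eq (r : Q)
    · simp [b]
  let H1 := ⨅ q : Q, S.toAddSubgroup.comap (AddMonoidHom.mulRight (b q))
  let H2 := ⨅ q : Q, S.toAddSubgroup.comap (AddMonoidHom.mulLeft (b q))
  let H3 := ⨅ p : Q × Q, S.toAddSubgroup.comap
    ((AddMonoidHom.mulRight (b p.2)).comp (AddMonoidHom.mulLeft (b p.1)))
  have f1 : H1.FiniteIndex := AddSubgroup.finiteIndex_iInf fun _ => finiteIndex_comap _ _
  have f2 : H2.FiniteIndex := AddSubgroup.finiteIndex_iInf fun _ => finiteIndex_comap _ _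
  have f3 : H3.FiniteIndex := AddSubgroup.finiteIndex_iInf fun _ => finiteIndex_comap _ _
  have hle : S.toAddSubgroup ⊓ H1 ⊓ (H2 ⊓ H3) ≤ (core S).toAddSubgroup := by
    rintro x ⟨⟨h0, h1⟩, h2, h3⟩
    have h0 : x ∈ S := h0
    have h1 : ∀ q, x * b q ∈ S := fun q => (AddSubgroup.mem_iInf.1 h1 q)
    have h2 : ∀ q, b q * x ∈ S := fun q => (AddSubgroup.mem_iInf.1 h2 q)
    have h3 : ∀ q q', b q * x * b q' ∈ S := fun q q' => (AddSubgroup.mem_iInf.1 h3 (q, q'))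
    have g1 : ∀ r, x * r ∈ S := by
      intro r
      obtain ⟨q, s, hs, rfl⟩ := hb r
      rw [mul_add]
      exact S.add_mem (h1 q) (S.mul_mem h0 hs)
    have g2 : ∀ r, r * x ∈ S := by
      intro r
      obtain ⟨q, s, hs, rfl⟩ := hb r
      rw [add_mul]
      exact S.add_mem (h2 q) (S.mul_mem hs h0)
    have g3 : ∀ r r', r * x * r' ∈ S := by
      intro r r'
      obtain ⟨q, s, hs, rfl⟩ := hb r
      obtain ⟨q', s', hs', rfl⟩ := hb r'
      have : (b q + s) * x * (b q' + s') =
          b q * x * b q' + (b q * x) * s' + s * (x * (b q' + s')) := by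
        noncomm_ring
      rw [this]
      exact S.add_mem (S.add_mem (h3 q q') (S.mul_mem (h2 q) hs')) (S.mul_mem hs (g1 _))
    exact ⟨h0, g1, g2, g3⟩
  exact AddSubgroup.finiteIndex_of_le hle

theorem main (S : NonUnitalSubring R) (h : Finite (R ⧸ S.toAddSubgroup)) :
    NUAlgFP ℤ R ↔ NUAlgFP ℤ S := by
  have hJ := core_finiteIndex S h
  have hJS : core S ≤ S := fun x hx => (mem_core.1 hx).1
  have e1 : NUAlgFP ℤ R ↔ NUAlgFP ℤ (core S) :=
    fp_iff_of_ideal (NonUnitalSubringClass.subtype (core S)) Subtype.val_injective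
      (fun r a => ⟨⟨r * a, core_left r a.2⟩, rfl⟩)
      (fun r a => ⟨⟨a * r, core_right r a.2⟩, rfl⟩)
      (core S).toAddSubgroup (fun x hx => ⟨⟨x, hx⟩, rfl⟩) hJ
  have e2 : NUAlgFP ℤ S ↔ NUAlgFP ℤ (core S) :=
    fp_iff_of_ideal (NonUnitalSubring.inclusion hJS)
      (fun x y hxy => Subtype.ext (congrArg (fun z : S => (z : R)) hxy))
      (fun r a => ⟨⟨r * a, core_left _ a.2⟩, rfl⟩)
      (fun r a => ⟨⟨a * r, core_right _ a.2⟩, rfl⟩)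
      ((core S).toAddSubgroup.addSubgroupOf S.toAddSubgroup)
      (fun x hx => ⟨⟨x, hx⟩, rfl⟩)
      (AddSubgroup.instFiniteIndex_addSubgroupOf (core S).toAddSubgroup S.toAddSubgroup)
  exact e1.trans e2.symm

end assembly

end FPIdx

/-- Let `R` be a ring (not necessarily commutative or with identity,
i.e. a `ℤ`-algebra), and let `S` be a subring of finite index in `R` (as an additive
subgroup). Then `R` is finitely presented as a ring if and only if `S` is finitely
presented as a ring. -/
theorem subring_finite_index_fp_iff
    (R : Type*) [NonUnitalRing R] (S : NonUnitalSubring R)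
    (h : Finite (R ⧸ S.toAddSubgroup)) :
    NUAlgFP ℤ R ↔ NUAlgFP ℤ S := by
  exact FPIdx.main S h
end
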